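/- Let S = S_g be a closed orientable surface of genus g ≥ 2. If two isotopic separating essential simple closed curves β and γ in S intersect, then their compact elevations β̂ and γ̂ in the annular cover S̃_γ corresponding to their common isotopy class also intersect. -/

import Mathlib

noncomputable section

open Set

/-- The circle, as `ℝ / ℤ`. -/
abbrev Circle1 := AddCircle (1 : ℝ)

/-- `c` is a simple closed curve in `S`: the image of a continuous injection of the circle. -/
def IsSCC {S : Type} [TopologicalSpace S] (c : Set S) : Prop :=
  ∃ f : C(Circle1, S), Function.Injective f ∧ Set.range f = c

/-- A simple closed curve is essential if no parametrization of it is null-homotopic. -/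
def IsEssentialSCC {S : Type} [TopologicalSpace S] (c : Set S) : Prop :=
  IsSCC c ∧ ∀ f : C(Circle1, S), Set.range f = c →
    ¬ ∃ x : S, f.Homotopic (ContinuousMap.const Circle1 x)

/-- A simple closed curve is nonperipheral (with respect to the boundary `Bd`) if no
parametrization of it is freely homotopic to a loop contained in `Bd`. -/
def IsNonperipheralSCC {S : Type} [TopologicalSpace S] (Bd c : Set S) : Prop :=
  ∀ f : C(Circle1, S), Set.range f = c →
    ¬ ∃ g : C(Circle1, S), Set.range g ⊆ Bd ∧ f.Homotopic g

/-- An essential nonperipheral simple closed curve in the interior of the surface. -/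
def IsEssentialCurve {S : Type} [TopologicalSpace S] (Bd : Set S) (c : Set S) : Prop :=
  IsSCC c ∧ IsEssentialSCC c ∧ IsNonperipheralSCC Bd c ∧ Disjoint c Bd

/-- Two simple closed curves are isotopic (equivalently, for essential simple closed curves
on a surface, freely homotopic): some injective parametrizations are freely homotopic. -/
def CurvesIsotopic {S : Type} [TopologicalSpace S] (c d : Set S) : Prop :=
  ∃ f g : C(Circle1, S), Function.Injective f ∧ Function.Injective g ∧
    Set.range f = c ∧ Set.range g = d ∧ f.Homotopic g

/-- Identification relation defining the Möbius band as a quotient of the square. -/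
def MobiusRel (p q : unitInterval × unitInterval) : Prop :=
  p = q ∨ ((p.1 : ℝ) = 0 ∧ (q.1 : ℝ) = 1 ∧ (p.2 : ℝ) + (q.2 : ℝ) = 1)

/-- The Möbius band. -/
def MobiusBand : Type := Quot MobiusRel

instance : TopologicalSpace MobiusBand :=
  inferInstanceAs (TopologicalSpace (Quot MobiusRel))

/-- `S` is a compact connected orientable surface of genus `g` with `b` boundary components,
with boundary `Bd`.  Orientability is expressed as the nonexistence of an embedded Möbius
band, and the genus as the maximal number of disjoint simple closed curves with connected
complement. -/
def IsOrientedSurface (g b : ℕ) (S : Type) [TopologicalSpace S] (Bd : Set S) : Prop :=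
  CompactSpace S ∧ ConnectedSpace S ∧ T2Space S ∧ SecondCountableTopology S ∧
  IsClosed Bd ∧
  (∀ x : S, x ∉ Bd → ∃ U : Set S, IsOpen U ∧ x ∈ U ∧ Nonempty (U ≃ₜ (ℝ × ℝ))) ∧
  (∀ x ∈ Bd, ∃ U : Set S, IsOpen U ∧ x ∈ U ∧
      Nonempty (U ≃ₜ ({p : ℝ × ℝ | 0 ≤ p.2} : Set (ℝ × ℝ)))) ∧
  Nat.card (ConnectedComponents ↥Bd) = b ∧
  (¬ ∃ e : C(MobiusBand, S), Function.Injective e) ∧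
  (∃ F : Fin g → Set S, (∀ i, IsSCC (F i) ∧ Disjoint (F i) Bd) ∧
      Pairwise (Function.onFun Disjoint F) ∧ IsConnected (⋃ i, F i)ᶜ) ∧
  ¬ (∃ F : Fin (g + 1) → Set S, (∀ i, IsSCC (F i) ∧ Disjoint (F i) Bd) ∧
      Pairwise (Function.onFun Disjoint F) ∧ IsConnected (⋃ i, F i)ᶜ)

/-- Vertices of the fine curve graph: essential nonperipheral simple closed curves. -/
def CurveVert (S : Type) [TopologicalSpace S] (Bd : Set S) : Type :=
  {c : Set S // IsEssentialCurve Bd c}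

/-- The fine curve graph: edges connect (distinct) disjoint curves. -/
def fineCurveGraph (S : Type) [TopologicalSpace S] (Bd : Set S) :
    SimpleGraph (CurveVert S Bd) :=
  SimpleGraph.fromRel fun c d => Disjoint c.val d.val

/-- Isotopy, as a relation on vertices of the fine curve graph. -/
def isotopyRel (S : Type) [TopologicalSpace S] (Bd : Set S) :
    CurveVert S Bd → CurveVert S Bd → Prop :=
  fun c d => CurvesIsotopic c.val d.val

/-- Isotopy classes of essential nonperipheral simple closed curves. -/
def CurveClass (S : Type) [TopologicalSpace S] (Bd : Set S) : Type :=
  Quot (isotopyRel S Bd)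

/-- The (usual) curve graph: vertices are isotopy classes, edges connect classes
admitting disjoint representatives. -/
def curveGraph (S : Type) [TopologicalSpace S] (Bd : Set S) :
    SimpleGraph (CurveClass S Bd) :=
  SimpleGraph.fromRel fun x y => ∃ c d : CurveVert S Bd,
    Quot.mk _ c = x ∧ Quot.mk _ d = y ∧ Disjoint c.val d.val

/-- The star of a vertex of a graph: the vertex together with all its neighbors. -/
def graphStar {V : Type} (G : SimpleGraph V) (v : V) : Set V :=
  insert v (G.neighborSet v)

/-- `c00`: real sequences which are eventually `0`. -/
def c00 : Type := {f : ℕ → ℝ // ∀ᶠ n in Filter.atTop, f n = 0}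

/-- The `ℓ^∞` (supremum) distance on `c00`. -/
def c00Dist (f g : c00) : ℝ := ⨆ n, |f.val n - g.val n|

/-- `f : X → Y` is a quasi-isometric embedding with respect to the given distance
functions: `(1/K) d(x,x') - L ≤ d(f x, f x') ≤ K d(x,x') + L` for all `x, x'`. -/
def IsQIEmbedding {X Y : Type} (dX : X → X → ℝ) (dY : Y → Y → ℝ) (f : X → Y) : Prop :=
  ∃ K L : ℝ, 0 < K ∧ 0 ≤ L ∧ ∀ x x' : X,
    dX x x' / K - L ≤ dY (f x) (f x') ∧ dY (f x) (f x') ≤ K * dX x x' + L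

/-- Gromov hyperbolicity of a distance function, via the four-point condition
(equivalent, for geodesic spaces, to the thin-triangles condition). -/
def GromovHyperbolicDist {X : Type} (d : X → X → ℝ) : Prop :=
  ∃ δ : ℝ, 0 ≤ δ ∧ ∀ x y z w : X,
    d x y + d z w ≤ max (d x z + d y w) (d x w + d y z) + 2 * δ

/-- The `ℓ^∞` distance on `ℤ^N`. -/
def zNDist (N : ℕ) (u v : Fin N → ℤ) : ℝ :=
  ((Finset.univ.sup fun i => (u i - v i).natAbs : ℕ) : ℝ)
open scoped Classical

/-- An annular (cyclic) cover of the surface `S`: a covering map whose total space is an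
open annulus. -/
structure AnnCover (S : Type) [TopologicalSpace S] : Type 1 where
  /-- The total space of the cover. -/
  Tot : Type
  /-- The topology on the total space. -/
  top : TopologicalSpace Tot
  /-- The covering map. -/
  p : Tot → S
  cov : IsCoveringMap p
  annulus : Nonempty (Tot ≃ₜ (Circle1 × ℝ))

attribute [instance] AnnCover.top

/-- Elevations of a curve `δ` in the cover `C`: connected components of `p ⁻¹(δ)`. -/
def Elev {S : Type} [TopologicalSpace S] (C : AnnCover S) (δ : Set S) : Type :=
  {A : Set C.Tot // ∃ x ∈ C.p ⁻¹' δ, A = connectedComponentIn (C.p ⁻¹' δ) x}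

/-- Data exhibiting the compact elevation of a curve `δ` in the cover `C` (witnessing that
the cover corresponds to the homotopy class of `δ`: `δ` lifts bijectively to its compact
elevation), together with a choice of positive side of the compact elevation. -/
structure CurveLift {S : Type} [TopologicalSpace S] (C : AnnCover S) (δ : Set S) where
  /-- A point of the compact elevation. -/
  x0 : C.Tot
  mem : C.p x0 ∈ δ
  compact : IsCompact (connectedComponentIn (C.p ⁻¹' δ) x0)
  bij : Set.BijOn C.p (connectedComponentIn (C.p ⁻¹' δ) x0) δ
  /-- A point on the chosen positive side of the compact elevation. -/
  pos : C.Tot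
  pos_notin : pos ∉ connectedComponentIn (C.p ⁻¹' δ) x0

/-- The compact elevation, as a subset of the total space. -/
def hatSet {S : Type} [TopologicalSpace S] {C : AnnCover S} {δ : Set S}
    (D : CurveLift C δ) : Set C.Tot :=
  connectedComponentIn (C.p ⁻¹' δ) D.x0

/-- The compact elevation, as an elevation. -/
def hatElev {S : Type} [TopologicalSpace S] {C : AnnCover S} {δ : Set S}
    (D : CurveLift C δ) : Elev C δ :=
  ⟨hatSet D, D.x0, D.mem, rfl⟩

/-- The tree of elevations of `δ`: two elevations are adjacent exactly when they lie in
the closure of a common connected component of the complement of `p ⁻¹(δ)`. -/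
def elevTree {S : Type} [TopologicalSpace S] (C : AnnCover S) (δ : Set S) :
    SimpleGraph (Elev C δ) :=
  SimpleGraph.fromRel fun A B => ∃ x ∈ (C.p ⁻¹' δ)ᶜ,
    A.val ⊆ closure (connectedComponentIn (C.p ⁻¹' δ)ᶜ x) ∧
    B.val ⊆ closure (connectedComponentIn (C.p ⁻¹' δ)ᶜ x)

/-- The signed level of an elevation: its distance to the compact elevation in the tree of
elevations, with positive sign exactly for elevations on the chosen positive side. -/
def level {S : Type} [TopologicalSpace S] {C : AnnCover S} {δ : Set S}
    (D : CurveLift C δ) (A : Elev C δ) : ℤ :=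
  if A.val ⊆ connectedComponentIn (hatSet D)ᶜ D.pos
  then ((elevTree C δ).dist (hatElev D) A : ℤ)
  else -(((elevTree C δ).dist (hatElev D) A : ℕ) : ℤ)

/-- The set of levels of `δ` met by a subset `T` of the cover. -/
def levelsMet {S : Type} [TopologicalSpace S] {C : AnnCover S} {δ : Set S}
    (D : CurveLift C δ) (T : Set C.Tot) : Set ℤ :=
  {k | ∃ A : Elev C δ, level D A = k ∧ (A.val ∩ T).Nonempty}

/-- The `γ`-crossing number of `β`: the number of levels of `γ` intersected by the compact
elevation of `β` (and `0` when `β = γ`). -/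
def crossing {S : Type} [TopologicalSpace S] {C : AnnCover S} {γc βc : Set S}
    (D : CurveLift C γc) (E : CurveLift C βc) : ℕ :=
  if βc = γc then 0 else (levelsMet D (hatSet E)).ncard

/-- A simple closed curve is separating if its complement is disconnected. -/
def IsSeparating {S : Type} [TopologicalSpace S] (c : Set S) : Prop :=
  ¬ IsPreconnected cᶜ

namespace PlaneTop
open Filter Metric Topology Complex

/-! ### Linked points and continuous logarithms -/

/-- `a` and `b` lie in a common connected subset of `A`. -/
def Linked {X : Type*} [TopologicalSpace X] (A : Set X) (a b : X) : Prop :=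
  ∃ C : Set X, IsPreconnected C ∧ C ⊆ A ∧ a ∈ C ∧ b ∈ C

/-- The function `g` has a continuous logarithm on `K`. -/
def HasLog {X : Type*} [TopologicalSpace X] (K : Set X) (g : X → ℂ) : Prop :=
  ∃ l : X → ℂ, ContinuousOn l K ∧ ∀ z ∈ K, exp (l z) = g z

section Linked
variable {X Y : Type*} [TopologicalSpace X] [TopologicalSpace Y] {A B : Set X} {a b c : X}

theorem Linked.refl (ha : a ∈ A) : Linked A a a :=
  ⟨{a}, isPreconnected_singleton, by simpa, rfl, rfl⟩

theorem Linked.symm (h : Linked A a b) : Linked A b a := by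
  obtain ⟨C, h1, h2, h3, h4⟩ := h
  exact ⟨C, h1, h2, h4, h3⟩

theorem Linked.trans (h : Linked A a b) (h' : Linked A b c) : Linked A a c := by
  obtain ⟨C, h1, h2, h3, h4⟩ := h
  obtain ⟨D, k1, k2, k3, k4⟩ := h'
  exact ⟨C ∪ D, h1.union b h4 k3 k1, union_subset h2 k2, Or.inl h3, Or.inr k4⟩

theorem Linked.mono (h : Linked A a b) (hAB : A ⊆ B) : Linked B a b := by
  obtain ⟨C, h1, h2, h3, h4⟩ := h
  exact ⟨C, h1, h2.trans hAB, h3, h4⟩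

theorem Linked.mem_left (h : Linked A a b) : a ∈ A := by
  obtain ⟨C, h1, h2, h3, h4⟩ := h
  exact h2 h3

theorem Linked.mem_right (h : Linked A a b) : b ∈ A := h.symm.mem_left

theorem Linked.image {f : X → Y} (h : Linked A a b) (hf : ContinuousOn f A) :
    Linked (f '' A) (f a) (f b) := by
  obtain ⟨C, h1, h2, h3, h4⟩ := h
  exact ⟨f '' C, h1.image f (hf.mono h2), image_mono h2, mem_image_of_mem f h3,
    mem_image_of_mem f h4⟩

theorem linked_iff_mem : Linked A a b ↔ a ∈ A ∧ b ∈ connectedComponentIn A a := by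
  constructor
  · rintro ⟨C, h1, h2, h3, h4⟩
    exact ⟨h2 h3, h1.subset_connectedComponentIn h3 h2 h4⟩
  · rintro ⟨ha, hb⟩
    exact ⟨_, isPreconnected_connectedComponentIn, connectedComponentIn_subset A a,
      mem_connectedComponentIn ha, hb⟩

theorem Linked.mem_of_isOpen {U V : Set X} (h : Linked (U ∪ V) a b) (hU : IsOpen U)
    (hV : IsOpen V) (hUV : Disjoint U V) (ha : a ∈ U) : b ∈ U := by
  obtain ⟨C, h1, h2, h3, h4⟩ := h
  exact h1.subset_left_of_subset_union hU hV hUV h2 ⟨a, h3, ha⟩ h4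

end Linked

section Log
variable {X Y : Type*} [TopologicalSpace X] [TopologicalSpace Y] {K : Set X} {g h : X → ℂ}

theorem HasLog.congr (hg : HasLog K g) (hgh : EqOn g h K) : HasLog K h := by
  obtain ⟨l, hl, hl'⟩ := hg
  exact ⟨l, hl, fun z hz => (hl' z hz).trans (hgh hz)⟩

theorem HasLog.mul (hg : HasLog K g) (hh : HasLog K h) : HasLog K (fun z => g z * h z) := by
  obtain ⟨l, hl, hl'⟩ := hg
  obtain ⟨m, hm, hm'⟩ := hh
  exact ⟨fun z => l z + m z, hl.add hm, fun z hz => by rw [exp_add, hl' z hz, hm' z hz]⟩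

theorem HasLog.zpow (hg : HasLog K g) (n : ℤ) : HasLog K (fun z => g z ^ n) := by
  obtain ⟨l, hl, hl'⟩ := hg
  exact ⟨fun z => n * l z, continuousOn_const.mul hl, fun z hz => by
    rw [exp_int_mul, hl' z hz]⟩

theorem HasLog.inv (hg : HasLog K g) : HasLog K (fun z => (g z)⁻¹) := by
  simpa using hg.zpow (-1)

theorem HasLog.comp {f : Y → X} {M : Set Y} (hg : HasLog K g) (hf : ContinuousOn f M)
    (hM : MapsTo f M K) : HasLog M (fun y => g (f y)) := by
  obtain ⟨l, hl, hl'⟩ := hg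
  exact ⟨fun y => l (f y), hl.comp hf hM, fun y hy => hl' _ (hM hy)⟩

theorem hasLog_const {c : ℂ} (hc : c ≠ 0) : HasLog K (fun _ => c) :=
  ⟨fun _ => log c, continuousOn_const, fun _ _ => exp_log hc⟩

theorem hasLog_of_norm_sub_one_lt (hg : ContinuousOn g K) (h : ∀ z ∈ K, ‖g z - 1‖ < 1) :
    HasLog K g := by
  have key : ∀ z ∈ K, g z ∈ slitPlane := fun z hz => by
    have h1 := h z hz
    have : |(g z - 1).re| < 1 := (abs_re_le_norm _).trans_lt h1
    rw [abs_lt] at this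
    simp only [sub_re, one_re] at this
    exact Or.inl (by linarith)
  exact ⟨fun z => log (g z), hg.clog key, fun z hz => exp_log (slitPlane_ne_zero (key z hz))⟩

theorem exists_log_of_continuous [SimplyConnectedSpace X] [LocallyPathConnectedSpace X]
    (hg : Continuous g) (h0 : ∀ x, g x ≠ 0) : ∃ l : X → ℂ, Continuous l ∧ ∀ x, exp (l x) = g x := by
  have hs : IsSimplyConnected (univ : Set X) :=
    (Homeomorph.Set.univ X).toHomotopyEquiv.simplyConnectedSpace_iff.2 inferInstance
  obtain ⟨f, hf, hf'⟩ := exists_continuousOn_eqOn_exp_comp hs isOpen_univ hg.continuousOn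
    (by rintro ⟨x, -, hx⟩; exact h0 x hx)
  exact ⟨f, continuousOn_univ.1 hf, fun x => hf' (mem_univ x)⟩

theorem eq_of_log_eq_on {l m : X → ℂ} {C : Set X} (hC : IsPreconnected C)
    (hl : ContinuousOn l C) (hm : ContinuousOn m C) (h : ∀ x ∈ C, exp (l x) = exp (m x))
    {x y : X} (hx : x ∈ C) (hy : y ∈ C) : l x - m x = l y - m y := by
  set T : Set ℂ := range fun n : ℤ => (n : ℂ) * (2 * Real.pi * I)
  have hT : IsDiscrete T := by
    have : ∀ n m : ℤ, n ≠ m → (1:ℝ) ≤ dist ((n : ℂ) * (2 * Real.pi * I)) ((m : ℂ) * (2 * Real.pi * I)) := by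
      intro n m hnm
      rw [dist_eq, ← sub_mul, norm_mul, norm_mul, norm_mul, norm_I, ← Int.cast_sub, norm_intCast,
        norm_real, Real.norm_of_nonneg Real.pi_pos.le]
      have h1 : (1:ℝ) ≤ |((n - m : ℤ) : ℝ)| := by
        exact_mod_cast Int.one_le_abs (sub_ne_zero.2 hnm)
      have := Real.pi_gt_three
      norm_num
      push_cast at h1
      nlinarith
    constructor
    rw [discreteTopology_iff_isOpen_singleton]
    rintro ⟨_, n, rfl⟩
    rw [Metric.isOpen_iff]
    rintro _ rfl
    refine ⟨1, one_pos, ?_⟩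
    rintro ⟨_, m, rfl⟩ hm
    by_contra hne
    have hmn : m ≠ n := by rintro rfl; exact hne rfl
    have := this m n hmn
    rw [mem_ball, Subtype.dist_eq] at hm
    exact absurd hm (not_lt.2 this)
  refine hC.constant_of_mapsTo hT (hl.sub hm) (fun z hz => ?_) hx hy
  obtain ⟨n, hn⟩ := exp_eq_exp_iff_exists_int.1 (h z hz)
  exact ⟨n, by simp [hn]⟩

end Log
end PlaneTop

namespace PlaneTop
open Filter Metric Topology Complex

/-! ### Eilenberg's criterion and Janiszewski's theorem -/

theorem isPreconnected_lt_norm {R : ℝ} (hR : 0 < R) : IsPreconnected {z : ℂ | R < ‖z‖} := by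
  have : {z : ℂ | R < ‖z‖} = exp '' {z : ℂ | Real.log R < z.re} := by
    ext z
    simp only [mem_ofPred_eq, mem_image]
    constructor
    · intro hz
      have h0 : z ≠ 0 := by rintro rfl; simp at hz; linarith
      exact ⟨log z, by rw [log_re]; exact Real.log_lt_log hR hz, exp_log h0⟩
    · rintro ⟨w, hw, rfl⟩
      rw [norm_exp]
      exact (Real.log_lt_iff_lt_exp hR).1 hw
  rw [this]
  exact ((convex_halfSpace_re_gt _).isPreconnected).image _ continuous_exp.continuousOn

variable {K : Set ℂ} {a b : ℂ}

theorem hasLog_div_of_dist_lt {r : ℝ} (hb : ∀ z ∈ K, r ≤ ‖z - b‖) (hab : ‖a - b‖ < r) :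
    HasLog K (fun z => (z - a) / (z - b)) := by
  have hr : 0 < r := (norm_nonneg _).trans_lt hab
  have h0 : ∀ z ∈ K, z - b ≠ 0 := fun z hz => norm_pos_iff.1 (hr.trans_le (hb z hz))
  refine hasLog_of_norm_sub_one_lt (by fun_prop (disch := assumption)) fun z hz => ?_
  rw [div_sub_one (h0 z hz), norm_div, div_lt_one (hr.trans_le (hb z hz))]
  refine lt_of_lt_of_le ?_ (hb z hz)
  rwa [show z - a - (z - b) = -(a - b) by ring, norm_neg]

theorem exists_pos_le_norm_sub (hK : IsClosed K) (ha : a ∉ K) :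
    ∃ r > 0, ∀ z ∈ K, r ≤ ‖z - a‖ := by
  obtain ⟨r, hr, h⟩ := Metric.isOpen_iff.1 hK.isOpen_compl a ha
  refine ⟨r, hr, fun z hz => ?_⟩
  by_contra! hlt
  exact h (mem_ball_iff_norm.2 hlt) hz

theorem Linked.hasLog_div (hK : IsClosed K) (h : Linked Kᶜ a b) :
    HasLog K (fun z => (z - a) / (z - b)) := by
  obtain ⟨C, hC, hCK, ha, hb⟩ := h
  have hne : ∀ x ∈ C, ∀ z ∈ K, z - x ≠ 0 := by
    intro x hx z hz h0
    rw [sub_eq_zero] at h0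
    exact hCK hx (h0 ▸ hz)
  refine hC.induction₂ (fun a b => HasLog K (fun z => (z - a) / (z - b))) ?_ ?_ ?_ ha hb
  · intro x hx
    obtain ⟨r, hr, h⟩ := exists_pos_le_norm_sub hK (hCK hx)
    filter_upwards [mem_nhdsWithin_of_mem_nhds (ball_mem_nhds x hr)] with y hy
    have := (hasLog_div_of_dist_lt h (mem_ball_iff_norm.1 hy)).inv
    simpa using this
  · intro x y z hx hy hz h1 h2
    refine (h1.mul h2).congr fun w hw => ?_
    have := hne y hy w hw
    field_simp
  · intro x y hx hy h1
    simpa using h1.inv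

theorem hasLog_sub_of_lt_norm {R : ℝ} (hK : ∀ z ∈ K, ‖z‖ ≤ R) (ha : R < ‖a‖) :
    HasLog K (fun z => z - a) := by
  rcases K.eq_empty_or_nonempty with rfl | ⟨w, hw⟩
  · exact ⟨0, by simp, by simp⟩
  have h0 : a ≠ 0 := by
    rintro rfl
    rw [norm_zero] at ha
    exact absurd ((norm_nonneg w).trans (hK w hw)) (not_le.2 ha)
  have h1 : HasLog K (fun z => 1 - z / a) := by
    refine hasLog_of_norm_sub_one_lt (by fun_prop) fun z hz => ?_
    simp only [sub_sub_cancel_left, norm_neg, norm_div]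
    rw [div_lt_one (norm_pos_iff.2 h0)]
    exact (hK z hz).trans_lt ha
  refine (h1.mul (hasLog_const (neg_ne_zero.2 h0))).congr fun z _ => ?_
  field_simp
  ring

/-- The component of `a` in the complement of `K` is unbounded. -/
def Far (K : Set ℂ) (a : ℂ) : Prop := ∀ R : ℝ, ∃ b, R < ‖b‖ ∧ Linked Kᶜ a b

theorem Far.notMem (h : Far K a) : a ∉ K := by
  obtain ⟨b, -, hb⟩ := h 0
  exact hb.mem_left

theorem Far.hasLog (hK : IsCompact K) (h : Far K a) : HasLog K (fun z => z - a) := by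
  obtain ⟨R, hR⟩ := hK.isBounded.exists_norm_le
  obtain ⟨b, hb, hab⟩ := h R
  refine ((hab.hasLog_div hK.isClosed).mul (hasLog_sub_of_lt_norm hR hb)).congr fun z hz => ?_
  have : z - b ≠ 0 := by
    rw [sub_ne_zero]; rintro rfl; exact hab.mem_right hz
  simp only
  field_simp

theorem linked_of_lt_norm {R : ℝ} (hR : ∀ z ∈ K, ‖z‖ ≤ R) (ha : R < ‖a‖) (hb : R < ‖b‖) :
    Linked Kᶜ a b := by
  rcases K.eq_empty_or_nonempty with rfl | ⟨w, hw⟩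
  · exact ⟨univ, isPreconnected_univ, by simp, by simp, by simp⟩
  rcases (((norm_nonneg w).trans (hR w hw)).eq_or_lt) with h0 | h0
  · have hK0 : K ⊆ {0} := fun z hz => by simpa [← h0] using hR z hz
    refine ⟨{0}ᶜ, (isConnected_compl_singleton_of_one_lt_rank (by simp) 0).isPreconnected,
      compl_subset_compl.2 hK0, ?_, ?_⟩ <;> · rintro rfl; simp [← h0] at *
  · exact ⟨_, isPreconnected_lt_norm h0, fun z hz hzK => absurd (hR z hzK) (not_le.2 hz), ha, hb⟩

theorem Far.linked (hK : IsCompact K) (ha : Far K a) (hb : Far K b) : Linked Kᶜ a b := by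
  obtain ⟨R, hR⟩ := hK.isBounded.exists_norm_le
  obtain ⟨a', ha', haa⟩ := ha R
  obtain ⟨b', hb', hbb⟩ := hb R
  exact (haa.trans (linked_of_lt_norm hR ha' hb')).trans hbb.symm

theorem Far.of_linked (ha : Far K a) (h : Linked Kᶜ a b) : Far K b := fun R => by
  obtain ⟨c, hc, hac⟩ := ha R
  exact ⟨c, hc, h.symm.trans hac⟩

theorem far_of_lt_norm {R : ℝ} (hR : ∀ z ∈ K, ‖z‖ ≤ R) (ha : R < ‖a‖) : Far K a := fun R' => by
  refine ⟨((max (max R R') 0 + 1 : ℝ) : ℂ), ?_, linked_of_lt_norm hR ha ?_⟩ <;>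
  · rw [norm_real, Real.norm_of_nonneg (by positivity)]
    have := le_max_left (max R R') 0
    have := le_max_left R R'
    have := le_max_right R R'
    linarith

/-- On a large circle, `(z - a) ^ n` has no logarithm. -/
theorem not_hasLog_zpow_circle {R : ℝ} (hR : 0 < R) {n : ℤ} (hn : n ≠ 0) :
    ¬ HasLog (sphere a R) (fun z => (z - a) ^ n) := by
  intro h
  have hmaps : ∀ t : ℝ, a + R * exp (t * I) ∈ sphere a R := fun t => by
    simp [norm_exp_ofReal_mul_I, abs_of_pos hR]
  obtain ⟨l, hl, hl'⟩ := h
  have h1 : Continuous fun t : ℝ => l (a + R * exp (t * I)) :=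
    hl.comp_continuous (by fun_prop) hmaps
  have h2 : Continuous fun t : ℝ => (n : ℂ) * (Real.log R + t * I) := by fun_prop
  have := eq_of_log_eq_on (isPreconnected_univ (α := ℝ)) h1.continuousOn h2.continuousOn
    (fun t _ => by
      rw [hl' _ (hmaps t), exp_int_mul, exp_add, ← ofReal_exp, Real.exp_log hR]; simp)
    (mem_univ 0) (mem_univ (2 * Real.pi))
  have h3 : exp ((2 * Real.pi : ℝ) * I) = exp ((0 : ℝ) * I) := by simp
  rw [h3] at this
  have h4 : (n : ℂ) * (2 * Real.pi * I) = 0 := by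
    push_cast at this
    linear_combination this
  have hpi : (Real.pi : ℂ) ≠ 0 := by exact_mod_cast Real.pi_ne_zero
  simp [hn, hpi] at h4

/-- The hard direction of Eilenberg's criterion. -/
theorem far_of_hasLog (hK : IsCompact K) (ha : a ∉ K) {n : ℤ} (hn : n ≠ 0) {h : ℂ → ℂ}
    (hc : ContinuousOn h (K ∪ {z | Linked Kᶜ a z})) (h0 : ∀ z, z ∈ K ∨ Linked Kᶜ a z → h z ≠ 0)
    (hlog : HasLog K (fun z => (z - a) ^ n / h z)) : Far K a := by
  by_contra hfar
  have hfar' : ∃ R : ℝ, ∀ b, Linked Kᶜ a b → ‖b‖ ≤ R := by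
    simp only [Far, not_forall, not_exists, not_and'] at hfar
    obtain ⟨R, hR⟩ := hfar
    exact ⟨R, fun b hb => not_lt.1 (hR b hb)⟩
  obtain ⟨R, hR⟩ := hfar'
  set O : Set ℂ := {z | Linked Kᶜ a z} with hO
  have hOc : O = connectedComponentIn Kᶜ a := by
    ext z; simp [hO, linked_iff_mem, ha]
  have hOo : IsOpen O := by rw [hOc]; exact hK.isClosed.isOpen_compl.connectedComponentIn
  have haO : a ∈ O := Linked.refl ha
  have hfr : closure O ⊆ K ∪ O := by
    intro z hz
    by_contra hzn
    simp only [mem_union, not_or] at hzn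
    have hcc : connectedComponentIn Kᶜ z ∈ 𝓝 z :=
      (hK.isClosed.isOpen_compl.connectedComponentIn).mem_nhds (mem_connectedComponentIn hzn.1)
    obtain ⟨w, hw, hwO⟩ := mem_closure_iff_nhds.1 hz _ hcc
    exact hzn.2 (hwO.trans (linked_iff_mem.2 ⟨hzn.1, hw⟩ : Linked Kᶜ z w).symm)
  obtain ⟨l, hl, hl'⟩ := hlog
  obtain ⟨L, hL⟩ := ContinuousMap.exists_restrict_eq hK.isClosed
    (⟨K.domRestrict l, continuousOn_iff_continuous_domRestrict.1 hl⟩ : C(K, ℂ))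
  have hL' : ∀ z ∈ K, L z = l z := fun z hz => congrArg (fun f => f ⟨z, hz⟩) hL
  set r : ℂ → ℂ := O.piecewise (fun z => exp (L z) * h z) (fun z => (z - a) ^ n) with hr
  have hrc : Continuous r := by
    rw [← continuousOn_univ]
    refine ContinuousOn.piecewise ?_ ?_ ?_
    · rintro z ⟨-, hz⟩
      have hzK : z ∈ K := by
        rcases hfr hz.1 with h1 | h1
        · exact h1
        · exact absurd h1 (by rw [hOo.frontier_eq] at hz; exact hz.2)
      rw [hL' z hzK, hl' z hzK]
      exact div_mul_cancel₀ _ (h0 z (Or.inl hzK))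
    · rw [univ_inter]
      exact (by fun_prop : Continuous fun z => exp (L z)).continuousOn.mul (hc.mono hfr)
    · rw [univ_inter, hOo.isClosed_compl.closure_eq]
      refine ContinuousOn.zpow₀ (by fun_prop) n fun z hz => Or.inl ?_
      rw [sub_ne_zero]; rintro rfl; exact hz haO
  have hr0 : ∀ z, r z ≠ 0 := by
    intro z
    by_cases hz : z ∈ O
    · simp only [hr, piecewise_eq_of_mem _ _ _ hz]
      exact mul_ne_zero (exp_ne_zero _) (h0 z (Or.inr hz))
    · simp only [hr, piecewise_eq_of_notMem _ _ _ hz]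
      refine zpow_ne_zero _ ?_
      rw [sub_ne_zero]; rintro rfl; exact hz haO
  obtain ⟨m, hm, hm'⟩ := exists_log_of_continuous hrc hr0
  have hR0 : 0 ≤ R := (norm_nonneg a).trans (hR a haO)
  refine not_hasLog_zpow_circle (a := a) (R := 2 * R + 1) (by linarith) hn
    ⟨m, hm.continuousOn, fun z hz => ?_⟩
  rw [hm']
  refine piecewise_eq_of_notMem _ _ _ fun hzO => ?_
  have h1 := hR z hzO
  have h2 := hR a haO
  have h3 := norm_sub_le z a
  rw [mem_sphere_iff_norm] at hz
  linarith

theorem linked_of_hasLog_div (hK : IsCompact K) (ha : a ∉ K) (hb : b ∉ K) {n m : ℤ} (hn : n ≠ 0)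
    (hm : m ≠ 0) (h : HasLog K (fun z => (z - a) ^ n / (z - b) ^ m)) : Linked Kᶜ a b := by
  by_contra hab
  have key : ∀ a b : ℂ, b ∉ K → ¬ Linked Kᶜ a b → ∀ m : ℤ, 
      ContinuousOn (fun z => (z - b) ^ m) (K ∪ {z | Linked Kᶜ a z}) ∧
      ∀ z, z ∈ K ∨ Linked Kᶜ a z → (z - b) ^ m ≠ 0 := by
    intro a b hb hab m
    have h0 : ∀ z, z ∈ K ∨ Linked Kᶜ a z → z - b ≠ 0 := by
      intro z hz
      rw [sub_ne_zero]
      rintro rfl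
      exact hz.elim hb hab
    exact ⟨ContinuousOn.zpow₀ (by fun_prop) m fun z hz => Or.inl (h0 z hz),
      fun z hz => zpow_ne_zero _ (h0 z hz)⟩
  have h1 := far_of_hasLog hK ha hn (key a b hb hab m).1 (key a b hb hab m).2 h
  have hba : ¬ Linked Kᶜ b a := fun h => hab h.symm
  have h2 := far_of_hasLog hK hb hm (key b a ha hba n).1 (key b a ha hba n).2
    (by simpa using h.inv)
  exact hab (h1.linked hK h2)

theorem far_of_hasLog_sub (hK : IsCompact K) (ha : a ∉ K) (h : HasLog K (fun z => z - a)) :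
    Far K a :=
  far_of_hasLog hK ha one_ne_zero (h := fun _ => 1) continuousOn_const (by simp) (by simpa using h)

/-- **Janiszewski's theorem**. -/
theorem Linked.janiszewski {K₁ K₂ : Set ℂ} (h₁ : IsCompact K₁) (h₂ : IsCompact K₂)
    (h : IsPreconnected (K₁ ∩ K₂)) (hl₁ : Linked K₁ᶜ a b) (hl₂ : Linked K₂ᶜ a b) :
    Linked (K₁ ∪ K₂)ᶜ a b := by
  obtain ⟨l, hl, hl'⟩ := hl₁.hasLog_div h₁.isClosed
  obtain ⟨m, hm, hm'⟩ := hl₂.hasLog_div h₂.isClosed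
  have hex : ∃ c : ℂ, exp c = 1 ∧ ∀ z ∈ K₁ ∩ K₂, l z = m z + c := by
    rcases (K₁ ∩ K₂).eq_empty_or_nonempty with h0 | ⟨w, hw⟩
    · exact ⟨0, by simp, by simp [h0]⟩
    · refine ⟨l w - m w, ?_, fun z hz => ?_⟩
      · rw [exp_sub, hl' w hw.1, hm' w hw.2, div_self]
        rw [← hl' w hw.1]
        exact exp_ne_zero _
      · have := eq_of_log_eq_on h (hl.mono inter_subset_left) (hm.mono inter_subset_right)
          (fun x hx => (hl' x hx.1).trans (hm' x hx.2).symm) hz hw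
        linear_combination this
  obtain ⟨c, hc, hcl⟩ := hex
  refine linked_of_hasLog_div (h₁.union h₂) (n := 1) (m := 1) ?_ ?_ one_ne_zero one_ne_zero ?_
  · exact fun h => h.elim hl₁.mem_left hl₂.mem_left
  · exact fun h => h.elim hl₁.mem_right hl₂.mem_right
  refine ⟨K₁.piecewise l (fun z => m z + c), ?_, ?_⟩
  · refine ContinuousOn.union_of_isClosed ?_ ?_ h₁.isClosed h₂.isClosed
    · exact hl.congr fun z hz => piecewise_eq_of_mem _ _ _ hz
    · refine (hm.add (continuousOn_const : ContinuousOn (fun _ => c) K₂)).congr fun z hz => ?_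
      by_cases hz1 : z ∈ K₁
      · simpa [piecewise_eq_of_mem _ _ _ hz1] using hcl z ⟨hz1, hz⟩
      · simp [piecewise_eq_of_notMem _ _ _ hz1]
  · intro z hz
    simp only [zpow_one]
    by_cases hz1 : z ∈ K₁
    · rw [piecewise_eq_of_mem _ _ _ hz1, hl' z hz1]
    · rw [piecewise_eq_of_notMem _ _ _ hz1, exp_add, hc, mul_one, hm' z (hz.resolve_left hz1)]

end PlaneTop

namespace PlaneTop
open Filter Metric Topology Complex

/-! ### Jordan curves -/

section Degree
variable {X : Type*} [TopologicalSpace X]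

theorem hasLog_range {Y : Type*} [TopologicalSpace Y] {f : Y → X} (hf : IsEmbedding f) {g : X → ℂ}
    (h : HasLog univ (fun y => g (f y))) : HasLog (range f) g := by
  obtain ⟨l, hl, hl'⟩ := h
  rw [continuousOn_univ] at hl
  rcases isEmpty_or_nonempty Y with hY | hY
  · exact ⟨fun _ => 0, continuousOn_const, by rintro _ ⟨y, -⟩; exact hY.elim y⟩
  have hinv : ∀ y, Function.invFun f (f y) = y := Function.leftInverse_invFun hf.injective
  refine ⟨fun z => l (Function.invFun f z), ?_, ?_⟩
  · rw [continuousOn_iff_continuous_domRestrict]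
    have : (range f).domRestrict (fun z => l (Function.invFun f z)) =
        fun z => l (hf.toHomeomorph.symm z) := by
      funext z
      obtain ⟨y, rfl⟩ := hf.toHomeomorph.surjective z
      rw [hf.toHomeomorph.symm_apply_apply]
      exact congrArg l (hinv y)
    rw [this]
    exact hl.comp (hf.toHomeomorph.symm.continuous)
  · rintro _ ⟨y, rfl⟩
    simp only [hinv]
    exact hl' y trivial

/-- `l` is a continuous logarithm of `g` along the loop `f` with increment `2πin`. -/
structure IsLift (f : Circle1 → X) (g : X → ℂ) (l : ℝ → ℂ) (n : ℤ) : Prop where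
  cont : Continuous l
  exp_eq : ∀ t : ℝ, exp (l t) = g (f t)
  add_one : ∀ t : ℝ, l (t + 1) = l t + n * (2 * Real.pi * I)

theorem exists_isLift {f : Circle1 → X} (hf : Continuous f) {g : X → ℂ}
    (hg : ContinuousOn g (range f)) (h0 : ∀ z ∈ range f, g z ≠ 0) : ∃ l n, IsLift f g l n := by
  obtain ⟨l, hl, hl'⟩ := exists_log_of_continuous (X := ℝ) (g := fun t : ℝ => g (f t))
    (hg.comp_continuous (hf.comp (AddCircle.continuous_mk' 1)) fun t => mem_range_self _)
    (fun t => h0 _ (mem_range_self _))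
  have hper : ∀ t : ℝ, exp (l (t + 1)) = exp (l t) := fun t => by
    rw [hl', hl', AddCircle.coe_add_period]
  obtain ⟨n, hn⟩ := exp_eq_exp_iff_exists_int.1 (hper 0)
  refine ⟨l, n, hl, hl', fun t => ?_⟩
  have := eq_of_log_eq_on (isPreconnected_univ (α := ℝ)) (l := fun t => l (t + 1)) (m := l)
    (by fun_prop) hl.continuousOn (fun t _ => hper t) (mem_univ t) (mem_univ 0)
  linear_combination this + hn

omit [TopologicalSpace X] in
theorem IsLift.add_int {f : Circle1 → X} {g : X → ℂ} {l : ℝ → ℂ} {n : ℤ} (h : IsLift f g l n)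
    (t : ℝ) (k : ℤ) : l (t + k) = l t + k * (n * (2 * Real.pi * I)) := by
  induction k using Int.induction_on with
  | zero => simp
  | succ k ih => 
    push_cast at ih ⊢
    rw [← add_assoc, h.add_one, ih]; ring
  | pred k ih => 
    have := h.add_one (t + ((-k - 1 : ℤ) : ℝ))
    push_cast at ih this ⊢
    rw [show t + (-(k:ℝ) - 1) + 1 = t + -k by ring, ih] at this
    linear_combination -this

theorem IsLift.hasLog {f : Circle1 → X} (hf : IsEmbedding f) {g : X → ℂ} {l : ℝ → ℂ}
    (h : IsLift f g l 0) : HasLog (range f) g := by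
  have hper : Function.Periodic l 1 := fun t => by simpa using h.add_one t
  refine hasLog_range hf ⟨hper.lift, (continuous_quot_lift _ h.cont).continuousOn, fun y _ => ?_⟩
  obtain ⟨t, rfl⟩ := QuotientAddGroup.mk_surjective y
  exact h.exp_eq t

theorem IsLift.eq_zero_of_hasLog {f : Circle1 → X} (hf : Continuous f) {g : X → ℂ} {l : ℝ → ℂ}
    {n : ℤ} (h : IsLift f g l n) (hg : HasLog (range f) g) : n = 0 := by
  obtain ⟨m, hm, hm'⟩ := hg
  have := eq_of_log_eq_on (isPreconnected_univ (α := ℝ)) (l := l) (m := fun t : ℝ => m (f t))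
    h.cont.continuousOn
    (hm.comp_continuous (hf.comp (AddCircle.continuous_mk' 1)) fun t => mem_range_self _).continuousOn
    (fun t _ => by rw [h.exp_eq, hm' _ (mem_range_self _)]) (mem_univ ((0:ℝ) + 1)) (mem_univ 0)
  rw [h.add_one, AddCircle.coe_add_period] at this
  have h2 : (n : ℂ) * (2 * Real.pi * I) = 0 := by linear_combination this
  have hpi : (Real.pi : ℂ) ≠ 0 := by exact_mod_cast Real.pi_ne_zero
  simpa [hpi] using h2

omit [TopologicalSpace X] in
theorem IsLift.mul {f : Circle1 → X} {g g' : X → ℂ} {l l' : ℝ → ℂ} {n n' : ℤ}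
    (h : IsLift f g l n) (h' : IsLift f g' l' n') (a b : ℤ) :
    IsLift f (fun z => g z ^ a / g' z ^ b) (fun t => a * l t - b * l' t) (a * n - b * n') where
  cont := (continuous_const.mul h.cont).sub (continuous_const.mul h'.cont)
  exp_eq t := by rw [exp_sub, exp_int_mul, exp_int_mul, h.exp_eq, h'.exp_eq]
  add_one t := by rw [h.add_one, h'.add_one]; push_cast; ring

end Degree

theorem far_of_norm_le {K : Set ℂ} {a : ℂ} (h : ∀ z ∈ K, ‖z‖ ≤ ‖a‖) (ha : a ∉ K) (h0 : a ≠ 0) :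
    Far K a := fun R => by
  have ha0 : 0 < ‖a‖ := norm_pos_iff.2 h0
  have hn : ∀ s : ℝ, 1 ≤ s → ‖(s : ℂ) * a‖ = s * ‖a‖ := fun s hs => by
    rw [norm_mul, norm_real, Real.norm_of_nonneg (by linarith)]
  set s : ℝ := max 1 ((R + 1) / ‖a‖) with hs
  have hs1 : 1 ≤ s := le_max_left _ _
  refine ⟨s * a, ?_, (fun s : ℝ => (s : ℂ) * a) '' Ici 1, ?_, ?_, ⟨1, by simp⟩, ⟨s, hs1, rfl⟩⟩
  · rw [hn s hs1]
    have : (R + 1) / ‖a‖ ≤ s := le_max_right _ _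
    rw [div_le_iff₀ ha0] at this
    linarith
  · exact isPreconnected_Ici.image _ (by fun_prop)
  · rintro _ ⟨s, hs, rfl⟩ hz
    have h1 := h _ hz
    simp only at h1
    rw [hn s hs] at h1
    have : s = 1 := le_antisymm (by nlinarith) hs
    subst this
    simp at hz
    exact ha hz

theorem linked_zero_of_le_norm {K : Set ℂ} {a : ℂ} (h : ∀ z ∈ K, ‖a‖ ≤ ‖z‖) (ha : a ∉ K)
    (h0 : a ≠ 0) : Linked Kᶜ 0 a := by
  refine ⟨(fun s : ℝ => (s : ℂ) * a) '' Icc 0 1, isPreconnected_Icc.image _ (by fun_prop), ?_,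
    ⟨0, by simp⟩, ⟨1, by simp⟩⟩
  rintro _ ⟨s, hs, rfl⟩ hz
  have h1 := h _ hz
  have ha0 : 0 < ‖a‖ := norm_pos_iff.2 h0
  simp only at h1
  rw [norm_mul, norm_real, Real.norm_of_nonneg hs.1] at h1
  have : s = 1 := le_antisymm hs.2 (by nlinarith)
  subst this
  simp at hz
  exact ha hz

section Jordan
variable {f : Circle1 → ℂ} (hf : IsEmbedding f) {a b : ℂ}
include hf

theorem isCompact_range_loop : IsCompact (range f) := isCompact_range hf.continuous

theorem isPreconnected_range_loop : IsPreconnected (range f) := isPreconnected_range hf.continuous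

theorem exists_isLift_sub (ha : a ∉ range f) : ∃ l n, IsLift f (fun z => z - a) l n :=
  exists_isLift hf.continuous (by fun_prop) fun z hz => by
    rw [sub_ne_zero]; rintro rfl; exact ha hz

/-- The complement of a Jordan curve has at most one bounded component. -/
theorem linked_of_not_far (ha : a ∉ range f) (hb : b ∉ range f) (ha' : ¬ Far (range f) a)
    (hb' : ¬ Far (range f) b) : Linked (range f)ᶜ a b := by
  obtain ⟨l, n, hl⟩ := exists_isLift_sub hf ha
  obtain ⟨l', n', hl'⟩ := exists_isLift_sub hf hb
  have hK := isCompact_range_loop hf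
  have hn : n ≠ 0 := by
    rintro rfl; exact ha' (far_of_hasLog_sub hK ha (hl.hasLog hf))
  have hn' : n' ≠ 0 := by
    rintro rfl; exact hb' (far_of_hasLog_sub hK hb (hl'.hasLog hf))
  have := hl.mul hl' n' n
  rw [mul_comm, sub_self] at this
  exact linked_of_hasLog_div hK ha hb hn' hn (this.hasLog hf)

theorem not_far_iff_linked (ha : a ∉ range f) (ha' : ¬ Far (range f) a) :
    (b ∉ range f ∧ ¬ Far (range f) b) ↔ Linked (range f)ᶜ a b :=
  ⟨fun h => linked_of_not_far hf ha h.1 ha' h.2, fun h => ⟨h.mem_right,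
    fun hb => ha' (hb.of_linked h.symm)⟩⟩

/-- The increment of the logarithm along a Jordan curve around `0` is `±2πi`. -/
theorem IsLift.natAbs_eq_one {l : ℝ → ℂ} {n : ℤ} (h : IsLift f id l n) (hn : n ≠ 0) :
    n.natAbs = 1 := by
  by_contra hn1
  have hnC : (n : ℂ) ≠ 0 := by exact_mod_cast hn
  have hπ : (2 * Real.pi * I : ℂ) ≠ 0 := by
    simp [Real.pi_ne_zero]
  set l' : ℝ → ℂ := fun t => l t / n with hl'
  have hl1 : ∀ t, l' (t + 1) = l' t + 2 * Real.pi * I := fun t => by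
    simp only [hl', h.add_one]; field_simp
  have hcl : Continuous l' := h.cont.div_const _
  have hper : Function.Periodic (fun t => exp (l' t)) 1 := fun t => by
    simp only [hl1]; exact exp_periodic _
  set F : Circle1 → ℂ := hper.lift with hF
  have hFt : ∀ t : ℝ, F t = exp (l' t) := fun t => rfl
  have hFc : Continuous F := continuous_quot_lift _ (by fun_prop)
  set ρ : ℂ := exp (2 * Real.pi * I / n) with hρ
  have hρ1 : ‖ρ‖ = 1 := by
    have : (2 * Real.pi * I / n : ℂ) = ((2 * Real.pi / n : ℝ) : ℂ) * I := by push_cast; ring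
    rw [hρ, this, norm_exp_ofReal_mul_I]
  have key : ∀ y y', F y ≠ ρ * F y' := by
    intro y y' hyy
    obtain ⟨s, rfl⟩ := QuotientAddGroup.mk_surjective y
    obtain ⟨t, rfl⟩ := QuotientAddGroup.mk_surjective y'
    change exp (l' s) = ρ * exp (l' t) at hyy
    rw [hρ, ← exp_add] at hyy
    obtain ⟨k, hk⟩ := exp_eq_exp_iff_exists_int.1 hyy
    have h1 : l s = l t + ((1 + k * n : ℤ) : ℂ) * (2 * Real.pi * I) := by
      simp only [hl'] at hk
      field_simp at hk
      push_cast
      linear_combination hk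
    have h2 : exp (l s) = exp (l t) := exp_eq_exp_iff_exists_int.2 ⟨_, h1⟩
    rw [h.exp_eq, h.exp_eq] at h2
    have h3 := hf.injective h2
    rw [← sub_eq_zero, ← AddCircle.coe_sub, AddCircle.coe_eq_zero_iff] at h3
    obtain ⟨m, hm⟩ := h3
    rw [zsmul_eq_mul, mul_one] at hm
    rw [show s = t + m by linarith, h.add_int] at h1
    have h4 : ((m * n - (1 + k * n) : ℤ) : ℂ) * (2 * Real.pi * I) = 0 := by
      push_cast; push_cast at h1; linear_combination h1
    have h5 : m * n - (1 + k * n) = 0 := by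
      exact_mod_cast (mul_eq_zero.1 h4).resolve_right hπ
    apply hn1
    have : n ∣ 1 := ⟨m - k, by linarith⟩
    exact Int.isUnit_iff_natAbs_eq.1 (isUnit_of_dvd_one this)
  have hpow : ∀ y, F y ^ n = f y := fun y => by
    obtain ⟨t, rfl⟩ := QuotientAddGroup.mk_surjective y
    change exp (l' t) ^ n = f t
    rw [← exp_int_mul, mul_div_cancel₀ _ hnC, h.exp_eq]; rfl
  have hFi : Function.Injective F := fun y y' hy => hf.injective (by rw [← hpow, ← hpow, hy])
  have hFe : IsEmbedding F := (hFc.isClosedEmbedding hFi).isEmbedding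
  have hFl : IsLift F id l' 1 := ⟨hcl, fun t => rfl, fun t => by simp [hl1]⟩
  have hF0 : ∀ y, F y ≠ 0 := fun y h0 => by
    obtain ⟨t, rfl⟩ := QuotientAddGroup.mk_surjective y
    exact exp_ne_zero _ h0
  have hK := isCompact_range_loop hFe
  have hfar : ¬ Far (range F) 0 := fun h0 => by
    simpa using hFl.eq_zero_of_hasLog hFc ((h0.hasLog hK).congr fun z _ => sub_zero z)
  obtain ⟨y₁, -, hy₁⟩ := isCompact_univ.exists_isMaxOn univ_nonempty hFc.norm.continuousOn
  obtain ⟨y₂, -, hy₂⟩ := isCompact_univ.exists_isMinOn univ_nonempty hFc.norm.continuousOn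
  have hnorm : ∀ y, ‖ρ * F y‖ = ‖F y‖ := fun y => by rw [norm_mul, hρ1, one_mul]
  have hmem : ∀ y, ρ * F y ∉ range F := by rintro y ⟨y', hy'⟩; exact key _ _ hy'
  have hne : ∀ y, ρ * F y ≠ 0 := fun y => mul_ne_zero (exp_ne_zero _) (hF0 y)
  have h1 : Far (range F) (ρ * F y₁) := far_of_norm_le
    (by rintro _ ⟨y, rfl⟩; rw [hnorm]; exact hy₁ (mem_univ y)) (hmem _) (hne _)
  have h2 : Linked (range F)ᶜ 0 (ρ * F y₂) := linked_zero_of_le_norm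
    (by rintro _ ⟨y, rfl⟩; rw [hnorm]; exact hy₂ (mem_univ y)) (hmem _) (hne _)
  have h3 : Linked (range F)ᶜ (ρ * F y₂) (ρ * F y₁) :=
    ⟨range fun y => ρ * F y, isPreconnected_range (by fun_prop),
      by rintro _ ⟨y, rfl⟩; exact hmem y, ⟨_, rfl⟩, ⟨_, rfl⟩⟩
  exact hfar (h1.of_linked (h2.trans h3).symm)

/-- A nonempty open arc can be removed from a Jordan curve to make its complement connected. -/
theorem exists_subset_far {x : ℂ} (hx : x ∈ range f) {N : Set ℂ} (hN : N ∈ 𝓝 x) (h0 : 0 ∉ range f) :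
    ∃ A ⊆ range f, IsClosed A ∧ range f ⊆ A ∪ N ∧ Far A 0 := by
  obtain ⟨l, n, hl⟩ := exists_isLift (g := id) hf.continuous continuousOn_id
    (by rintro z hz rfl; exact h0 hz)
  obtain ⟨y, rfl⟩ := hx
  obtain ⟨t, rfl⟩ := QuotientAddGroup.mk_surjective y
  obtain ⟨ε, hε, hball⟩ := Metric.mem_nhds_iff.1
    ((hf.continuous.comp (AddCircle.continuous_mk' 1)).continuousAt.preimage_mem_nhds hN)
  set δ := min (ε / 2) (1 / 4) with hδ
  have hδε : δ < ε := by linarith [min_le_left (ε / 2) (1 / 4 : ℝ)]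
  have hδ2 : δ < 1 / 2 := by linarith [min_le_right (ε / 2) (1 / 4 : ℝ)]
  have hδ0 : 0 < δ := lt_min (by linarith) (by norm_num)
  set e : Icc (t + δ) (t + 1 - δ) → ℂ := fun s => f (s : ℝ) with he
  have hec : Continuous e :=
    hf.continuous.comp ((AddCircle.continuous_mk' 1).comp continuous_subtype_val)
  have hei : Function.Injective e := fun s s' hss => by
    have h1 := hf.injective hss
    rw [AddCircle.coe_eq_coe_iff_of_mem_Ico (a := t)] at h1
    · exact Subtype.ext h1
    · exact ⟨by linarith [s.2.1], by linarith [s.2.2]⟩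
    · exact ⟨by linarith [s'.2.1], by linarith [s'.2.2]⟩
  have hAJ : range e ⊆ range f := by rintro _ ⟨s, rfl⟩; exact mem_range_self _
  refine ⟨range e, hAJ, (isCompact_range hec).isClosed, ?_, ?_⟩
  · rintro _ ⟨y, rfl⟩
    obtain ⟨s, hs, rfl⟩ : y ∈ ((↑) : ℝ → Circle1) '' Ico (t - δ) (t - δ + 1) := by
      rw [AddCircle.coe_image_Ico_eq]; trivial
    by_cases hs' : s < t + δ
    · refine Or.inr (hball ?_)
      rw [mem_ball, Real.dist_eq, abs_lt]
      constructor <;> linarith [hs.1]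
    · exact Or.inl ⟨⟨s, by linarith, by linarith [hs.2]⟩, rfl⟩
  · have hlog : HasLog (range e) (fun z => z) :=
      hasLog_range (hec.isClosedEmbedding hei).isEmbedding
        ⟨fun s => l s, (hl.cont.comp continuous_subtype_val).continuousOn, fun s _ => hl.exp_eq s⟩
    exact far_of_hasLog_sub (isCompact_range hec) (fun h => h0 (hAJ h))
      (hlog.congr fun z _ => (sub_zero z).symm)

/-- Both components of the complement of a Jordan curve accumulate everywhere on it. -/
theorem range_subset_closure (h0 : 0 ∉ range f) (h0' : ¬ Far (range f) 0) :
    range f ⊆ closure {z | Linked (range f)ᶜ 0 z} ∩ closure {z | Far (range f) z} := by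
  have hK := isCompact_range_loop hf
  have key : ∀ B : Set ℂ, IsOpen B → closure B ⊆ B ∪ range f → B ⊆ (range f)ᶜ →
      (∀ A ⊆ range f, Far A 0 → ∃ a b, a ∈ B ∧ b ∉ B ∧ b ∉ range f ∧ Linked Aᶜ a b) →
      range f ⊆ closure B := by
    intro B hB hBc hBf hBA x hx
    by_contra hxB
    obtain ⟨A, hA, hAc, hAN, hAfar⟩ := exists_subset_far hf hx
      (isClosed_closure.isOpen_compl.mem_nhds hxB) h0
    obtain ⟨a, b, ha, hb, hbf, C, hC, hCA, haC, hbC⟩ := hBA A hA hAfar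
    have h1 : C ⊆ B ∪ (closure B)ᶜ := by
      intro c hc
      by_contra hcn
      simp only [mem_union, mem_compl_iff, not_or, not_not] at hcn
      rcases hAN ((hBc hcn.2).resolve_left hcn.1) with h | h
      · exact hCA hc h
      · exact h hcn.2
    exact hb (hC.subset_left_of_subset_union hB isClosed_closure.isOpen_compl
      (disjoint_compl_right.mono_left subset_closure).symm.symm h1 ⟨a, haC, ha⟩ hbC)
  have hcl : ∀ B : Set ℂ, IsOpen B → (∀ a b, Linked (range f)ᶜ a b → b ∈ B → a ∈ B) →
      closure B ⊆ B ∪ range f := by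
    intro B hB hBl z hz
    by_contra hzn
    simp only [mem_union, not_or] at hzn
    have hcc : connectedComponentIn (range f)ᶜ z ∈ 𝓝 z :=
      (hK.isClosed.isOpen_compl.connectedComponentIn).mem_nhds (mem_connectedComponentIn hzn.2)
    obtain ⟨w, hw, hwO⟩ := mem_closure_iff_nhds.1 hz _ hcc
    exact hzn.1 (hBl z w (linked_iff_mem.2 ⟨hzn.2, hw⟩) hwO)
  have hopen : ∀ B : Set ℂ, B ⊆ (range f)ᶜ → (∀ a b, Linked (range f)ᶜ a b → b ∈ B → a ∈ B) →
      IsOpen B := by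
    intro B hBf hBl
    rw [isOpen_iff_mem_nhds]
    intro z hz
    refine mem_of_superset ((hK.isClosed.isOpen_compl.connectedComponentIn).mem_nhds
      (mem_connectedComponentIn (hBf hz))) fun w hw => ?_
    exact hBl w z (linked_iff_mem.2 ⟨hBf hz, hw⟩).symm hz
  have hB1 : {z | Linked (range f)ᶜ 0 z} ⊆ (range f)ᶜ := fun z hz => hz.mem_right
  have hB2 : {z | Far (range f) z} ⊆ (range f)ᶜ := fun z hz => hz.notMem
  have hl1 : ∀ a b, Linked (range f)ᶜ a b → b ∈ {z | Linked (range f)ᶜ 0 z} →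
      a ∈ {z | Linked (range f)ᶜ 0 z} := fun a b hab hb => hb.trans hab.symm
  have hl2 : ∀ a b, Linked (range f)ᶜ a b → b ∈ {z | Far (range f) z} →
      a ∈ {z | Far (range f) z} := fun a b hab hb => hb.of_linked hab.symm
  obtain ⟨R, hR⟩ := hK.isBounded.exists_norm_le
  have hfar : ∀ b, R < ‖b‖ → Far (range f) b := fun b hb => far_of_lt_norm hR hb
  refine subset_inter (key _ (hopen _ hB1 hl1) (hcl _ (hopen _ hB1 hl1) hl1) hB1 ?_)
    (key _ (hopen _ hB2 hl2) (hcl _ (hopen _ hB2 hl2) hl2) hB2 ?_)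
  · intro A hA hA0
    obtain ⟨b, hb, hb'⟩ := hA0 R
    exact ⟨0, b, Linked.refl h0, fun h => h0' ((hfar b hb).of_linked h.symm), (hfar b hb).notMem, hb'⟩
  · intro A hA hA0
    obtain ⟨b, hb, hb'⟩ := hA0 R
    exact ⟨b, 0, hfar b hb, h0', h0, hb'.symm⟩

end Jordan

theorem isPreconnected_thickening {J : Set ℂ} (hJ : IsCompact J) (hJp : IsPreconnected J)
    (hne : J.Nonempty) (ε : ℝ) : IsPreconnected {z | infDist z J < ε} := by
  obtain ⟨w, hw⟩ := hne
  refine isPreconnected_of_forall w fun z hz => ?_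
  obtain ⟨v, hv, hzv⟩ := hJ.exists_infDist_eq_dist ⟨w, hw⟩ z
  refine ⟨J ∪ segment ℝ z v, ?_, Or.inl hw, Or.inr (left_mem_segment _ _ _),
    hJp.union v hv (right_mem_segment _ _ _) (convex_segment _ _).isPreconnected⟩
  have hε : 0 < ε := infDist_nonneg.trans_lt hz
  rintro y (hy | hy)
  · rw [mem_ofPred_eq, infDist_zero_of_mem hy]; exact hε
  · rw [mem_ofPred_eq] at hz ⊢
    refine (infDist_le_dist_of_mem hv).trans_lt (lt_of_le_of_lt ?_ (hzv ▸ hz))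
    rw [dist_comm y, dist_comm z]
    have := (convex_closedBall v (dist v z)).segment_subset (x := z) (y := v)
      (by simp [dist_comm]) (by simp) hy
    rwa [mem_closedBall, dist_comm] at this

/-- Points near a continuum which can be linked off it can be linked near it. -/
theorem Linked.near {J : Set ℂ} (hJ : IsCompact J) (hJp : IsPreconnected J) (hne : J.Nonempty)
    {ε : ℝ} {a b : ℂ} (h : Linked Jᶜ a b) (ha : infDist a J < ε) (hb : infDist b J < ε) :
    Linked {z | z ∉ J ∧ infDist z J < ε} a b := by
  have hε : 0 < ε := infDist_nonneg.trans_lt ha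
  have hcont : Continuous fun z => infDist z J := continuous_infDist_pt J
  have hC : IsCompact {z | infDist z J = ε} := by
    refine Metric.isCompact_of_isClosed_isBounded (isClosed_eq hcont continuous_const) ?_
    obtain ⟨R, hR⟩ := hJ.isBounded.exists_norm_le
    refine isBounded_iff_forall_norm_le.2 ⟨ε + R, fun z hz => ?_⟩
    obtain ⟨v, hv, hzv⟩ := hJ.exists_infDist_eq_dist hne z
    rw [mem_ofPred_eq, hzv, dist_eq] at hz
    have := norm_le_norm_sub_add z v
    have := hR v hv
    linarith
  have h0 : J ∩ {z | infDist z J = ε} = ∅ := by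
    ext z
    simp only [mem_inter_iff, mem_ofPred_eq, mem_empty_iff_false, iff_false, not_and]
    intro hz
    rw [infDist_zero_of_mem hz]
    exact hε.ne
  obtain ⟨D, hD, hDs, haD, hbD⟩ := h.janiszewski hJ hC (by rw [h0]; exact isPreconnected_empty)
    (⟨_, isPreconnected_thickening hJ hJp hne ε, fun z hz => ne_of_lt hz, ha, hb⟩)
  refine ⟨D, hD, fun z hz => ⟨fun hzJ => hDs hz (Or.inl hzJ), ?_⟩, haD, hbD⟩
  by_contra! hlt
  obtain ⟨w, hw, hw'⟩ := hD.intermediate_value haD hz hcont.continuousOn ⟨ha.le, hlt⟩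
  exact hDs hw (Or.inr hw')

end PlaneTop

namespace PlaneTop
open Filter Metric Topology Complex

/-! ### Injective holomorphic functions -/

section InjHolo
variable {U : Set ℂ} {f : ℂ → ℂ}

theorem nhds_le_map_of_injOn (hU : IsOpen U) (hf : DifferentiableOn ℂ f U) (hi : InjOn f U) {z : ℂ}
    (hz : z ∈ U) : 𝓝 (f z) ≤ map f (𝓝 z) := by
  refine ((hf.analyticAt (hU.mem_nhds hz)).eventually_constant_or_nhds_le_map_nhds).resolve_left ?_
  intro h
  have h1 : ∀ᶠ w in 𝓝[≠] z, False := by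
    filter_upwards [nhdsWithin_le_nhds h, nhdsWithin_le_nhds (hU.mem_nhds hz), self_mem_nhdsWithin]
      with w hw hwU hwz
    exact hwz (hi hwU hz hw)
  exact (NormedField.nhdsNE_neBot z).ne (Filter.eventually_false_iff_eq_bot.1 h1)

theorem isOpen_image_of_injOn (hU : IsOpen U) (hf : DifferentiableOn ℂ f U) (hi : InjOn f U) :
    IsOpen (f '' U) := by
  rw [isOpen_iff_mem_nhds]
  rintro _ ⟨z, hz, rfl⟩
  exact nhds_le_map_of_injOn hU hf hi hz (image_mem_map (hU.mem_nhds hz))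

theorem exists_inverse_of_injOn (hU : IsOpen U) (hf : DifferentiableOn ℂ f U) (hi : InjOn f U) :
    ∃ g : ℂ → ℂ, DifferentiableOn ℂ g (f '' U) ∧ ∀ z ∈ U, g (f z) = z := by
  set g := Function.invFunOn f U with hg
  have hgf : ∀ z ∈ U, g (f z) = z := fun z hz => hi.leftInvOn_invFunOn hz
  have hcont : ∀ z ∈ U, ContinuousAt g (f z) := by
    intro z hz N hN
    rw [hgf z hz] at hN
    refine mem_map.2 (mem_of_superset (nhds_le_map_of_injOn hU hf hi hz
      (image_mem_map (inter_mem hN (hU.mem_nhds hz)))) ?_)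
    rintro _ ⟨w, hw, rfl⟩
    rw [mem_preimage, hgf w hw.2]; exact hw.1
  have hdiff : ∀ z ∈ U, deriv f z ≠ 0 → DifferentiableAt ℂ g (f z) := by
    intro z hz h0
    refine (HasDerivAt.of_local_left_inverse (f := f) (hcont z hz) ?_ h0 ?_).differentiableAt
    · rw [hgf z hz]; exact (hf.differentiableAt (hU.mem_nhds hz)).hasDerivAt
    · filter_upwards [(isOpen_image_of_injOn hU hf hi).mem_nhds (mem_image_of_mem f hz)] with w hw
      obtain ⟨v, hv, rfl⟩ := hw
      rw [hgf v hv]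
  refine ⟨g, ?_, hgf⟩
  rintro _ ⟨z, hz, rfl⟩
  refine (AnalyticAt.differentiableAt
    (analyticAt_of_differentiable_on_punctured_nhds_of_continuousAt ?_
      (hcont z hz))).differentiableWithinAt
  have han := (hf.analyticAt (hU.mem_nhds hz)).deriv
  rcases han.eventually_eq_zero_or_eventually_ne_zero with h | h
  · exfalso
    obtain ⟨r, hr, hball⟩ := Metric.mem_nhds_iff.1 (inter_mem (hU.mem_nhds hz) h)
    have hconst : ∀ w ∈ ball z r, f w = f z := fun w hw =>
      IsOpen.is_const_of_deriv_eq_zero isOpen_ball (convex_ball z r).isPreconnected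
        (hf.mono fun w hw => (hball hw).1) (fun w hw => (hball hw).2) hw (mem_ball_self hr)
    have hw : z + (r / 2 : ℝ) ∈ ball z r := by
      rw [mem_ball_iff_norm, add_sub_cancel_left, norm_real, Real.norm_of_nonneg (by linarith)]
      linarith
    have := hi (hball hw).1 hz (hconst _ hw)
    simp at this
    linarith
  · have hmap := nhds_le_map_of_injOn hU hf hi hz
    have hne : ∀ᶠ w in 𝓝 z, w ≠ z → (w ∈ U ∧ deriv f w ≠ 0) := by
      rw [eventually_nhdsWithin_iff] at h
      filter_upwards [h, hU.mem_nhds hz] with w hw hwU hwz using ⟨hwU, hw hwz⟩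
    rw [eventually_nhdsWithin_iff]
    refine hmap ?_
    rw [mem_map]
    filter_upwards [hne] with w hw hwz
    have hwz' : w ≠ z := by rintro rfl; exact hwz rfl
    exact hdiff w (hw hwz').1 (hw hwz').2

theorem differentiableOn_of_exp_eq {l g : ℂ → ℂ} (hU : IsOpen U) (hl : ContinuousOn l U)
    (hg : DifferentiableOn ℂ g U) (h : ∀ z ∈ U, exp (l z) = g z) : DifferentiableOn ℂ l U := by
  intro z hz
  have hlz := hl.continuousAt (hU.mem_nhds hz)
  have h1 : ∀ᶠ w in 𝓝 z, l w = l z + log (g w / g z) := by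
    have h2 : ∀ᶠ w in 𝓝 z, ‖l w - l z‖ < 1 := by
      have := hlz.eventually (ball_mem_nhds (l z) one_pos)
      filter_upwards [this] with w hw using mem_ball_iff_norm.1 hw
    filter_upwards [h2, hU.mem_nhds hz] with w hw hwU
    rw [← h w hwU, ← h z hz, ← exp_sub, log_exp]
    · ring
    · have := abs_im_le_norm (l w - l z)
      linarith [neg_abs_le (l w - l z).im, Real.pi_gt_three]
    · have := abs_im_le_norm (l w - l z)
      linarith [le_abs_self (l w - l z).im, Real.pi_gt_three]
  have h0 : g z ≠ 0 := by rw [← h z hz]; exact exp_ne_zero _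
  refine (DifferentiableAt.congr_of_eventuallyEq ?_ h1).differentiableWithinAt
  refine (differentiableAt_const _).add (((hg.differentiableAt (hU.mem_nhds hz)).div_const _).clog ?_)
  rw [div_self h0]; exact one_mem_slitPlane

end InjHolo

/-! ### Logarithms on domains -/

section Domain

theorem hasLog_of_forall_isCompact {U : Set ℂ} {g : ℂ → ℂ} (hU : IsOpen U) (hUc : IsConnected U)
    (h : ∀ K ⊆ U, IsCompact K → HasLog K g) : HasLog U g := by
  obtain ⟨a, ha⟩ := hUc.nonempty
  have hpath : ∀ z ∈ U, ∃ K ⊆ U, IsCompact K ∧ IsPreconnected K ∧ a ∈ K ∧ z ∈ K := by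
    intro z hz
    obtain ⟨γ, hγ⟩ := (hU.isConnected_iff_isPathConnected.1 hUc).joinedIn a ha z hz
    exact ⟨range γ, by rintro _ ⟨t, rfl⟩; exact hγ t, isCompact_range γ.continuous,
      isPreconnected_range γ.continuous, ⟨0, γ.source⟩, ⟨1, γ.target⟩⟩
  have h0 : g a ≠ 0 := by
    obtain ⟨l, -, hl⟩ := h {a} (by simpa) isCompact_singleton
    rw [← hl a rfl]; exact exp_ne_zero _
  have hlog : ∀ K ⊆ U, IsCompact K → ∃ l : ℂ → ℂ, ContinuousOn l K ∧ (∀ z ∈ K, exp (l z) = g z) ∧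
      (a ∈ K → l a = log (g a)) := by
    intro K hK hKc
    obtain ⟨l, hl, hl'⟩ := h K hK hKc
    refine ⟨fun z => if a ∈ K then l z + (log (g a) - l a) else l z, ?_, ?_, ?_⟩
    · by_cases haK : a ∈ K <;> simp only [haK, if_true, if_false]
      · exact hl.add continuousOn_const
      · exact hl
    · intro z hz
      by_cases haK : a ∈ K <;> simp only [haK, if_true, if_false]
      · rw [exp_add, exp_sub, exp_log h0, hl' a haK, hl' z hz, div_self h0, mul_one]
      · exact hl' z hz
    · intro haK
      simp only [haK, if_true]; ring
  choose! κ hκU hκc hκp hκa hκz using hpath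
  choose! l hl hl' hla using hlog
  have hagree : ∀ z ∈ U, ∀ M ⊆ U, IsCompact M → IsPreconnected M → a ∈ M → z ∈ M →
      l M z = l (κ z) z := by
    have hsub : ∀ M ⊆ U, ∀ N ⊆ U, IsCompact M → IsCompact N → IsPreconnected M → a ∈ M → M ⊆ N →
        ∀ z ∈ M, l M z = l N z := by
      intro M hM N hN hMc hNc hMp haM hMN z hz
      have := eq_of_log_eq_on hMp (hl M hM hMc) ((hl N hN hNc).mono hMN)
        (fun x hx => (hl' M hM hMc x hx).trans (hl' N hN hNc x (hMN hx)).symm) hz haM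
      rw [hla M hM hMc haM, hla N hN hNc (hMN haM)] at this
      linear_combination this
    intro z hz M hM hMc hMp haM hzM
    have h1 := hsub M hM (M ∪ κ z) (union_subset hM (hκU z hz)) hMc (hMc.union (hκc z hz)) hMp haM
      subset_union_left z hzM
    have h2 := hsub (κ z) (hκU z hz) (M ∪ κ z) (union_subset hM (hκU z hz)) (hκc z hz)
      (hMc.union (hκc z hz)) (hκp z hz) (hκa z hz) subset_union_right z (hκz z hz)
    rw [h1, h2]
  refine ⟨fun z => l (κ z) z, ?_, fun z hz => hl' _ (hκU z hz) (hκc z hz) z (hκz z hz)⟩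
  intro z hz
  obtain ⟨r, hr, hball⟩ := nhds_basis_closedBall.mem_iff.1 (hU.mem_nhds hz)
  set M := κ z ∪ closedBall z r with hM
  have hMU : M ⊆ U := union_subset (hκU z hz) hball
  have hMc : IsCompact M := (hκc z hz).union (isCompact_closedBall z r)
  have hMp : IsPreconnected M := (hκp z hz).union z (hκz z hz) (mem_closedBall_self hr.le)
    (convex_closedBall z r).isPreconnected
  have haM : a ∈ M := Or.inl (hκa z hz)
  have hMz : M ∈ 𝓝 z := mem_of_superset (closedBall_mem_nhds z hr) subset_union_right
  refine (((hl M hMU hMc).continuousAt hMz).congr ?_).continuousWithinAt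
  filter_upwards [hMz] with w hw
  exact hagree w (hMU hw) M hMU hMc hMp haM hw

/-- Any two points of `U` outside a large compact set are linked outside a given compact set. -/
def OneEnded (U : Set ℂ) : Prop :=
  ∀ K ⊆ U, IsCompact K → ∃ K' ⊆ U, IsCompact K' ∧ ∀ a ∈ U \ K', ∀ b ∈ U \ K', Linked (U \ K) a b

theorem OneEnded.image {U : Set ℂ} {f : ℂ → ℂ} (h : OneEnded U) (hU : IsOpen U)
    (hf : DifferentiableOn ℂ f U) (hi : InjOn f U) : OneEnded (f '' U) := by
  intro K hK hKc
  obtain ⟨g, hg, hgf⟩ := exists_inverse_of_injOn hU hf hi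
  have hgK : g '' K ⊆ U := by
    rintro _ ⟨w, hw, rfl⟩
    obtain ⟨z, hz, rfl⟩ := hK hw
    rwa [hgf z hz]
  obtain ⟨K', hK'U, hK'c, hK'⟩ := h (g '' K) hgK (hKc.image_of_continuousOn (hg.continuousOn.mono hK))
  refine ⟨f '' K', image_mono hK'U, hK'c.image_of_continuousOn (hf.continuousOn.mono hK'U), ?_⟩
  rintro _ ⟨⟨a, ha, rfl⟩, ha'⟩ _ ⟨⟨b, hb, rfl⟩, hb'⟩
  refine ((hK' a ⟨ha, fun h => ha' ⟨a, h, rfl⟩⟩ b ⟨hb, fun h => hb' ⟨b, h, rfl⟩⟩).image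
    (hf.continuousOn.mono sdiff_subset)).mono ?_
  rintro _ ⟨z, ⟨hz, hzK⟩, rfl⟩
  exact ⟨⟨z, hz, rfl⟩, fun h => hzK ⟨_, h, hgf z hz⟩⟩

theorem isOpen_linked {K : Set ℂ} (hK : IsClosed K) (a : ℂ) : IsOpen {z | Linked Kᶜ a z} := by
  rw [isOpen_iff_mem_nhds]
  intro z hz
  refine mem_of_superset ((hK.isOpen_compl.connectedComponentIn).mem_nhds
    (mem_connectedComponentIn hz.mem_right)) fun w hw => ?_
  exact hz.trans (linked_iff_mem.2 ⟨hz.mem_right, hw⟩)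

theorem isPreconnected_linked {X : Type*} [TopologicalSpace X] (A : Set X) (a : X) :
    IsPreconnected {z | Linked A a z} := by
  by_cases ha : a ∈ A
  · have : {z | Linked A a z} = connectedComponentIn A a := by ext z; simp [linked_iff_mem, ha]
    rw [this]; exact isPreconnected_connectedComponentIn
  · have : {z | Linked A a z} = ∅ := by ext z; simp [linked_iff_mem, ha]
    rw [this]; exact isPreconnected_empty

theorem closure_linked_subset {K : Set ℂ} (hK : IsClosed K) (a : ℂ) :
    closure {z | Linked Kᶜ a z} ⊆ {z | Linked Kᶜ a z} ∪ K := by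
  intro z hz
  by_contra hzn
  simp only [mem_union, not_or] at hzn
  obtain ⟨w, hw, hw'⟩ := mem_closure_iff.1 hz _ (isOpen_linked hK z) (Linked.refl hzn.2)
  exact hzn.1 (hw'.trans hw.symm)

theorem OneEnded.far {U K : Set ℂ} {w : ℂ} (h : OneEnded U) (hU : IsOpen U)
    (hUb : Bornology.IsBounded U) (hK : K ⊆ U) (hKc : IsCompact K) (hw : w ∉ U) : Far K w := by
  obtain ⟨K', hK'U, hK'c, hK'⟩ := h K hK hKc
  rcases K.eq_empty_or_nonempty with rfl | ⟨x, hx⟩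
  · intro R
    refine ⟨((|R| + 1 : ℝ) : ℂ), ?_, univ, isPreconnected_univ, by simp, trivial, trivial⟩
    rw [norm_real, Real.norm_of_nonneg (by positivity)]
    linarith [le_abs_self R]
  have key : ∀ v, v ∉ U → ∃ c, Linked Kᶜ v c ∧ c ∈ U \ K' := by
    intro v hv
    by_contra! hcon
    set Q := {z | Linked Kᶜ v z} with hQ
    have hvQ : v ∈ Q := Linked.refl fun h => hv (hK h)
    have hQo : IsOpen Q := isOpen_linked hKc.isClosed v
    have hQK' : Q ∩ U ⊆ K' := fun z hz => by
      by_contra hzK; exact hcon z hz.1 ⟨hz.2, hzK⟩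
    have h1 : Q ⊆ U ∪ K'ᶜ := fun z hz => by
      by_cases hzU : z ∈ U
      · exact Or.inl hzU
      · exact Or.inr fun h => hzU (hK'U h)
    have hQU : Q ∩ U = ∅ := by
      by_contra hne
      obtain ⟨z, hz⟩ := nonempty_iff_ne_empty.2 hne
      obtain ⟨y, hy, hyU, hyK⟩ := (isPreconnected_linked Kᶜ v) U K'ᶜ hU hK'c.isClosed.isOpen_compl h1
        ⟨z, hz⟩ ⟨v, hvQ, fun h => hv (hK'U h)⟩
      exact hyK (hQK' ⟨hy, hyU⟩)
    have hQcl : IsClosed Q := by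
      refine isClosed_of_closure_subset fun z hz => ?_
      refine (closure_linked_subset hKc.isClosed v hz).resolve_right fun hzK => ?_
      obtain ⟨y, hyU, hyQ⟩ := mem_closure_iff.1 hz U hU (hK hzK)
      exact (hQU ▸ (⟨hyQ, hyU⟩ : y ∈ Q ∩ U) : y ∈ (∅ : Set ℂ))
    have : Q = univ := IsClopen.eq_univ ⟨hQcl, hQo⟩ ⟨v, hvQ⟩
    have hxQ : x ∈ Q := this ▸ trivial
    exact hxQ.mem_right hx
  obtain ⟨R, hR⟩ := hUb.exists_norm_le
  intro R'
  set v : ℂ := ((|R| + |R'| + 1 : ℝ) : ℂ) with hv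
  have hvn : ‖v‖ = |R| + |R'| + 1 := by
    rw [hv, norm_real, Real.norm_of_nonneg (by positivity)]
  obtain ⟨c, hc, hcU⟩ := key w hw
  obtain ⟨d, hd, hdU⟩ := key v fun h => by
    have := hR v h
    linarith [le_abs_self R, abs_nonneg R']
  refine ⟨v, by linarith [le_abs_self R', abs_nonneg R], hc.trans (((hK' c hcU d hdU).mono ?_).trans
    hd.symm)⟩
  exact fun z hz => hz.2

theorem OneEnded.hasLog_sub {U : Set ℂ} {w : ℂ} (h : OneEnded U) (hU : IsOpen U)
    (hUc : IsConnected U) (hUb : Bornology.IsBounded U) (hw : w ∉ U) :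
    HasLog U (fun z => z - w) :=
  hasLog_of_forall_isCompact hU hUc fun _ hK hKc => (h.far hU hUb hK hKc hw).hasLog hKc

theorem oneEnded_inside {J : Set ℂ} (hJ : IsCompact J) (hJp : IsPreconnected J) (hne : J.Nonempty)
    {a : ℂ} (ha : ¬ Far J a) : OneEnded {z | Linked Jᶜ a z} := by
  intro K hK hKc
  have hb : Bornology.IsBounded {z | Linked Jᶜ a z} := by
    simp only [Far, not_forall, not_exists, not_and'] at ha
    obtain ⟨R, hR⟩ := ha
    exact isBounded_iff_forall_norm_le.2 ⟨R, fun b hb => not_lt.1 (hR b hb)⟩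
  obtain ⟨ε, hε, hεK⟩ : ∃ ε > 0, ∀ z ∈ K, ε ≤ infDist z J := by
    rcases K.eq_empty_or_nonempty with rfl | hKn
    · exact ⟨1, one_pos, by simp⟩
    obtain ⟨z, hz, hmin⟩ := hKc.exists_isMinOn hKn (continuous_infDist_pt J).continuousOn
    exact ⟨infDist z J, (hJ.isClosed.notMem_iff_infDist_pos hne).1 (hK hz).mem_right,
      fun y hy => hmin hy⟩
  refine ⟨{z | Linked Jᶜ a z} ∩ {z | ε ≤ infDist z J}, inter_subset_left, ?_, ?_⟩
  · refine Metric.isCompact_of_isClosed_isBounded (isClosed_of_closure_subset fun z hz => ?_)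
      (hb.subset inter_subset_left)
    have h2 : z ∈ {z | ε ≤ infDist z J} :=
      (isClosed_le continuous_const (continuous_infDist_pt J)).closure_subset
        (closure_mono inter_subset_right hz)
    refine ⟨(closure_linked_subset hJ.isClosed a (closure_mono inter_subset_left hz)).resolve_right
      fun hzJ => ?_, h2⟩
    rw [mem_ofPred_eq, infDist_zero_of_mem hzJ] at h2
    exact absurd h2 (not_le.2 hε)
  · rintro b ⟨hb, hb'⟩ c ⟨hc, hc'⟩
    have hb1 : infDist b J < ε := by
      by_contra! h; exact hb' ⟨hb, h⟩
    have hc1 : infDist c J < ε := by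
      by_contra! h; exact hc' ⟨hc, h⟩
    obtain ⟨D, hD, hDs, hbD, hcD⟩ := Linked.near hJ hJp hne (hb.symm.trans hc) hb1 hc1
    exact ⟨D, hD, fun z hz => ⟨hb.trans ⟨D, hD, fun y hy => (hDs hy).1, hbD, hz⟩,
      fun hzK => absurd (hεK z hzK) (not_le.2 (hDs hz).2)⟩, hbD, hcD⟩

end Domain
end PlaneTop

namespace PlaneTop
open Filter Metric Topology Complex

/-! ### The Riemann mapping theorem -/

theorem exists_tendstoLocallyUniformlyOn {U : Set ℂ} (hU : IsOpen U) {F : ℕ → ℂ → ℂ}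
    (hF : ∀ n, DifferentiableOn ℂ (F n) U) (hF1 : ∀ n, MapsTo (F n) U (ball 0 1)) :
    ∃ f, TendstoLocallyUniformlyOn F f (hyperfilter ℕ : Filter ℕ) U := by
  have hlim : ∀ z, ∃ y, z ∈ U → Tendsto (fun n => F n z) (hyperfilter ℕ : Filter ℕ) (𝓝 y) := by
    intro z
    by_cases hz : z ∈ U
    · obtain ⟨y, -, hy⟩ := (isCompact_closedBall (0 : ℂ) 1).ultrafilter_le_nhds
        ((hyperfilter ℕ).map fun n => F n z)
        (by
          rw [le_principal_iff]
          exact mem_map.2 (univ_mem' fun n => ball_subset_closedBall (hF1 n hz)))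
      exact ⟨y, fun _ => hy⟩
    · exact ⟨0, fun h => absurd h hz⟩
  choose f hf using hlim
  refine ⟨f, Metric.tendstoLocallyUniformlyOn_iff.2 fun ε hε z hz => ?_⟩
  obtain ⟨R, hR, hball⟩ := Metric.isOpen_iff.1 hU z hz
  have hlip : ∀ n, ∀ y ∈ ball z R, dist (F n y) (F n z) ≤ 2 / R * dist y z := by
    intro n y hy
    refine dist_le_div_mul_dist_of_mapsTo_ball ((hF n).mono hball) (fun w hw => ?_) hy
    have h1 := mem_ball_zero_iff.1 (hF1 n (hball hw))
    have h2 := mem_ball_zero_iff.1 (hF1 n hz)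
    rw [mem_closedBall, dist_eq]
    linarith [norm_sub_le (F n w) (F n z)]
  have hlip' : ∀ y ∈ ball z R, dist (f y) (f z) ≤ 2 / R * dist y z := fun y hy =>
    le_of_tendsto ((hf y (hball hy)).dist (hf z hz)) (Eventually.of_forall fun n => hlip n y hy)
  set δ := min R (R * (ε / 8)) with hδ
  have hδ0 : 0 < δ := lt_min hR (by positivity)
  refine ⟨ball z δ, mem_nhdsWithin_of_mem_nhds (ball_mem_nhds z hδ0), ?_⟩
  filter_upwards [Metric.tendsto_nhds.1 (hf z hz) (ε / 4) (by linarith)] with n hn y hy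
  have hyR : y ∈ ball z R := ball_subset_ball (min_le_left _ _) hy
  have h3 : 2 / R * dist y z ≤ ε / 4 := by
    have : dist y z ≤ R * (ε / 8) := (mem_ball.1 hy).le.trans (min_le_right _ _)
    calc 2 / R * dist y z ≤ 2 / R * (R * (ε / 8)) := by gcongr
      _ = ε / 4 := by field_simp; ring
  have h4 := hlip n y hyR
  have h5 := hlip' y hyR
  have h6 := dist_triangle4 (f y) (f z) (F n z) (F n y)
  rw [dist_comm (f z), dist_comm (F n z) (F n y)] at h6
  linarith

/-- **Hurwitz's theorem** for injective functions. -/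
theorem injOn_of_tendstoLocallyUniformlyOn {U : Set ℂ} (hU : IsOpen U) (hUc : IsPreconnected U)
    {ι : Type*} {p : Filter ι} [p.NeBot] {F : ι → ℂ → ℂ} {f : ℂ → ℂ}
    (hF : ∀ n, DifferentiableOn ℂ (F n) U) (hFi : ∀ n, InjOn (F n) U)
    (hFf : TendstoLocallyUniformlyOn F f p U) {x y : ℂ} (hx : x ∈ U) (hy : y ∈ U)
    (hxy : f x ≠ f y) : InjOn f U := by
  have hf : DifferentiableOn ℂ f U := hFf.differentiableOn (Eventually.of_forall hF) hU
  intro a ha b hb hab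
  by_contra hne
  have han : AnalyticOnNhd ℂ f U := hf.analyticOnNhd hU
  have hiso : ∀ᶠ z in 𝓝[≠] b, f z ≠ f b := by
    rcases (han b hb).eventually_eq_or_eventually_ne (g := fun _ => f b) analyticAt_const with h | h
    · have := han.eqOn_of_preconnected_of_eventuallyEq (g := fun _ => f b)
        (fun z _ => analyticAt_const) hUc hb h
      exact absurd ((this hx).trans (this hy).symm) hxy
    · exact h
  rw [eventually_nhdsWithin_iff] at hiso
  obtain ⟨r, hr, hball⟩ := nhds_basis_closedBall.mem_iff.1
    (inter_mem (inter_mem hiso (hU.mem_nhds hb)) (isOpen_ne.mem_nhds (Ne.symm hne) : {a}ᶜ ∈ 𝓝 b))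
  obtain ⟨z₀, hz₀, hmin⟩ := (isCompact_sphere b r).exists_isMinOn
    (NormedSpace.sphere_nonempty.2 hr.le) (f := fun z => ‖f z - f b‖)
    ((hf.continuousOn.mono fun z hz => (hball (sphere_subset_closedBall hz)).1.2).sub
      continuousOn_const).norm
  set ε := ‖f z₀ - f b‖ with hε
  have hε0 : 0 < ε := by
    rw [hε, norm_pos_iff, sub_ne_zero]
    refine (hball (sphere_subset_closedBall hz₀)).1.1 ?_
    rintro rfl
    simp at hz₀
    exact hr.ne hz₀
  have hclU : closedBall b r ⊆ U := fun z hz => (hball hz).1.2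
  have hunif := (tendstoLocallyUniformlyOn_iff_forall_isCompact hU).1 hFf (closedBall b r) hclU
    (isCompact_closedBall b r)
  have hpt : ∀ z ∈ U, Tendsto (fun n => F n z) p (𝓝 (f z)) := fun z hz => hFf.tendsto_at hz
  obtain ⟨n, hn1, hn2⟩ := ((Metric.tendstoUniformlyOn_iff.1 hunif (ε / 8) (by linarith)).and
    (Metric.tendsto_nhds.1 (hpt a ha) (ε / 8) (by linarith))).exists
  have hbn := hn1 b (mem_closedBall_self hr.le)
  have hsub : ball (F n b) (ε / 2 / 2) ⊆ F n '' closedBall b r := by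
    refine DiffContOnCl.ball_subset_image_closedBall
      (((hF n).mono (hclU.trans' ?_)).diffContOnCl) hr ?_ ?_
    · exact closure_ball_subset_closedBall
    · intro z hz
      have h1 := hn1 z (sphere_subset_closedBall hz)
      have h2 : ε ≤ ‖f z - f b‖ := hmin hz
      rw [dist_eq] at h1 hbn
      have h3 : f z - f b = (f z - F n z) + (F n z - F n b) - (f b - F n b) := by ring
      have h4 := norm_sub_le ((f z - F n z) + (F n z - F n b)) (f b - F n b)
      have h5 := norm_add_le (f z - F n z) (F n z - F n b)
      rw [← h3] at h4
      linarith
    · have hh : ∃ᶠ z in 𝓝[≠] b, F n z ≠ F n b := by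
        refine Eventually.frequently ?_
        filter_upwards [nhdsWithin_le_nhds (hU.mem_nhds hb), self_mem_nhdsWithin] with z hz hzb h
        exact hzb (hFi n hz hb h)
      exact hh.filter_mono nhdsWithin_le_nhds
  have hmem : F n a ∈ ball (F n b) (ε / 2 / 2) := by
    rw [mem_ball]
    have := dist_triangle (F n a) (f a) (F n b)
    rw [hab] at this hn2
    linarith
  obtain ⟨c, hc, hca⟩ := hsub hmem
  have : c = a := hFi n (hclU hc) ha hca
  exact (hball hc).2 this

/-- Injective holomorphic maps to the unit disc, normalized at `0`. -/
structure DiscMap (U : Set ℂ) (f : ℂ → ℂ) : Prop where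
  diff : DifferentiableOn ℂ f U
  inj : InjOn f U
  maps : MapsTo f U (ball 0 1)
  zero : f 0 = 0

theorem normSq_blaschke (u b : ℂ) :
    normSq (1 + (starRingEnd ℂ) b * u) - normSq (u + b) = (1 - normSq u) * (1 - normSq b) := by
  simp only [normSq_apply, add_re, add_im, mul_re, mul_im, conj_re, conj_im, one_re, one_im]
  ring

theorem norm_lt_one_iff_normSq {z : ℂ} : ‖z‖ < 1 ↔ normSq z < 1 := by
  rw [normSq_eq_norm_sq, sq_lt_one_iff₀ (norm_nonneg z)]

theorem one_add_conj_mul_ne_zero {u b : ℂ} (hu : ‖u‖ < 1) (hb : ‖b‖ < 1) :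
    1 + (starRingEnd ℂ) b * u ≠ 0 := by
  intro h
  have h1 : ‖(starRingEnd ℂ) b * u‖ < 1 := by
    rw [norm_mul, norm_conj]
    nlinarith [norm_nonneg u, norm_nonneg b]
  rw [eq_neg_of_add_eq_zero_right h, norm_neg, norm_one] at h1
  exact lt_irrefl _ h1

theorem norm_blaschke_lt {u b : ℂ} (hu : ‖u‖ < 1) (hb : ‖b‖ < 1) :
    ‖(u + b) / (1 + (starRingEnd ℂ) b * u)‖ < 1 := by
  have h0 := one_add_conj_mul_ne_zero hu hb
  rw [norm_lt_one_iff_normSq, map_div₀, div_lt_one (normSq_pos.2 h0)]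
  have := normSq_blaschke u b
  rw [norm_lt_one_iff_normSq] at hu hb
  nlinarith

theorem blaschke_injective {u v b : ℂ} (hu : ‖u‖ < 1) (hv : ‖v‖ < 1) (hb : ‖b‖ < 1)
    (h : (u + b) / (1 + (starRingEnd ℂ) b * u) = (v + b) / (1 + (starRingEnd ℂ) b * v)) : u = v := by
  rw [div_eq_div_iff (one_add_conj_mul_ne_zero hu hb) (one_add_conj_mul_ne_zero hv hb)] at h
  have h1 : (u - v) * (1 - b * (starRingEnd ℂ) b) = 0 := by linear_combination h
  rw [mul_conj] at h1
  rcases mul_eq_zero.1 h1 with h2 | h2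
  · exact sub_eq_zero.1 h2
  · rw [norm_lt_one_iff_normSq] at hb
    exfalso
    have : (1 : ℂ) = (normSq b : ℝ) := sub_eq_zero.1 h2
    have : (1 : ℝ) = normSq b := by exact_mod_cast this
    linarith

theorem DiscMap.exists_norm_lt {U : Set ℂ} {f : ℂ → ℂ} (hf : DiscMap U f) (hU : IsOpen U)
    (hUc : IsConnected U) (h0 : 0 ∈ U) (hone : OneEnded U) {w : ℂ}
    (hw : ‖w‖ < 1) (hwU : w ∉ f '' U) : ∃ h, DiscMap U h ∧ ∀ z ∈ U, z ≠ 0 → ‖f z‖ < ‖h z‖ := by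
  have hmw : ‖-w‖ < 1 := by rwa [norm_neg]
  have hf1 : ∀ z ∈ U, ‖f z‖ < 1 := fun z hz => mem_ball_zero_iff.1 (hf.maps hz)
  set g : ℂ → ℂ := fun z => (f z + -w) / (1 + (starRingEnd ℂ) (-w) * f z) with hg
  have hgd : DifferentiableOn ℂ g U :=
    (hf.diff.add_const _).div ((hf.diff.const_mul _).const_add _)
      fun z hz => one_add_conj_mul_ne_zero (hf1 z hz) hmw
  have hlog : HasLog U g := by
    have h1 := (hone.image hU hf.diff hf.inj).hasLog_sub (isOpen_image_of_injOn hU hf.diff hf.inj)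
      (hUc.image f hf.diff.continuousOn) (isBounded_ball.subset (image_subset_iff.2 hf.maps)) hwU
    have h2 := h1.comp hf.diff.continuousOn (mapsTo_image f U)
    have h3 : HasLog U (fun z => 1 + (starRingEnd ℂ) (-w) * f z) := by
      refine hasLog_of_norm_sub_one_lt
        ((continuousOn_const.mul hf.diff.continuousOn).const_add _) fun z hz => ?_
      rw [add_sub_cancel_left, norm_mul, norm_conj]
      nlinarith [norm_nonneg (f z), norm_nonneg (-w), hf1 z hz]
    exact (h2.mul h3.inv).congr fun z hz => by simp only [hg]; ring
  obtain ⟨l, hl, hl'⟩ := hlog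
  have hld := differentiableOn_of_exp_eq hU hl hgd hl'
  set s : ℂ → ℂ := fun z => exp (l z / 2) with hs
  have hsd : DifferentiableOn ℂ s U := (hld.div_const _).cexp
  have hs2 : ∀ z ∈ U, s z ^ 2 = g z := fun z hz => by
    rw [← hl' z hz, hs, ← exp_nat_mul]; congr 1; push_cast; ring
  have hg1 : ∀ z ∈ U, ‖g z‖ < 1 := fun z hz => norm_blaschke_lt (hf1 z hz) hmw
  have hs1 : ∀ z ∈ U, ‖s z‖ < 1 := fun z hz => by
    have := hg1 z hz
    rw [← hs2 z hz, norm_pow, sq_lt_one_iff₀ (norm_nonneg _)] at this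
    exact this
  set b := s 0 with hb
  have hb1 : ‖b‖ < 1 := hs1 0 h0
  have hmb : ‖-b‖ < 1 := by rwa [norm_neg]
  have hbw : b ^ 2 = -w := by rw [hb, hs2 0 h0, hg]; simp [hf.zero]
  set h : ℂ → ℂ := fun z => (s z + -b) / (1 + (starRingEnd ℂ) (-b) * s z) with hh
  have hh1 : ∀ z ∈ U, ‖h z‖ < 1 := fun z hz => norm_blaschke_lt (hs1 z hz) hmb
  have hinj : InjOn h U := by
    intro z hz z' hz' hzz
    have h1 := blaschke_injective (hs1 z hz) (hs1 z' hz') hmb hzz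
    have h2 : g z = g z' := by rw [← hs2 z hz, ← hs2 z' hz', h1]
    exact hf.inj hz hz' (blaschke_injective (hf1 z hz) (hf1 z' hz') hmw h2)
  have hh0 : h 0 = 0 := by simp [hh, hb]
  refine ⟨h, ⟨?_, hinj, fun z hz => mem_ball_zero_iff.2 (hh1 z hz), hh0⟩, ?_⟩
  · exact (hsd.add_const _).div ((hsd.const_mul _).const_add _)
      fun z hz => one_add_conj_mul_ne_zero (hs1 z hz) hmb
  intro z hz hz0
  set u := h z with hu
  have hu0 : u ≠ 0 := fun h => hz0 (hinj hz h0 (h.trans hh0.symm))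
  have hu1 : ‖u‖ < 1 := hh1 z hz
  set c := (starRingEnd ℂ) b with hc
  have hd1 : 1 + -c * s z ≠ 0 := by
    have := one_add_conj_mul_ne_zero (hs1 z hz) hmb
    rwa [map_neg] at this
  have hd2 : 1 + c * u ≠ 0 := one_add_conj_mul_ne_zero hu1 hb1
  have hβ : normSq b < 1 := norm_lt_one_iff_normSq.1 hb1
  have hbc : b * c = (normSq b : ℝ) := mul_conj b
  have hsu : s z * (1 + c * u) = u + b := by
    have h1 : u * (1 + -c * s z) = s z + -b := by
      rw [hu, hh]; simp only [map_neg]; exact div_mul_cancel₀ _ hd1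
    linear_combination -h1
  have hd3 : 1 + -(starRingEnd ℂ) w * f z ≠ 0 := by
    have := one_add_conj_mul_ne_zero (hf1 z hz) hmw
    rwa [map_neg] at this
  have hcw : (starRingEnd ℂ) w = -c ^ 2 := by
    rw [show w = -b ^ 2 by rw [hbw]; ring, map_neg, map_pow]
  have hfz : s z ^ 2 * (1 + c ^ 2 * f z) = f z + b ^ 2 := by
    rw [hs2 z hz, hg, hbw]
    simp only [map_neg, hcw, neg_neg]
    rw [hcw, neg_neg] at hd3
    exact div_mul_cancel₀ _ hd3
  set D : ℂ := (1 + b * c) + 2 * c * u with hD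
  set N : ℂ := (1 + b * c) * u + 2 * b with hN
  have hb1' : 1 - b * c ≠ 0 := by
    rw [hbc]; intro h; 
    have : (1:ℂ) = (normSq b : ℝ) := sub_eq_zero.1 h
    have : (1 : ℝ) = normSq b := by exact_mod_cast this
    linarith
  have hrel : f z * D = u * N := by
    have h1 : (u + b) ^ 2 * (1 + c ^ 2 * f z) = (f z + b ^ 2) * (1 + c * u) ^ 2 := by
      rw [← hsu]; linear_combination (1 + c * u) ^ 2 * hfz
    have h2 : (1 - b * c) * (f z * D - u * N) = 0 := by
      rw [hD, hN]; linear_combination -h1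
    exact sub_eq_zero.1 ((mul_eq_zero.1 h2).resolve_left hb1')
  have hlt : normSq N < normSq D := by
    have hre : normSq D - normSq N = (1 - normSq b) ^ 2 * (1 - normSq u) := by
      rw [hD, hN, hbc, hc]
      simp only [normSq_apply, add_re, add_im, mul_re, mul_im, conj_re, conj_im, one_re, one_im,
        ofReal_re, ofReal_im, re_ofNat, im_ofNat]
      ring
    have hu2 := norm_lt_one_iff_normSq.1 hu1
    have : 0 < (1 - normSq b) ^ 2 * (1 - normSq u) := by
      have : 0 < 1 - normSq b := by linarith
      have : 0 < 1 - normSq u := by linarith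
      positivity
    linarith
  have hlt' : ‖N‖ < ‖D‖ := by
    rw [normSq_eq_norm_sq, normSq_eq_norm_sq] at hlt
    exact lt_of_pow_lt_pow_left₀ 2 (norm_nonneg _) hlt
  have hDpos : 0 < ‖D‖ := (norm_nonneg _).trans_lt hlt'
  have := congrArg norm hrel
  rw [norm_mul, norm_mul] at this
  have hupos := norm_pos_iff.2 hu0
  by_contra! hle
  nlinarith

/-- The **Riemann mapping theorem** for bounded one-ended domains. -/
theorem exists_riemann_map {U : Set ℂ} (hU : IsOpen U) (hUc : IsConnected U)
    (hUb : Bornology.IsBounded U) (h0 : 0 ∈ U) (hone : OneEnded U) :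
    ∃ ψ : ℂ → ℂ, DifferentiableOn ℂ ψ (ball 0 1) ∧ InjOn ψ (ball 0 1) ∧ ψ '' ball 0 1 = U ∧
      ψ 0 = 0 := by
  obtain ⟨z₁, hz₁, hz₁0⟩ : ∃ z ∈ U, z ≠ 0 := by
    obtain ⟨r, hr, hball⟩ := Metric.isOpen_iff.1 hU 0 h0
    refine ⟨((r / 2 : ℝ) : ℂ), hball ?_, ?_⟩
    · rw [mem_ball_zero_iff, norm_real, Real.norm_of_nonneg (by linarith)]; linarith
    · simpa using hr.ne'
  set V : Set ℝ := (fun f : ℂ → ℂ => ‖f z₁‖) '' {f | DiscMap U f} with hV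
  have hVb : BddAbove V := ⟨1, by
    rintro _ ⟨f, hf, rfl⟩
    exact (mem_ball_zero_iff.1 (DiscMap.maps hf hz₁)).le⟩
  obtain ⟨R, hR⟩ := hUb.exists_norm_le
  have hR0 : 0 < |R| + 1 := by positivity
  have hscale : DiscMap U (fun z => z / ((|R| + 1 : ℝ) : ℂ)) := by
    have hne : ((|R| + 1 : ℝ) : ℂ) ≠ 0 := by exact_mod_cast hR0.ne'
    refine ⟨by fun_prop, ?_, ?_, by simp⟩
    · intro z _ w _ h
      exact (div_left_inj' hne).1 h
    · intro z hz
      rw [mem_ball_zero_iff, norm_div, norm_real, Real.norm_of_nonneg hR0.le, div_lt_one hR0]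
      linarith [hR z hz, le_abs_self R]
  obtain ⟨v, -, hv, hvV⟩ := exists_seq_tendsto_sSup (S := V) ⟨_, mem_image_of_mem _ hscale⟩ hVb
  choose F hF hFv using hvV
  obtain ⟨f, hf⟩ := exists_tendstoLocallyUniformlyOn hU (fun n => (hF n).diff) (fun n => (hF n).maps)
  have hpt : ∀ z ∈ U, Tendsto (fun n => F n z) (hyperfilter ℕ : Filter ℕ) (𝓝 (f z)) :=
    fun z hz => hf.tendsto_at hz
  have hfz : ‖f z₁‖ = sSup V := by
    refine tendsto_nhds_unique (hpt z₁ hz₁).norm ?_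
    have : (fun n => ‖F n z₁‖) = v := funext fun n => hFv n
    rw [this]
    exact hv.mono_left Nat.hyperfilter_le_atTop
  have hf0 : f 0 = 0 := tendsto_nhds_unique (hpt 0 h0) (by
    simp only [(hF _).zero]; exact tendsto_const_nhds)
  have hpos : 0 < ‖f z₁‖ := by
    rw [hfz]
    refine lt_of_lt_of_le ?_ (le_csSup hVb (mem_image_of_mem _ hscale))
    simp only [norm_div, norm_real, Real.norm_of_nonneg hR0.le]
    exact div_pos (norm_pos_iff.2 hz₁0) hR0
  have hinj : InjOn f U := injOn_of_tendstoLocallyUniformlyOn hU hUc.isPreconnected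
    (fun n => (hF n).diff) (fun n => (hF n).inj) hf hz₁ h0 (by rw [hf0]; exact norm_pos_iff.1 hpos)
  have hd : DifferentiableOn ℂ f U :=
    hf.differentiableOn (Eventually.of_forall fun n => (hF n).diff) hU
  have hmap : f '' U ⊆ ball 0 1 := by
    rw [← interior_closedBall (0 : ℂ) one_ne_zero]
    refine (isOpen_image_of_injOn hU hd hinj).subset_interior_iff.2 ?_
    rintro _ ⟨z, hz, rfl⟩
    exact isClosed_closedBall.mem_of_tendsto (hpt z hz)
      (Eventually.of_forall fun n => ball_subset_closedBall ((hF n).maps hz))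
  have hfD : DiscMap U f := ⟨hd, hinj, fun z hz => hmap ⟨z, hz, rfl⟩, hf0⟩
  have hsurj : f '' U = ball 0 1 := by
    refine hmap.antisymm fun w hw => ?_
    by_contra hwU
    obtain ⟨h, hh, hlt⟩ := hfD.exists_norm_lt hU hUc h0 hone (mem_ball_zero_iff.1 hw) hwU
    have := hlt z₁ hz₁ hz₁0
    rw [hfz] at this
    exact absurd (le_csSup hVb (mem_image_of_mem _ hh)) (not_le.2 this)
  obtain ⟨ψ, hψ, hψf⟩ := exists_inverse_of_injOn hU hd hinj
  rw [hsurj] at hψ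
  refine ⟨ψ, hψ, ?_, ?_, by rw [← hf0, hψf 0 h0, hf0]⟩
  · rw [← hsurj]
    rintro _ ⟨z, hz, rfl⟩ _ ⟨w, hw, rfl⟩ h
    rw [hψf z hz, hψf w hw] at h
    rw [h]
  · rw [← hsurj, image_image]
    exact (image_congr hψf).trans (image_id' U)

end PlaneTop

namespace PlaneTop
open Filter Metric Topology Complex
open scoped ComplexConjugate

section Koebe
variable {C : Set ℂ} {u a b : ℂ} {m : ℕ}

/-- Reflection of `C` in the line through `u`, together with `C`. -/
def mirror (u : ℂ) (C : Set ℂ) : Set ℂ := C ∪ Set.image (fun z => u ^ 2 * conj z) C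

/-- The union of the rotates of the mirrored set `C` under the `m`-th roots of unity. -/
def kaleidoscope (m : ℕ) (u : ℂ) (C : Set ℂ) : Set ℂ :=
  (fun p : ℂ × ℂ => p.1 * p.2) '' ({w | w ^ m = 1} ×ˢ mirror u C)

theorem norm_eq_one_of_pow {w : ℂ} (hm : 0 < m) (h : w ^ m = 1) : ‖w‖ = 1 := by
  have := congrArg norm h
  rw [norm_pow, norm_one] at this
  exact (pow_eq_one_iff_of_nonneg (norm_nonneg _) hm.ne').1 this

theorem isCompact_kaleidoscope (hm : 0 < m) (hC : IsCompact C) :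
    IsCompact (kaleidoscope m u C) := by
  refine IsCompact.image (IsCompact.prod ?_ (hC.union (hC.image (by fun_prop)))) (by fun_prop)
  refine Metric.isCompact_of_isClosed_isBounded (isClosed_eq (by fun_prop) (by fun_prop)) ?_
  refine isBounded_iff_forall_norm_le.2 ⟨1, fun w hw => (norm_eq_one_of_pow hm hw).le⟩

theorem not_far_kaleidoscope (hm : 0 < m) (hC : IsCompact C) (hCp : IsPreconnected C)
    (h0 : 0 ∉ C) (ha : a ∈ C) (hb : b ∈ C) (hu : a = ‖a‖ * u)
    (hab : (b * conj a).re ≤ Real.cos (Real.pi / m) * (‖a‖ * ‖b‖)) :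
    ¬ Far (kaleidoscope m u C) 0 := by
  intro hfar
  obtain ⟨l, hl, hl'⟩ := hfar.hasLog (isCompact_kaleidoscope hm hC)
  simp only [sub_zero] at hl'
  have ha0 : a ≠ 0 := fun h => h0 (h ▸ ha)
  have hb0 : b ≠ 0 := fun h => h0 (h ▸ hb)
  have hna : (‖a‖ : ℂ) ≠ 0 := by exact_mod_cast (norm_pos_iff.2 ha0).ne'
  have hmR : (0 : ℝ) < m := by exact_mod_cast hm
  have hmC : (m : ℂ) ≠ 0 := by exact_mod_cast hm.ne'
  have hu1 : ‖u‖ = 1 := by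
    have := congrArg norm hu
    rw [norm_mul, norm_real, norm_norm] at this
    exact (mul_eq_left₀ (norm_pos_iff.2 ha0).ne').1 this.symm
  have huu : u * conj u = 1 := by rw [mul_conj, normSq_eq_norm_sq, hu1]; simp
  have hu0 : u ≠ 0 := by rw [← norm_pos_iff, hu1]; exact one_pos
  have hrefa : u ^ 2 * conj a = a := by
    conv_lhs => rw [hu]
    conv_rhs => rw [hu]
    rw [map_mul, conj_ofReal]
    linear_combination (‖a‖ : ℂ) * u * huu
  have hC1 : IsPreconnected (mirror u C) :=
    hCp.union a ha ⟨a, ha, hrefa⟩ (hCp.image _ (by fun_prop))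
  have hmem : ∀ w z, w ^ m = 1 → z ∈ mirror u C → w * z ∈ kaleidoscope m u C :=
    fun w z hw hz => ⟨(w, z), ⟨hw, hz⟩, rfl⟩
  have hsub : mirror u C ⊆ kaleidoscope m u C := fun z hz => by
    simpa using hmem 1 z (one_pow _) hz
  have hCs : C ⊆ mirror u C := subset_union_left
  -- the total turning along `C`
  have hdiff : Real.pi / m ≤ |(l b).im - (l a).im| := by
    by_contra! hlt
    have e1 := hl' a (hsub (hCs ha))
    have e2 := hl' b (hsub (hCs hb))
    have hre : (b * conj a).re = Real.cos ((l b).im - (l a).im) * (‖a‖ * ‖b‖) := by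
      have n1 : ‖a‖ = Real.exp (l a).re := by rw [← norm_exp, e1]
      have n2 : ‖b‖ = Real.exp (l b).re := by rw [← norm_exp, e2]
      have n3 : b * conj a = exp (l b + conj (l a)) := by rw [exp_add, exp_conj, e1, e2]
      rw [n1, n2, n3, exp_re, add_re, add_im, conj_re, conj_im, Real.exp_add, ← sub_eq_add_neg]
      ring
    rw [hre, ← Real.cos_abs] at hab
    have h1 := le_of_mul_le_mul_right hab (by positivity)
    have h2 : Real.pi / m ≤ Real.pi := div_le_self Real.pi_pos.le (by exact_mod_cast hm)
    exact absurd h1 (not_le.2 (Real.strictAntiOn_cos ⟨abs_nonneg _, by linarith⟩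
      ⟨by positivity, h2⟩ hlt))
  have hlC : ContinuousOn (fun z => (l z).im) C :=
    continuous_im.comp_continuousOn (hl.mono (hCs.trans hsub))
  obtain ⟨σ, hσ, c, hc, hcl⟩ : ∃ σ : ℝ, (σ = 1 ∨ σ = -1) ∧ ∃ c ∈ C,
      (l c).im = (l a).im + σ * (Real.pi / m) := by
    rcases le_abs.1 hdiff with h | h
    · obtain ⟨c, hc, h'⟩ := hCp.intermediate_value ha hb hlC
        (show (l a).im + 1 * (Real.pi / m) ∈ _ from ⟨by
          have : 0 < Real.pi / m := by positivity
          linarith, by linarith⟩)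
      exact ⟨1, Or.inl rfl, c, hc, h'⟩
    · obtain ⟨c, hc, h'⟩ := hCp.intermediate_value hb ha hlC
        (show (l a).im + (-1) * (Real.pi / m) ∈ _ from ⟨by linarith, by
          have : 0 < Real.pi / m := by positivity
          linarith⟩)
      exact ⟨-1, Or.inr rfl, c, hc, h'⟩
  set c' := u ^ 2 * conj c with hc'
  have hc'm : c' ∈ mirror u C := Or.inr ⟨c, hc, rfl⟩
  have hcm : c ∈ mirror u C := hCs hc
  have hlc : l c - l c' = σ * (2 * Real.pi * I / m) := by
    have key := eq_of_log_eq_on hCp (l := l)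
      (m := fun z => conj (l (u ^ 2 * conj z)) + log (u ^ 2)) (hl.mono (hCs.trans hsub))
      ((continuous_conj.comp_continuousOn ((hl.comp (by fun_prop)
        (fun z hz => hsub (Or.inr ⟨z, hz, rfl⟩))))).add continuousOn_const) (by
        intro z hz
        rw [exp_add, exp_log (pow_ne_zero 2 hu0), exp_conj,
          hl' _ (hsub (Or.inr ⟨z, hz, rfl⟩)), hl' _ (hsub (hCs hz))]
        simp only [map_mul, map_pow, conj_conj]
        linear_combination (-z - u * conj u * z) * huu) hc ha
    simp only [hrefa] at key
    rw [← hc'] at key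
    have hr := congrArg re key
    have hi := congrArg im key
    simp only [sub_re, add_re, conj_re, sub_im, add_im, conj_im] at hr hi
    apply Complex.ext
    · have : (↑σ * (2 * ↑Real.pi * I / ↑m) : ℂ) = ((σ * (2 * Real.pi / m) : ℝ) : ℂ) * I := by
        push_cast; ring
      rw [this]; simp; linarith
    · have : (↑σ * (2 * ↑Real.pi * I / ↑m) : ℂ) = ((σ * (2 * Real.pi / m) : ℝ) : ℂ) * I := by
        push_cast; ring
      rw [this]; simp
      have : σ * (2 * Real.pi / m) = 2 * (σ * (Real.pi / m)) := by ring
      linarith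
  set ω := exp (σ * (2 * Real.pi * I / m)) with hω
  have hωm : ω ^ m = 1 := by
    rw [hω, ← exp_nat_mul]
    have : (m : ℂ) * (↑σ * (2 * ↑Real.pi * I / ↑m)) = σ * (2 * Real.pi * I) := by
      field_simp
    rw [this]
    rcases hσ with rfl | rfl
    · simp [exp_two_pi_mul_I]
    · simp [exp_neg, exp_two_pi_mul_I]
  have hωk : ∀ k : ℕ, (ω ^ k) ^ m = 1 := fun k => by rw [← pow_mul, mul_comm, pow_mul, hωm, one_pow]
  have hωc : ω * c' = c := by
    rw [← hl' c' (hsub hc'm), ← hl' c (hsub hcm), hω, ← exp_add, ← hlc]; congr 1; ring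
  have hd : ∀ k : ℕ, l (ω ^ k * c) - l c = k * (σ * (2 * Real.pi * I / m)) := by
    intro k
    induction k with
    | zero => simp
    | succ k ih =>
      have key := eq_of_log_eq_on hC1 (l := fun z => l (ω ^ (k + 1) * z))
        (m := fun z => l z + (k + 1 : ℕ) * (σ * (2 * Real.pi * I / m)))
        (hl.comp (by fun_prop) fun z hz => hmem _ z (hωk _) hz)
        ((hl.mono hsub).add continuousOn_const) (by
          intro z hz
          rw [hl' _ (hmem _ z (hωk _) hz), exp_add, exp_nat_mul, ← hω, hl' _ (hsub hz)]
          ring) hcm hc'm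
      beta_reduce at key
      have h2 : ω ^ (k + 1) * c' = ω ^ k * c := by rw [pow_succ, mul_assoc, hωc]
      rw [h2] at key
      push_cast at key ⊢
      linear_combination key + ih + hlc
  have := hd m
  rw [hωm, one_mul, sub_self] at this
  have h3 : (m : ℂ) * (↑σ * (2 * ↑Real.pi * I / ↑m)) = σ * (2 * Real.pi * I) := by field_simp
  rw [h3] at this
  have hσ0 : (σ : ℂ) ≠ 0 := by rcases hσ with rfl | rfl <;> simp
  exact mul_ne_zero hσ0 two_pi_I_ne_zero this.symm

/-- **Koebe's lemma**: a bounded holomorphic function which is small along a crosscut seen from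
`0` under a definite angle is small at `0`. -/
theorem norm_pow_le_of_crosscut {F : ℂ → ℂ} {M η : ℝ} (hF : DifferentiableOn ℂ F (ball 0 1))
    (hM : ∀ z ∈ ball (0 : ℂ) 1, ‖F z‖ ≤ M) (hm : 0 < m) (hC : IsCompact C) (hCp : IsPreconnected C)
    (hCb : C ⊆ ball 0 1) (h0 : 0 ∉ C) (hη : ∀ z ∈ C, ‖F z‖ ≤ η) (ha : a ∈ C) (hb : b ∈ C)
    (hab : (b * conj a).re ≤ Real.cos (Real.pi / m) * (‖a‖ * ‖b‖)) :
    ‖F 0‖ ^ (2 * m) ≤ η * M * (M * M) ^ (m - 1) := by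
  have ha0 : a ≠ 0 := fun h => h0 (h ▸ ha)
  have hna : (‖a‖ : ℂ) ≠ 0 := by exact_mod_cast (norm_pos_iff.2 ha0).ne'
  have hM0 : 0 ≤ M := (norm_nonneg _).trans (hM 0 (by simp))
  have hη0 : 0 ≤ η := (norm_nonneg _).trans (hη a ha)
  set u := a / ‖a‖ with hu
  have hu1 : ‖u‖ = 1 := by rw [hu, norm_div, norm_real, norm_norm, div_self (norm_ne_zero_iff.2 ha0)]
  have huu : u * conj u = 1 := by rw [mul_conj, normSq_eq_norm_sq, hu1]; simp
  have hnf := not_far_kaleidoscope (u := u) hm hC hCp h0 ha hb (by rw [hu]; field_simp) hab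
  set K := kaleidoscope m u C with hK
  have hKc : IsCompact K := isCompact_kaleidoscope hm hC
  have hnr : ∀ z, ‖u ^ 2 * conj z‖ = ‖z‖ := fun z => by simp [hu1]
  have hmir : ∀ z ∈ mirror u C, z ∈ ball (0 : ℂ) 1 ∧ z ≠ 0 := by
    rintro z (hz | ⟨z, hz, rfl⟩)
    · exact ⟨hCb hz, fun h => h0 (h ▸ hz)⟩
    · have hz' := hCb hz
      rw [mem_ball_zero_iff] at hz' ⊢
      refine ⟨by rwa [hnr], fun h => h0 ?_⟩
      have := congrArg norm h
      rw [hnr, norm_zero, norm_eq_zero] at this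
      exact this ▸ hz
  have hKb : ∀ z ∈ K, ‖z‖ < 1 ∧ z ≠ 0 := by
    rintro _ ⟨⟨w, z⟩, ⟨hw, hz⟩, rfl⟩
    have hw1 := norm_eq_one_of_pow hm hw
    obtain ⟨h1, h2⟩ := hmir z hz
    refine ⟨by rw [norm_mul, hw1, one_mul]; exact mem_ball_zero_iff.1 h1, mul_ne_zero ?_ h2⟩
    rw [← norm_pos_iff]
    exact hw1 ▸ one_pos
  set G : ℂ → ℂ := fun z => F z * conj (F (u ^ 2 * conj z)) with hG
  have hGd : DifferentiableOn ℂ G (ball 0 1) := by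
    intro z hz
    have hz1 := mem_ball_zero_iff.1 hz
    have h1 : DifferentiableAt ℂ F z := hF.differentiableAt (isOpen_ball.mem_nhds hz)
    have h2 : DifferentiableAt ℂ (fun w => F (u ^ 2 * w)) (conj z) := by
      have : DifferentiableAt ℂ F (u ^ 2 * conj z) := hF.differentiableAt (isOpen_ball.mem_nhds (by
        rw [mem_ball_zero_iff, hnr]; exact hz1))
      exact this.fun_comp' (conj z) (differentiableAt_id.const_mul _)
    have h3 := h2.conj_conj
    rw [conj_conj] at h3
    exact (h1.mul h3).differentiableWithinAt
  have hGM : ∀ z, ‖z‖ < 1 → ‖G z‖ ≤ M * M := fun z hz => by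
    rw [hG, norm_mul, RCLike.norm_conj]
    exact mul_le_mul (hM z (mem_ball_zero_iff.2 hz)) (hM _ (by
      rw [mem_ball_zero_iff, hnr]; exact hz)) (norm_nonneg _) hM0
  have hGη : ∀ z ∈ mirror u C, ‖G z‖ ≤ η * M := by
    rintro z (hz | ⟨z, hz, rfl⟩)
    · rw [hG, norm_mul, RCLike.norm_conj]
      exact mul_le_mul (hη z hz) (hM _ (by
        rw [mem_ball_zero_iff, hnr]; exact mem_ball_zero_iff.1 (hCb hz))) (norm_nonneg _) hη0
    · have hrr : u ^ 2 * conj (u ^ 2 * conj z) = z := by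
        simp only [map_mul, map_pow, conj_conj]
        linear_combination (z + u * conj u * z) * huu
      rw [hG, norm_mul, RCLike.norm_conj, mul_comm]
      beta_reduce
      rw [hrr]
      exact mul_le_mul (hη z hz) (hM _ (by
        rw [mem_ball_zero_iff, hnr]; exact mem_ball_zero_iff.1 (hCb hz))) (norm_nonneg _) hη0
  set W := Polynomial.nthRootsFinset m (1 : ℂ) with hW
  have hmemW : ∀ w, w ∈ W ↔ w ^ m = 1 := fun w => Polynomial.mem_nthRootsFinset hm 1
  have hWc : W.card = m := (Complex.isPrimitiveRoot_exp m hm.ne').card_nthRootsFinset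
  set B := {z | Linked Kᶜ 0 z} with hB
  have hBK : closure B ⊆ B ∪ K := closure_linked_subset hKc.isClosed 0
  have hBb : B ⊆ ball 0 1 := by
    intro z hz
    rw [mem_ball_zero_iff]
    by_contra! hle
    refine hnf (Far.of_linked (far_of_norm_le (fun k hk => (hKb k hk).1.le.trans hle) hz.mem_right
      ?_) hz.symm)
    rintro rfl
    simp at hle; linarith
  have hcl : closure B ⊆ ball 0 1 := hBK.trans (union_subset hBb fun z hz =>
    mem_ball_zero_iff.2 (hKb z hz).1)
  set P : ℂ → ℂ := fun z => ∏ w ∈ W, G (w * z) with hP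
  have hPd : DifferentiableOn ℂ P (ball 0 1) := by
    refine DifferentiableOn.fun_finsetProd fun w hw => hGd.comp (by fun_prop) fun z hz => ?_
    rw [mem_ball_zero_iff, norm_mul, norm_eq_one_of_pow hm ((hmemW w).1 hw), one_mul]
    exact mem_ball_zero_iff.1 hz
  have hPK : ∀ z ∈ K, ‖P z‖ ≤ η * M * (M * M) ^ (m - 1) := by
    rintro z hzK
    have hz1 := (hKb z hzK).1
    obtain ⟨⟨w, c⟩, ⟨hw, hc⟩, rfl⟩ := hzK
    simp only [mem_ofPred_eq] at hw hc hz1 ⊢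
    have hw0 : w ≠ 0 := by rintro rfl; rw [zero_pow hm.ne'] at hw; exact zero_ne_one hw
    have hwW : w⁻¹ ∈ W := by rw [hmemW, inv_pow, hw, inv_one]
    rw [hP, norm_prod, ← Finset.mul_prod_erase W _ hwW, inv_mul_cancel_left₀ hw0]
    refine mul_le_mul (hGη c hc) ?_ (Finset.prod_nonneg fun _ _ => norm_nonneg _) (by positivity)
    refine (Finset.prod_le_prod (g := fun _ => M * M) (fun _ _ => norm_nonneg _)
      fun v hv => hGM _ ?_).trans_eq ?_
    · rw [norm_mul, norm_eq_one_of_pow hm ((hmemW v).1 (Finset.mem_of_mem_erase hv)), one_mul]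
      exact hz1
    · rw [Finset.prod_const, Finset.card_erase_of_mem hwW, hWc]
  have h0K : (0 : ℂ) ∉ K := fun h => (hKb 0 h).2 rfl
  have h0B : (0 : ℂ) ∈ B := Linked.refl h0K
  have hmax := Complex.norm_le_of_forall_mem_frontier_norm_le (isBounded_ball.subset hBb)
    (hPd.mono hcl).diffContOnCl (fun z hz => hPK z ?_) (subset_closure h0B)
  · convert hmax using 1
    simp only [hP, hG, mul_zero, map_zero, Finset.prod_const, hWc, norm_pow, norm_mul,
      RCLike.norm_conj]
    rw [pow_mul, pow_two]
  · exact (hBK hz.1).resolve_left fun h => hz.2 ((isOpen_linked hKc.isClosed 0).interior_eq.symm ▸ h)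

end Koebe
end PlaneTop

namespace PlaneTop
open Filter Metric Topology Complex
open scoped ComplexConjugate

theorem Linked.exists_isCompact {A : Set ℂ} {a b : ℂ} (hA : IsOpen A) (h : Linked A a b) :
    ∃ C ⊆ A, IsCompact C ∧ IsPreconnected C ∧ a ∈ C ∧ b ∈ C := by
  have ho : IsOpen {z | Linked A a z} := by
    simpa using isOpen_linked hA.isClosed_compl a
  have hc : IsConnected {z | Linked A a z} := ⟨⟨b, h⟩, isPreconnected_linked A a⟩
  obtain ⟨γ, hγ⟩ := (ho.isConnected_iff_isPathConnected.1 hc).joinedIn a (Linked.refl h.mem_left) b h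
  refine ⟨range γ, ?_, isCompact_range γ.continuous, isPreconnected_range γ.continuous,
    ⟨0, γ.source⟩, ⟨1, γ.target⟩⟩
  rintro _ ⟨t, rfl⟩
  exact (hγ t).mem_right

section Arc
variable {f : Circle1 → ℂ} (hf : IsEmbedding f)
include hf

theorem exists_isCompact_subarc {x : ℂ} (hx : x ∈ range f) {ε : ℝ} (hε : 0 < ε) :
    ∃ A ⊆ range f, IsCompact A ∧ IsPreconnected A ∧ x ∉ A ∧ range f ⊆ A ∪ ball x ε := by
  obtain ⟨y, rfl⟩ := hx
  obtain ⟨t, rfl⟩ := QuotientAddGroup.mk_surjective y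
  have hcont : Continuous fun s : ℝ => f s := hf.continuous.comp (AddCircle.continuous_mk' 1)
  obtain ⟨s, hs, hst⟩ := Metric.continuousAt_iff.1 hcont.continuousAt ε hε
  set r := min s (1 / 4) with hr
  have hr0 : 0 < r := lt_min hs (by norm_num)
  have hr4 : r ≤ 1 / 4 := min_le_right _ _
  refine ⟨(fun s : ℝ => f s) '' Icc (t + r) (t + 1 - r), ?_, isCompact_Icc.image hcont,
    isPreconnected_Icc.image _ hcont.continuousOn, ?_, ?_⟩
  · rintro _ ⟨u, -, rfl⟩; exact mem_range_self _
  · rintro ⟨u, hu, h⟩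
    have := (AddCircle.coe_eq_coe_iff_of_mem_Ico (p := (1 : ℝ)) (a := t) ⟨by linarith [hu.1], by
      linarith [hu.2]⟩ ⟨le_rfl, by linarith⟩).1 (hf.injective h)
    linarith [hu.1]
  · rintro _ ⟨y, rfl⟩
    have : y ∈ ((↑) : ℝ → Circle1) '' Ioc (t - r) (t - r + 1) := by
      rw [AddCircle.coe_image_Ioc_eq]; trivial
    obtain ⟨u, hu, rfl⟩ := this
    rcases lt_or_ge u (t + r) with h | h
    · right
      refine hst ?_
      rw [Real.dist_eq, abs_lt]
      constructor <;> linarith [min_le_left s (1 / 4), hu.1]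
    · exact Or.inl ⟨u, ⟨h, by linarith [hu.2]⟩, rfl⟩

/-- The complementary domains of a Jordan curve are locally connected at the boundary. -/
theorem exists_linked_inter_ball {x : ℂ} (hx : x ∈ range f) {ε : ℝ} (hε : 0 < ε) :
    ∃ δ > 0, ∀ a ∈ ball x δ, ∀ b ∈ ball x δ, Linked (range f)ᶜ a b →
      Linked ({z | Linked (range f)ᶜ a z} ∩ ball x ε) a b := by
  obtain ⟨A, hAf, hA, hAp, hxA, hcov⟩ := exists_isCompact_subarc hf hx hε
  obtain ⟨r, hr, hrA⟩ := exists_pos_le_norm_sub hA.isClosed hxA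
  refine ⟨min r ε, lt_min hr hε, fun a ha b hb hab => ?_⟩
  have hint : range f ∩ (A ∪ sphere x ε) = A := by
    apply Subset.antisymm
    · rintro z ⟨hz, h | h⟩
      · exact h
      · exact (hcov hz).resolve_right fun h' => (mem_ball.1 h').ne (mem_sphere.1 h)
    · exact fun z hz => ⟨hAf hz, Or.inl hz⟩
  have hl : Linked (A ∪ sphere x ε)ᶜ a b := by
    refine ⟨ball x (min r ε), (convex_ball _ _).isPreconnected, fun z hz => ?_, ha, hb⟩
    have hz := mem_ball.1 hz
    rintro (h | h)
    · rw [dist_eq_norm] at hz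
      exact absurd (hrA z h) (not_le.2 (hz.trans_le (min_le_left _ _)))
    · exact (hz.trans_le (min_le_right _ _)).ne (mem_sphere.1 h)
  obtain ⟨C, h1, h2, h3, h4⟩ := Linked.janiszewski (isCompact_range_loop hf)
    (hA.union (isCompact_sphere x ε)) (by rwa [hint]) hab hl
  refine ⟨C, h1, fun z hz => ⟨⟨C, h1, fun w hw h => h2 hw (Or.inl h), h3, hz⟩, ?_⟩, h3, h4⟩
  refine h1.subset_left_of_subset_union isOpen_ball (isClosed_closedBall (x := x) (ε := ε)).isOpen_compl
    (disjoint_compl_right.mono_left ball_subset_closedBall) (fun w hw => ?_)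
    ⟨a, h3, ball_subset_ball (min_le_right _ _) ha⟩ hz
  rcases lt_trichotomy (dist w x) ε with h | h | h
  · exact Or.inl h
  · exact absurd (Or.inr (Or.inr h)) (h2 hw)
  · exact Or.inr (by simpa using h)

theorem exists_ball_inter_range_subset {N : Set ℂ} (hN : N ⊆ range f) (hNp : IsPreconnected N)
    {p q : ℂ} (hp : p ∈ N) (hq : q ∈ N) (hpq : p ≠ q) :
    ∃ x ∈ range f, ∃ ε > 0, range f ∩ ball x ε ⊆ N := by
  obtain ⟨p, rfl⟩ := hN hp
  obtain ⟨q, rfl⟩ := hN hq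
  obtain ⟨s, rfl⟩ := QuotientAddGroup.mk_surjective p
  set Q := f ⁻¹' N with hQ
  have hQp : IsPreconnected Q := by
    rw [← hf.isInducing.isPreconnected_image, image_preimage_eq_of_subset hN]
    exact hNp
  obtain ⟨t, ht, rfl⟩ : q ∈ ((↑) : ℝ → Circle1) '' Ico s (s + 1) := by
    rw [AddCircle.coe_image_Ico_eq]; trivial
  have hst : s < t := ht.1.lt_of_ne fun h => hpq (by rw [h])
  have hopen : ∀ a b : ℝ, IsOpen (((↑) : ℝ → Circle1) '' Ioo a b) := fun a b =>
    QuotientAddGroup.isOpenMap_coe _ isOpen_Ioo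
  have key : ∃ O : Set Circle1, IsOpen O ∧ O.Nonempty ∧ O ⊆ Q := by
    by_contra! hno
    have hex : ∀ a b : ℝ, a < b → ∃ u ∈ Ioo a b, (u : Circle1) ∉ Q := by
      intro a b hab
      obtain ⟨y, ⟨u, hu, rfl⟩, hy⟩ := not_subset.1 (hno _ (hopen a b) ((nonempty_Ioo.2 hab).image _))
      exact ⟨u, hu, hy⟩
    obtain ⟨u, hu, huQ⟩ := hex s t hst
    obtain ⟨v, hv, hvQ⟩ := hex t (s + 1) ht.2
    have hcov : Q ⊆ ((↑) : ℝ → Circle1) '' Ioo u v ∪ ((↑) : ℝ → Circle1) '' Ioo v (u + 1) := by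
      intro y hy
      obtain ⟨w, hw, rfl⟩ : y ∈ ((↑) : ℝ → Circle1) '' Ico u (u + 1) := by
        rw [AddCircle.coe_image_Ico_eq]; trivial
      rcases lt_trichotomy w v with h | rfl | h
      · exact Or.inl ⟨w, ⟨hw.1.lt_of_ne fun h => huQ (h ▸ hy), h⟩, rfl⟩
      · exact absurd hy hvQ
      · exact Or.inr ⟨w, ⟨h, hw.2⟩, rfl⟩
    have hdis : Disjoint (((↑) : ℝ → Circle1) '' Ioo u v) (((↑) : ℝ → Circle1) '' Ioo v (u + 1)) := by
      rw [disjoint_left]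
      rintro _ ⟨a, ha, rfl⟩ ⟨b, hb, hab⟩
      have hu1 : v < u + 1 := by linarith [hv.2, hu.1]
      have := (AddCircle.coe_eq_coe_iff_of_mem_Ico (p := (1 : ℝ)) (a := u)
        ⟨by linarith [hb.1, ha.1, ha.2], hb.2⟩ ⟨ha.1.le, by linarith [ha.2]⟩).1 hab
      linarith [ha.2, hb.1]
    have h1 := hQp.subset_left_of_subset_union (hopen u v) (hopen v (u + 1)) hdis hcov
      ⟨t, hq, t, ⟨hu.2, hv.1⟩, rfl⟩ hp
    refine disjoint_left.1 hdis h1 ⟨s + 1, ⟨hv.2, by linarith [hu.1]⟩, ?_⟩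
    exact AddCircle.coe_add_period 1 s
  obtain ⟨O, hO, ⟨y, hy⟩, hOQ⟩ := key
  obtain ⟨N', hN', rfl⟩ := hf.isInducing.isOpen_iff.1 hO
  obtain ⟨ε, hε, hb⟩ := Metric.isOpen_iff.1 hN' (f y) hy
  refine ⟨f y, mem_range_self _, ε, hε, ?_⟩
  rintro _ ⟨⟨z, rfl⟩, hz⟩
  exact hOQ (hb hz)

end Arc

/-- A holomorphic function vanishing on an accessible piece of the boundary has a zero inside. -/
theorem exists_eq_zero_of_boundary {Ω : Set ℂ} (hΩ : IsOpen Ω) {F : ℂ → ℂ}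
    (hF : DifferentiableOn ℂ F Ω) (hFc : ContinuousOn F (closure Ω)) {x : ℂ} (hx : x ∈ closure Ω)
    (hx' : x ∈ closure (closure Ω)ᶜ) {ε : ℝ} (hε : 0 < ε)
    (h : ∀ z ∈ closure Ω, z ∉ Ω → z ∈ ball x ε → F z = 0) : ∃ z ∈ Ω, F z = 0 := by
  obtain ⟨e, he, hex⟩ := Metric.mem_closure_iff.1 hx' (ε / 4) (by positivity)
  obtain ⟨z₀, hz₀, hzx⟩ := Metric.mem_closure_iff.1 hx (ε / 4) (by positivity)
  obtain ⟨r, hr, hre⟩ := Metric.isOpen_iff.1 isClosed_closure.isOpen_compl e he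
  set ρ := dist e z₀ with hρ
  have hρ0 : 0 < ρ := dist_pos.2 fun h => he (h ▸ subset_closure hz₀)
  have hρε : ρ < ε / 2 := by
    have := dist_triangle_left e z₀ x
    linarith
  have hrot : ∀ w z : ℂ, ‖w‖ = 1 → ‖z₀ + w * (z - z₀) - z₀‖ = ‖z - z₀‖ := fun w z hw => by
    rw [add_sub_cancel_left, norm_mul, hw, one_mul]
  obtain ⟨W, hW⟩ := (isCompact_sphere z₀ ρ).elim_finite_subcover
    (fun w : sphere (0 : ℂ) 1 => {p | z₀ + w * (p - z₀) ∈ ball e r})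
    (fun w => isOpen_ball.preimage (by fun_prop)) (fun p hp => by
      have hp' : ‖p - z₀‖ = ρ := by rw [← dist_eq_norm]; exact hp
      have hpne : p - z₀ ≠ 0 := by rw [← norm_pos_iff, hp']; exact hρ0
      refine mem_iUnion.2 ⟨⟨(e - z₀) / (p - z₀), ?_⟩, ?_⟩
      · rw [mem_sphere_zero_iff_norm, norm_div, hp', ← dist_eq_norm, ← hρ, div_self hρ0.ne']
      · simp [div_mul_cancel₀ _ hpne, hr])
  set D := {z | ‖z - z₀‖ < ρ ∧ ∀ w ∈ W, z₀ + (w : ℂ) * (z - z₀) ∈ Ω} with hD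
  have hDo : IsOpen D := by
    have : D = {z | ‖z - z₀‖ < ρ} ∩ ⋂ w ∈ W, (fun z => z₀ + (w : ℂ) * (z - z₀)) ⁻¹' Ω := by
      ext z; simp [hD]
    rw [this]
    exact (isOpen_lt (by fun_prop) (by fun_prop)).inter
      (isOpen_biInter_finset fun w _ => hΩ.preimage (by fun_prop))
  have hz₀D : z₀ ∈ D := ⟨by simp [hρ0], fun w _ => by simpa using hz₀⟩
  have hcl : ∀ z ∈ closure D, ‖z - z₀‖ ≤ ρ ∧ ∀ w ∈ W, z₀ + (w : ℂ) * (z - z₀) ∈ closure Ω := by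
    intro z hz
    have h1 : closure D ⊆ {z | ‖z - z₀‖ ≤ ρ} :=
      closure_minimal (fun z hz => hz.1.le) (isClosed_le (by fun_prop) (by fun_prop))
    refine ⟨h1 hz, fun w hw => ?_⟩
    have hc : Continuous fun z : ℂ => z₀ + (w : ℂ) * (z - z₀) := by fun_prop
    exact map_mem_closure (f := fun z : ℂ => z₀ + (w : ℂ) * (z - z₀)) hc hz fun z hz => hz.2 w hw
  set P : ℂ → ℂ := fun z => ∏ w ∈ W, F (z₀ + (w : ℂ) * (z - z₀)) with hP
  have hPd : DiffContOnCl ℂ P D := by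
    constructor
    · exact DifferentiableOn.fun_finsetProd fun w hw => hF.comp (by fun_prop) fun z hz => hz.2 w hw
    · exact continuousOn_finsetProd _ fun w hw => hFc.comp (by fun_prop) fun z hz =>
        (hcl z hz).2 w hw
  have hDb : Bornology.IsBounded D := (isBounded_ball (x := z₀) (r := ρ)).subset fun z hz => by
    rw [mem_ball, dist_eq_norm]; exact hz.1
  have hPz : ‖P z₀‖ ≤ 0 := by
    refine Complex.norm_le_of_forall_mem_frontier_norm_le hDb hPd (fun z hz => ?_)
      (subset_closure hz₀D)
    rw [hDo.frontier_eq] at hz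
    obtain ⟨h1, h2⟩ := hcl z hz.1
    by_cases hw : ∀ w ∈ W, z₀ + (w : ℂ) * (z - z₀) ∈ Ω
    · have h3 : ‖z - z₀‖ = ρ := h1.antisymm (not_lt.1 fun h => hz.2 ⟨h, hw⟩)
      obtain ⟨w, hwW, hwz⟩ := mem_iUnion₂.1 (hW (show z ∈ sphere z₀ ρ by
        rw [mem_sphere, dist_eq_norm]; exact h3))
      exact absurd (subset_closure (hw w hwW)) (hre hwz)
    · push Not at hw
      obtain ⟨w, hwW, hwz⟩ := hw
      rw [hP]
      beta_reduce
      rw [Finset.prod_eq_zero hwW, norm_zero]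
      refine h _ (h2 w hwW) hwz ?_
      rw [mem_ball]
      have h4 : dist (z₀ + (w : ℂ) * (z - z₀)) z₀ ≤ ρ := by
        rw [dist_eq_norm, hrot _ _ (by simp)]; exact h1
      have h5 := dist_triangle (z₀ + (w : ℂ) * (z - z₀)) z₀ x
      rw [dist_comm z₀ x] at h5
      linarith
  have : P z₀ = 0 := norm_le_zero_iff.1 hPz
  simp only [hP, sub_self, mul_zero, add_zero, Finset.prod_const] at this
  exact ⟨z₀, hz₀, eq_zero_of_pow_eq_zero this⟩

end PlaneTop

namespace PlaneTop
open Filter Metric Topology Complex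
open scoped ComplexConjugate

/-- A Riemann map `ψ` of the unit disc onto `Ω`, with inverse `φ`, fixing the origin. -/
structure RiemannMap (Ω : Set ℂ) (ψ φ : ℂ → ℂ) : Prop where
  diff : DifferentiableOn ℂ ψ (ball 0 1)
  diff_inv : DifferentiableOn ℂ φ Ω
  maps : ∀ z, ‖z‖ < 1 → ψ z ∈ Ω
  maps_inv : ∀ z ∈ Ω, ‖φ z‖ < 1
  left : ∀ z, ‖z‖ < 1 → φ (ψ z) = z
  right : ∀ z ∈ Ω, ψ (φ z) = z
  zero : ψ 0 = 0

theorem isCompact_bounded_component {K : Set ℂ} {a : ℂ} (ha : ¬ Far K a) :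
    IsCompact (closure {z | Linked Kᶜ a z}) := by
  simp only [Far, not_forall, not_exists, not_and'] at ha
  obtain ⟨R, hR⟩ := ha
  refine Bornology.IsBounded.isCompact_closure (isBounded_iff_forall_norm_le.2 ⟨R, fun z hz => ?_⟩)
  exact not_lt.1 (hR z hz)

section Boundary
variable {f : Circle1 → ℂ} (hf : IsEmbedding f) (h0 : 0 ∉ range f) (h0' : ¬ Far (range f) 0)
include hf h0 h0'

theorem exists_riemannMap : ∃ ψ φ, RiemannMap {z | Linked (range f)ᶜ 0 z} ψ φ := by
  have hJ := isCompact_range_loop hf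
  have hU := isOpen_linked hJ.isClosed 0
  obtain ⟨ψ, h1, h2, h3, h4⟩ := exists_riemann_map hU
    ⟨⟨0, Linked.refl h0⟩, isPreconnected_linked _ _⟩
    ((isCompact_bounded_component h0').isBounded.subset subset_closure) (Linked.refl h0)
    (oneEnded_inside hJ (isPreconnected_range_loop hf) (range_nonempty f) h0')
  obtain ⟨φ, h5, h6⟩ := exists_inverse_of_injOn isOpen_ball h1 h2
  rw [h3] at h5
  refine ⟨ψ, φ, h1, h5, fun z hz => h3 ▸ mem_image_of_mem ψ (mem_ball_zero_iff.2 hz), ?_,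
    fun z hz => h6 z (mem_ball_zero_iff.2 hz), ?_, h4⟩
  · rw [← h3]
    rintro _ ⟨z, hz, rfl⟩
    rw [h6 z hz]
    exact mem_ball_zero_iff.1 hz
  · rw [← h3]
    rintro _ ⟨z, hz, rfl⟩
    rw [h6 z hz]

theorem closure_inside : closure {z | Linked (range f)ᶜ 0 z} = {z | Linked (range f)ᶜ 0 z} ∪ range f :=
  (closure_linked_subset (isCompact_range_loop hf).isClosed 0).antisymm
    (union_subset subset_closure fun _ hz => (range_subset_closure hf h0 h0' hz).1)

theorem exists_tendsto_boundary {ψ φ : ℂ → ℂ} (H : RiemannMap {z | Linked (range f)ᶜ 0 z} ψ φ) {x : ℂ}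
    (hx : x ∈ range f) :
    ∃ y, ‖y‖ = 1 ∧ Tendsto φ (𝓝[{z | Linked (range f)ᶜ 0 z}] x) (𝓝 y) := by
  set Ω := {z | Linked (range f)ᶜ 0 z} with hΩ
  have hΩo : IsOpen Ω := isOpen_linked (isCompact_range_loop hf).isClosed 0
  have hxcl : x ∈ closure Ω := (range_subset_closure hf h0 h0' hx).1
  have hxΩ : x ∉ Ω := fun h => h.mem_right hx
  have hx0 : x ≠ 0 := fun h => h0 (h ▸ hx)
  have hne : (𝓝[Ω] x).NeBot := mem_closure_iff_nhdsWithin_neBot.1 hxcl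
  have hcb : closedBall (0 : ℂ) 1 ∈ map φ (𝓝[Ω] x) := by
    refine mem_map.2 ?_
    filter_upwards [self_mem_nhdsWithin] with z hz
    exact mem_closedBall_zero_iff.2 (H.maps_inv z hz).le
  have hcl : ∀ y, ClusterPt y (map φ (𝓝[Ω] x)) → ∀ s ∈ 𝓝 y, ∀ N ∈ 𝓝 x, ∃ z ∈ Ω, z ∈ N ∧ φ z ∈ s := by
    intro y hy s hs N hN
    have := mapClusterPt_iff_frequently.1 hy s hs
    obtain ⟨z, hz1, hz2, hz3⟩ := (this.and_eventually ((eventually_mem_set.2 self_mem_nhdsWithin).and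
      (eventually_mem_set.2 (mem_nhdsWithin_of_mem_nhds hN)))).exists
    exact ⟨z, hz2, hz3, hz1⟩
  have hnorm : ∀ y, ClusterPt y (map φ (𝓝[Ω] x)) → ‖y‖ = 1 := by
    intro y hy
    have h1 : y ∈ closedBall (0 : ℂ) 1 := isClosed_iff_clusterPt.1 isClosed_closedBall y
      (hy.mono (le_principal_iff.2 hcb))
    refine (mem_closedBall_zero_iff.1 h1).antisymm (not_lt.1 fun hlt => ?_)
    have hc : ContinuousAt ψ y := (H.diff.differentiableAt (isOpen_ball.mem_nhds
      (mem_ball_zero_iff.2 hlt))).continuousAt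
    have hyx : ψ y ≠ x := fun h => hxΩ (h ▸ H.maps y hlt)
    obtain ⟨U, V, hU, hV, hyU, hxV, hUV⟩ := t2_separation hyx
    obtain ⟨z, hz, hzV, hzU⟩ := hcl y hy _ (hc.preimage_mem_nhds (hU.mem_nhds hyU)) V (hV.mem_nhds hxV)
    have : ψ (φ z) ∈ U := hzU
    rw [H.right z hz] at this
    exact disjoint_left.1 hUV this hzV
  have huniq : ∀ α β, ClusterPt α (map φ (𝓝[Ω] x)) → ClusterPt β (map φ (𝓝[Ω] x)) → α = β := by
    intro α β hα hβ
    by_contra hne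
    have hα1 := hnorm α hα
    have hβ1 := hnorm β hβ
    have hre : (β * conj α).re < 1 := by
      have e1 : normSq (β - α) = 2 - 2 * (β * conj α).re := by
        rw [normSq_sub, normSq_eq_norm_sq, normSq_eq_norm_sq, hα1, hβ1]; ring
      have e2 : 0 < normSq (β - α) := normSq_pos.2 (sub_ne_zero.2 (Ne.symm hne))
      linarith
    obtain ⟨m, hm, hmcos⟩ : ∃ m : ℕ, 0 < m ∧ (β * conj α).re < Real.cos (Real.pi / m) := by
      have h1 : Tendsto (fun m : ℕ => Real.cos (Real.pi / m)) atTop (𝓝 1) := by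
        have := (Real.continuous_cos.tendsto 0).comp (tendsto_const_div_atTop_nhds_zero_nat Real.pi)
        simpa [Function.comp_def] using this
      obtain ⟨m, h2, h3⟩ := ((h1.eventually_const_lt hre).and (eventually_gt_atTop 0)).exists
      exact ⟨m, h3, h2⟩
    have hopen : IsOpen {p : ℂ × ℂ | (p.2 * conj p.1).re < Real.cos (Real.pi / m) * (‖p.1‖ * ‖p.2‖)} :=
      isOpen_lt (by fun_prop) (by fun_prop)
    have hmem : {p : ℂ × ℂ | (p.2 * conj p.1).re < Real.cos (Real.pi / m) * (‖p.1‖ * ‖p.2‖)} ∈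
        𝓝 (α, β) := hopen.mem_nhds (by simpa [hα1, hβ1] using hmcos)
    rw [nhds_prod_eq, mem_prod_iff] at hmem
    obtain ⟨Vα, hVα, Vβ, hVβ, hV⟩ := hmem
    obtain ⟨M, hM⟩ := (isCompact_bounded_component h0').isBounded.exists_norm_le
    have hM0 : 0 ≤ M := (norm_nonneg _).trans (hM 0 (subset_closure (Linked.refl h0)))
    set M' := M + ‖x‖ with hM'
    have hx0' := norm_pos_iff.2 hx0
    set Q := M' * (M' * M') ^ (m - 1) with hQ
    have hQ0 : 0 ≤ Q := by positivity
    have key : ∀ η, 0 < η → η ≤ ‖x‖ → ‖x‖ ^ (2 * m) ≤ η * Q := by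
      intro η hη hηx
      obtain ⟨δ, hδ, hlink⟩ := exists_linked_inter_ball hf hx hη
      obtain ⟨z₁, h1, h1', h1''⟩ := hcl α hα Vα hVα _ (ball_mem_nhds x hδ)
      obtain ⟨z₂, h2, h2', h2''⟩ := hcl β hβ Vβ hVβ _ (ball_mem_nhds x hδ)
      obtain ⟨C, hC, hCc, hCp, hz1, hz2⟩ := ((hlink z₁ h1' z₂ h2' (h1.symm.trans h2)).mono
        (B := Ω ∩ ball x η) (fun z hz => ⟨h1.trans hz.1, hz.2⟩)).exists_isCompact
          (hΩo.inter isOpen_ball)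
      have hφC : ContinuousOn φ C := H.diff_inv.continuousOn.mono fun z hz => (hC hz).1
      have := norm_pow_le_of_crosscut (F := fun z => ψ z - x) (M := M') (η := η) (C := φ '' C)
        (a := φ z₁) (b := φ z₂) (m := m) (H.diff.sub_const x) (fun z hz => ?_) hm
        (hCc.image_of_continuousOn hφC) (hCp.image φ hφC) ?_ ?_ ?_ (mem_image_of_mem φ hz1)
        (mem_image_of_mem φ hz2) (le_of_lt (hV (mk_mem_prod h1'' h2'')))
      · simpa [H.zero, mul_assoc] using this
      · have := hM (ψ z) (subset_closure (H.maps z (mem_ball_zero_iff.1 hz)))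
        exact (norm_sub_le _ _).trans (by linarith)
      · rintro _ ⟨z, hz, rfl⟩; exact mem_ball_zero_iff.2 (H.maps_inv z (hC hz).1)
      · rintro ⟨z, hz, hz0⟩
        have h3 := H.right z (hC hz).1
        rw [hz0, H.zero] at h3
        have h4 := (hC hz).2
        rw [← h3, mem_ball, dist_zero_left] at h4
        linarith
      · rintro _ ⟨z, hz, rfl⟩
        rw [H.right z (hC hz).1, ← dist_eq_norm]
        exact (mem_ball.1 (hC hz).2).le
    have hxm : 0 < ‖x‖ ^ (2 * m) := by positivity
    have := key (min ‖x‖ (‖x‖ ^ (2 * m) / (Q + 1))) (by positivity) (min_le_left _ _)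
    have h1 : min ‖x‖ (‖x‖ ^ (2 * m) / (Q + 1)) * Q ≤ ‖x‖ ^ (2 * m) / (Q + 1) * Q :=
      mul_le_mul_of_nonneg_right (min_le_right _ _) hQ0
    have h2 : ‖x‖ ^ (2 * m) / (Q + 1) * Q < ‖x‖ ^ (2 * m) := by
      rw [div_mul_eq_mul_div, div_lt_iff₀ (by positivity)]
      nlinarith
    linarith
  obtain ⟨y, -, hy⟩ := (isCompact_closedBall (0 : ℂ) 1).exists_clusterPt (f := map φ (𝓝[Ω] x))
    (le_principal_iff.2 hcb)
  exact ⟨y, hnorm y hy, (isCompact_closedBall (0 : ℂ) 1).le_nhds_of_unique_clusterPt hcb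
    fun z _ hz => huniq _ _ hz hy⟩

end Boundary
end PlaneTop

namespace PlaneTop
open Filter Metric Topology Complex

theorem continuousOn_leftInverse_of_isCompact {X Y : Type*} [TopologicalSpace X]
    [TopologicalSpace Y] [T2Space Y] {K : Set X} (hK : IsCompact K) {e : X → Y} {g : Y → X}
    (he : ContinuousOn e K) (hg : ∀ x ∈ K, g (e x) = x) : ContinuousOn g (e '' K) := by
  refine continuousOn_iff_isClosed.2 fun t ht => ⟨e '' (K ∩ t),
    ((hK.inter_right ht).image_of_continuousOn (he.mono inter_subset_left)).isClosed, ?_⟩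
  ext y
  constructor
  · rintro ⟨h1, x, hx, rfl⟩
    rw [mem_preimage, hg x hx] at h1
    exact ⟨⟨x, ⟨hx, h1⟩, rfl⟩, ⟨x, hx, rfl⟩⟩
  · rintro ⟨⟨x, hx, rfl⟩, h2⟩
    exact ⟨by rw [mem_preimage, hg x hx.1]; exact hx.2, h2⟩

section Boundary
variable {f : Circle1 → ℂ} (hf : IsEmbedding f) (h0 : 0 ∉ range f) (h0' : ¬ Far (range f) 0)
include hf h0 h0'

theorem exists_boundary_extension {ψ φ : ℂ → ℂ}
    (H : RiemannMap {z | Linked (range f)ᶜ 0 z} ψ φ) :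
    ∃ e : ℂ → ℂ, ContinuousOn e (closure {z | Linked (range f)ᶜ 0 z}) ∧
      (∀ z, Linked (range f)ᶜ 0 z → e z = φ z) ∧ ∀ x ∈ range f, ‖e x‖ = 1 := by
  refine ⟨extendFrom {z | Linked (range f)ᶜ 0 z} φ,
    continuousOn_extendFrom subset_rfl fun x hx => ?_, fun z hz => ?_, fun x hx => ?_⟩
  · rw [closure_inside hf h0 h0'] at hx
    obtain hx | hx := hx
    · exact ⟨φ x, H.diff_inv.continuousOn x hx⟩
    · obtain ⟨y, -, hy⟩ := exists_tendsto_boundary hf h0 h0' H hx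
      exact ⟨y, hy⟩
  · exact extendFrom_eq (subset_closure hz) (H.diff_inv.continuousOn z hz)
  · obtain ⟨y, h1, hy⟩ := exists_tendsto_boundary hf h0 h0' H hx
    rwa [extendFrom_eq (range_subset_closure hf h0 h0' hx).1 hy]

omit hf h0 in
theorem isPreconnected_boundary_fibre {ψ φ e : ℂ → ℂ}
    (H : RiemannMap {z | Linked (range f)ᶜ 0 z} ψ φ)
    (hec : ContinuousOn e (closure {z | Linked (range f)ᶜ 0 z}))
    (he : ∀ z, Linked (range f)ᶜ 0 z → e z = φ z) (α : ℂ) :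
    IsPreconnected {x ∈ closure {z | Linked (range f)ᶜ 0 z} | e x = α} := by
  set Ω := {z | Linked (range f)ᶜ 0 z} with hΩ
  set N := {x ∈ closure Ω | e x = α} with hN
  have hcl : IsCompact (closure Ω) := isCompact_bounded_component h0'
  have hNc : IsClosed N := hec.preimage_isClosed_of_isClosed isClosed_closure isClosed_singleton
  have hNK : IsCompact N := hcl.of_isClosed_subset hNc fun x hx => hx.1
  rw [isPreconnected_iff_subset_of_fully_disjoint_closed hNc]
  intro u v hu hv huv hd
  by_contra! hcon
  obtain ⟨⟨a, ha, hav⟩, b, hb, hbu⟩ := And.intro (not_subset.1 hcon.2) (not_subset.1 hcon.1)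
  have hau := (huv ha).resolve_right hav
  have hbv := (huv hb).resolve_left hbu
  obtain ⟨U, V, hU, hV, huU, hvV, hUV⟩ := SeparatedNhds.of_isCompact_isCompact
    (hNK.inter_right hu) (hNK.inter_right hv) (hd.mono inter_subset_right inter_subset_right)
  obtain ⟨δ, hδ, hδ'⟩ : ∃ δ > 0, ∀ x ∈ closure Ω, dist (e x) α < δ → x ∈ U ∪ V := by
    have hKc : IsCompact (e '' (closure Ω \ (U ∪ V))) :=
      (hcl.diff (hU.union hV)).image_of_continuousOn (hec.mono sdiff_subset)
    have hα : α ∉ e '' (closure Ω \ (U ∪ V)) := by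
      rintro ⟨x, hx, hxα⟩
      have hxN : x ∈ N := ⟨hx.1, hxα⟩
      exact hx.2 ((huv hxN).imp (fun h => huU ⟨hxN, h⟩) fun h => hvV ⟨hxN, h⟩)
    obtain ⟨r, hr, hr'⟩ := exists_pos_le_norm_sub hKc.isClosed hα
    refine ⟨r, hr, fun x hx hxr => by_contra fun hxU => ?_⟩
    have := hr' _ (mem_image_of_mem e ⟨hx, hxU⟩)
    rw [dist_eq_norm] at hxr
    linarith
  have hA : IsPreconnected (ψ '' (ball 0 1 ∩ ball α δ)) :=
    ((convex_ball (0 : ℂ) 1).inter (convex_ball α δ)).isPreconnected.image ψ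
      (H.diff.continuousOn.mono inter_subset_left)
  have hAs : ψ '' (ball 0 1 ∩ ball α δ) ⊆ U ∪ V := by
    rintro _ ⟨w, ⟨hw, hw'⟩, rfl⟩
    have hw := mem_ball_zero_iff.1 hw
    refine hδ' _ (subset_closure (H.maps w hw)) ?_
    rw [he _ (H.maps w hw), H.left w hw]
    exact hw'
  have hmeet : ∀ x ∈ N, ∀ O, IsOpen O → x ∈ O → (ψ '' (ball 0 1 ∩ ball α δ) ∩ O).Nonempty := by
    intro x hx O hO hxO
    have hev : ∀ᶠ z in 𝓝[closure Ω] x, dist (e z) α < δ ∧ z ∈ O := by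
      refine Filter.Eventually.and ?_ (mem_nhdsWithin_of_mem_nhds (hO.mem_nhds hxO))
      refine (hec x hx.1).eventually (p := fun w => dist w α < δ) ?_
      rw [hx.2]
      exact ball_mem_nhds α hδ
    obtain ⟨W, hW, hxW, hWs⟩ := mem_nhdsWithin.1 hev
    obtain ⟨z, hzW, hz⟩ := mem_closure_iff.1 hx.1 W hW hxW
    obtain ⟨h1, h2⟩ := hWs ⟨hzW, subset_closure hz⟩
    rw [he z hz] at h1
    exact ⟨z, ⟨φ z, ⟨mem_ball_zero_iff.2 (H.maps_inv z hz), h1⟩, H.right z hz⟩, h2⟩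
  obtain ⟨z, -, hz⟩ := hA U V hU hV hAs (hmeet a ha U hU (huU ⟨ha, hau⟩))
    (hmeet b hb V hV (hvV ⟨hb, hbv⟩))
  exact disjoint_left.1 hUV hz.1 hz.2

theorem injOn_boundary_extension {ψ φ e : ℂ → ℂ}
    (H : RiemannMap {z | Linked (range f)ᶜ 0 z} ψ φ)
    (hec : ContinuousOn e (closure {z | Linked (range f)ᶜ 0 z}))
    (he : ∀ z, Linked (range f)ᶜ 0 z → e z = φ z) (he1 : ∀ x ∈ range f, ‖e x‖ = 1) :
    InjOn e (closure {z | Linked (range f)ᶜ 0 z}) := by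
  set Ω := {z | Linked (range f)ᶜ 0 z} with hΩ
  have hcl := closure_inside hf h0 h0'
  have hlt : ∀ x ∈ Ω, ‖e x‖ < 1 := fun x hx => he x hx ▸ H.maps_inv x hx
  intro p hp q hq hpq
  by_contra hne
  by_cases hpΩ : p ∈ Ω
  · have hqΩ : q ∈ Ω := by
      rw [hcl] at hq
      refine hq.resolve_right fun h => ?_
      have := hlt p hpΩ
      rw [hpq, he1 q h] at this
      exact lt_irrefl _ this
    rw [he p hpΩ, he q hqΩ] at hpq
    exact hne (by rw [← H.right p hpΩ, hpq, H.right q hqΩ])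
  have hpJ : p ∈ range f := (hcl ▸ hp).resolve_left hpΩ
  have hα := he1 p hpJ
  have hsub : {x ∈ closure Ω | e x = e p} ⊆ range f := by
    rintro x ⟨hx, hxp⟩
    rw [hcl] at hx
    refine hx.resolve_left fun h => ?_
    have := hlt x h
    rw [hxp, hα] at this
    exact lt_irrefl _ this
  obtain ⟨x, hx, ε, hε, hsub'⟩ := exists_ball_inter_range_subset hf hsub
    (isPreconnected_boundary_fibre h0' H hec he (e p)) ⟨hp, rfl⟩ ⟨hq, hpq.symm⟩ hne
  have hJ := isCompact_range_loop hf
  obtain ⟨hx1, hx2⟩ := range_subset_closure hf h0 h0' hx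
  have hx3 : x ∈ closure (closure Ω)ᶜ := by
    refine closure_mono ?_ hx2
    intro z hz hzcl
    rw [hcl] at hzcl
    obtain h | h := hzcl
    · exact h0' (hz.of_linked (Linked.symm h))
    · exact hz.notMem h
  obtain ⟨z, hz, hz0⟩ := exists_eq_zero_of_boundary (F := fun z => e z - e p)
    (isOpen_linked hJ.isClosed 0)
    ((H.diff_inv.congr fun z hz => he z hz).sub_const _) (hec.sub continuousOn_const) hx1 hx3 hε
    fun z hz hzΩ hzb => sub_eq_zero.2 (hsub' ⟨(hcl ▸ hz).resolve_left hzΩ, hzb⟩).2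
  have := hlt z hz
  rw [sub_eq_zero.1 hz0, hα] at this
  exact lt_irrefl _ this

/-- A collar of a Jordan curve on its bounded side. -/
theorem exists_collar : ∃ Φ : Circle1 × ℝ → ℂ, ContinuousOn Φ (univ ×ˢ Icc 0 (1 / 2)) ∧
    InjOn Φ (univ ×ˢ Icc 0 (1 / 2)) ∧ (∀ θ, Φ (θ, 0) = f θ) ∧
    ∀ θ, ∀ r ∈ Ioc (0 : ℝ) (1 / 2), Linked (range f)ᶜ 0 (Φ (θ, r)) ∧ Φ (θ, r) ≠ 0 := by
  obtain ⟨ψ, φ, H⟩ := exists_riemannMap hf h0 h0'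
  obtain ⟨e, hec, he, he1⟩ := exists_boundary_extension hf h0 h0' H
  have hinj := injOn_boundary_extension hf h0 h0' H hec he he1
  have hcl := closure_inside hf h0 h0'
  set Ω := {z | Linked (range f)ᶜ 0 z} with hΩ
  have hcpt : IsCompact (closure Ω) := isCompact_bounded_component h0'
  set Ψ := Function.invFunOn e (closure Ω) with hΨ
  have hΨe : ∀ x ∈ closure Ω, Ψ (e x) = x := fun x hx => hinj.leftInvOn_invFunOn hx
  have hdisc : ∀ w, ‖w‖ < 1 → e (ψ w) = w := fun w hw => by rw [he _ (H.maps w hw), H.left w hw]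
  have himg : closedBall 0 1 ⊆ e '' closure Ω := by
    rw [← closure_ball _ one_ne_zero]
    refine closure_minimal (fun w hw => ?_) (hcpt.image_of_continuousOn hec).isClosed
    rw [mem_ball_zero_iff] at hw
    exact ⟨ψ w, subset_closure (H.maps w hw), hdisc w hw⟩
  have hΨc := (continuousOn_leftInverse_of_isCompact hcpt hec hΨe).mono himg
  have heΨ : ∀ w ∈ closedBall (0 : ℂ) 1, e (Ψ w) = w := by
    intro w hw
    obtain ⟨x, hx, rfl⟩ := himg hw
    rw [hΨe x hx]
  have hJcl : ∀ θ, f θ ∈ closure Ω := fun θ => hcl ▸ Or.inr (mem_range_self θ)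
  have hn : ∀ θ, ∀ r ∈ Icc (0 : ℝ) (1 / 2), ‖((1 - r : ℝ) : ℂ) * e (f θ)‖ = 1 - r := by
    intro θ r hr
    rw [norm_mul, he1 _ (mem_range_self θ), mul_one, norm_real, Real.norm_of_nonneg]
    linarith [hr.2]
  have hmem : ∀ θ, ∀ r ∈ Icc (0 : ℝ) (1 / 2), ((1 - r : ℝ) : ℂ) * e (f θ) ∈ closedBall (0 : ℂ) 1 := by
    intro θ r hr
    rw [mem_closedBall_zero_iff, hn θ r hr]
    linarith [hr.1]
  have hef : Continuous fun θ => e (f θ) :=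
    continuousOn_univ.1 (hec.comp hf.continuous.continuousOn fun θ _ => hJcl θ)
  refine ⟨fun p => Ψ (((1 - p.2 : ℝ) : ℂ) * e (f p.1)), ?_, ?_, ?_, ?_⟩
  · exact hΨc.comp (Continuous.continuousOn
      ((continuous_ofReal.comp (continuous_const.sub continuous_snd)).mul (hef.comp continuous_fst))) fun p hp => hmem p.1 p.2 hp.2
  · rintro ⟨θ, r⟩ ⟨-, hr⟩ ⟨θ', r'⟩ ⟨-, hr'⟩ h
    have h1 : ((1 - r : ℝ) : ℂ) * e (f θ) = ((1 - r' : ℝ) : ℂ) * e (f θ') := by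
      rw [← heΨ _ (hmem θ r hr), ← heΨ _ (hmem θ' r' hr')]
      exact congrArg e h
    have h2 : r = r' := by
      have := congrArg norm h1
      rw [hn θ r hr, hn θ' r' hr'] at this
      linarith
    subst h2
    have h3 : ((1 - r : ℝ) : ℂ) ≠ 0 := ofReal_ne_zero.2 (by linarith [hr.2])
    rw [hf.injective (hinj (hJcl θ) (hJcl θ') (mul_left_cancel₀ h3 h1))]
  · intro θ
    simp [hΨe _ (hJcl θ)]
  · intro θ r hr
    have hr' : r ∈ Icc (0 : ℝ) (1 / 2) := ⟨hr.1.le, hr.2⟩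
    set w := ((1 - r : ℝ) : ℂ) * e (f θ) with hw
    have hw1 : ‖w‖ < 1 := by rw [hw, hn θ r hr']; linarith [hr.1]
    have h1 : Ψ w = ψ w := by
      rw [← hdisc w hw1, hΨe _ (subset_closure (H.maps w hw1)), hdisc w hw1]
    refine ⟨(congrArg (Linked (range f)ᶜ 0) h1).mpr (H.maps w hw1), fun h => ?_⟩
    have h2 : ψ w = 0 := h1.symm.trans h
    have h3 := H.left w hw1
    have h4 := H.left 0 (by simp)
    rw [H.zero, ← h2, h3, h2] at h4
    have := hn θ r hr'
    rw [← hw, h4, norm_zero] at this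
    linarith [hr.2]

end Boundary
end PlaneTop

namespace PlaneTop
open Filter Metric Topology Complex

theorem IsPreconnected.sdiff_of_isOpen {X : Type*} [TopologicalSpace X] {C N D : Set X}
    (hC : IsPreconnected C) (hN : IsOpen N) (hND : IsClosed (N ∪ D)) (hD : IsPreconnected D)
    (hDne : D.Nonempty) (hDC : D ⊆ C) (hdis : Disjoint D N) : IsPreconnected (C \ N) := by
  rw [isPreconnected_closed_iff]
  have key : ∀ u v : Set X, IsClosed u → IsClosed v → C \ N ⊆ u ∪ v → (C \ N ∩ (u ∩ v)) = ∅ →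
      D ⊆ u → C \ N ∩ v = ∅ := by
    intro u v hu hv huv he hDu
    by_contra hne
    rw [← ne_eq, ← nonempty_iff_ne_empty] at hne
    obtain ⟨x, hx, hxv⟩ := hne
    obtain ⟨d, hd⟩ := hDne
    obtain ⟨y, hyC, hyu, hyv⟩ := isPreconnected_closed_iff.1 hC (u ∪ (N ∪ D)) (v \ N)
      (hu.union hND) (hv.sdiff hN)
      (fun y hy => by
        by_cases hyN : y ∈ N
        · exact Or.inl (Or.inr (Or.inl hyN))
        · exact (huv ⟨hy, hyN⟩).imp Or.inl fun h => ⟨h, hyN⟩)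
      ⟨d, hDC hd, Or.inl (hDu hd)⟩ ⟨x, hx.1, hxv, hx.2⟩
    have hyu' : y ∈ u := by
      rcases hyu with h | h | h
      · exact h
      · exact absurd h hyv.2
      · exact hDu h
    exact (eq_empty_iff_forall_notMem.1 he) y ⟨⟨hyC, hyv.2⟩, hyu', hyv.1⟩
  have hDs : D ⊆ C \ N := fun d hd => ⟨hDC hd, disjoint_left.1 hdis hd⟩
  intro u v hu hv huv hnu hnv
  by_contra he
  rw [not_nonempty_iff_eq_empty] at he
  have hDuv : D ⊆ u ∨ D ⊆ v := by
    by_contra! hcon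
    obtain ⟨⟨a, ha, hau⟩, b, hb, hbv⟩ := And.intro (not_subset.1 hcon.1) (not_subset.1 hcon.2)
    obtain ⟨y, hy, hy'⟩ := isPreconnected_closed_iff.1 hD u v hu hv (hDs.trans huv)
      ⟨b, hb, (huv (hDs hb)).resolve_right hbv⟩ ⟨a, ha, (huv (hDs ha)).resolve_left hau⟩
    exact (eq_empty_iff_forall_notMem.1 he) y ⟨hDs hy, hy'⟩
  obtain h | h := hDuv
  · exact hnv.ne_empty (key u v hu hv huv he h)
  · exact hnu.ne_empty (key v u hv hu (union_comm u v ▸ huv) (inter_comm u v ▸ he) h)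

theorem isOpen_far {K : Set ℂ} (hK : IsClosed K) : IsOpen {z | Far K z} := by
  rw [isOpen_iff_mem_nhds]
  intro z hz
  exact mem_of_superset ((isOpen_linked hK z).mem_nhds (Linked.refl hz.notMem))
    fun w hw => hz.of_linked hw

/-- `f` is a Jordan curve around the origin. -/
structure EssLoop (f : Circle1 → ℂ) : Prop where
  emb : IsEmbedding f
  zero_notMem : 0 ∉ range f
  not_far : ¬ Far (range f) 0

/-- The preimage of a loop under the exponential. -/
def line (f : Circle1 → ℂ) : Set ℂ := exp ⁻¹' range f

/-- The upper (`true`) and lower (`false`) side of the preimage of a loop. -/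
def side (f : Circle1 → ℂ) : Bool → Set ℂ
  | true => {z | Far (range f) (exp z)}
  | false => {z | Linked (range f)ᶜ 0 (exp z)}

namespace EssLoop
variable {f : Circle1 → ℂ} (hf : EssLoop f)
include hf

theorem isClosed_line : IsClosed (line f) :=
  (isCompact_range_loop hf.emb).isClosed.preimage continuous_exp

theorem isOpen_side (b : Bool) : IsOpen (side f b) := by
  have := (isCompact_range_loop hf.emb).isClosed
  cases b
  · exact (isOpen_linked this 0).preimage continuous_exp
  · exact (isOpen_far this).preimage continuous_exp

omit hf in
theorem disjoint_line (b : Bool) : Disjoint (line f) (side f b) := by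
  rw [disjoint_left]
  intro z hz hz'
  cases b
  · exact hz'.mem_right hz
  · exact hz'.notMem hz

theorem disjoint_side : Disjoint (side f true) (side f false) :=
  disjoint_left.2 fun _ h h' => hf.not_far (Far.of_linked h (Linked.symm h'))

theorem cover (z : ℂ) : z ∈ side f true ∨ z ∈ line f ∨ z ∈ side f false := by
  by_cases h : Far (range f) (exp z)
  · exact Or.inl h
  by_cases h' : exp z ∈ range f
  · exact Or.inr (Or.inl h')
  · exact Or.inr (Or.inr ((not_far_iff_linked hf.emb hf.zero_notMem hf.not_far).1 ⟨h', h⟩))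

theorem mem_side_not {z : ℂ} {b : Bool} (h : z ∉ line f) (h' : z ∉ side f b) : z ∈ side f (!b) := by
  have := hf.cover z
  cases b <;> simp_all

theorem disjoint_side_not (b : Bool) : Disjoint (side f b) (side f (!b)) := by
  cases b
  · exact hf.disjoint_side.symm
  · exact hf.disjoint_side

theorem compl_side (b : Bool) : (side f b)ᶜ = line f ∪ side f (!b) := by
  ext z
  constructor
  · intro h
    by_cases hz : z ∈ line f
    · exact Or.inl hz
    · exact Or.inr (hf.mem_side_not hz h)
  · rintro (h | h) h'
    · exact disjoint_left.1 (disjoint_line b) h h'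
    · exact disjoint_left.1 (hf.disjoint_side_not b) h' h

theorem exists_lift : ∃ l : ℝ → ℂ, Continuous l ∧ line f = range l ∧
    ∀ t, exp (l t) = f (t : Circle1) := by
  obtain ⟨l, n, hl⟩ := exists_isLift (g := id) hf.emb.continuous continuousOn_id
    fun z hz h => hf.zero_notMem (h ▸ hz)
  have hn : n ≠ 0 := by
    rintro rfl
    exact hf.not_far (far_of_hasLog_sub (isCompact_range_loop hf.emb) hf.zero_notMem
      ((hl.hasLog hf.emb).congr fun z _ => by simp))
  have hn1 := hl.natAbs_eq_one hf.emb hn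
  refine ⟨l, hl.cont, ?_, hl.exp_eq⟩
  ext z
  constructor
  · rintro ⟨θ, hθ⟩
    obtain ⟨t, rfl⟩ := QuotientAddGroup.mk_surjective θ
    have h1 : exp z = exp (l t) := hθ.symm.trans (hl.exp_eq t).symm
    obtain ⟨k, hk⟩ := exp_eq_exp_iff_exists_int.1 h1
    refine ⟨t + ((k * n : ℤ) : ℝ), ?_⟩
    have hnn : (n : ℂ) * n = 1 := by
      rcases Int.natAbs_eq n with h | h <;> rw [hn1] at h <;> subst h <;> norm_num
    rw [hl.add_int, hk]
    push_cast
    linear_combination (k * (2 * Real.pi * I)) * hnn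
  · rintro ⟨t, rfl⟩
    exact ⟨t, (hl.exp_eq t).symm⟩

theorem isPreconnected_line : IsPreconnected (line f) := by
  obtain ⟨l, hl, h, -⟩ := hf.exists_lift
  rw [h]
  exact isPreconnected_range hl

theorem nonempty_line : (line f).Nonempty := by
  obtain ⟨l, hl, h, -⟩ := hf.exists_lift
  rw [h]
  exact range_nonempty l

theorem isPreconnected_line_union_side (b : Bool) : IsPreconnected (line f ∪ side f b) := by
  have h1 := hf.compl_side (!b)
  rw [Bool.not_not] at h1
  rw [← h1, compl_eq_univ_sdiff]
  refine IsPreconnected.sdiff_of_isOpen isPreconnected_univ (hf.isOpen_side _) ?_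
    hf.isPreconnected_line hf.nonempty_line (subset_univ _) (disjoint_line _)
  rw [union_comm, ← hf.compl_side b]
  exact (hf.isOpen_side b).isClosed_compl

omit hf in
theorem exp_add_int (z : ℂ) (k : ℤ) : exp (z + k * (2 * Real.pi * I)) = exp z :=
  exp_eq_exp_iff_exists_int.2 ⟨k, rfl⟩

theorem exists_bound : ∃ R : ℝ, (∀ z ∈ line f, |z.re| ≤ R) ∧ (∀ z : ℂ, R < z.re → z ∈ side f true) ∧
    ∀ z : ℂ, z.re < -R → z ∈ side f false := by
  have hJ := isCompact_range_loop hf.emb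
  obtain ⟨R₁, hR₁⟩ := hJ.isBounded.exists_norm_le
  obtain ⟨r, hr, hr'⟩ := exists_pos_le_norm_sub hJ.isClosed hf.zero_notMem
  simp only [sub_zero] at hr'
  have hR0 : 0 < |R₁| + 1 := by positivity
  have hup : ∀ z : ℂ, max (Real.log (|R₁| + 1)) (-Real.log r) < z.re → z ∈ side f true := by
    intro z hz
    refine far_of_lt_norm hR₁ ?_
    rw [norm_exp]
    have := (Real.log_lt_iff_lt_exp hR0).1 ((le_max_left _ _).trans_lt hz)
    linarith [le_abs_self R₁]
  have hdown : ∀ z : ℂ, z.re < -max (Real.log (|R₁| + 1)) (-Real.log r) → z ∈ side f false := by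
    intro z hz
    have h1 : z.re < Real.log r := by linarith [le_max_right (Real.log (|R₁| + 1)) (-Real.log r)]
    have h2 : ‖exp z‖ < r := by rw [norm_exp]; exact (Real.lt_log_iff_exp_lt hr).1 h1
    refine ⟨ball 0 r, (convex_ball _ _).isPreconnected, fun w hw h => ?_, mem_ball_self hr,
      mem_ball_zero_iff.2 h2⟩
    exact absurd (hr' w h) (not_le.2 (mem_ball_zero_iff.1 hw))
  refine ⟨_, fun z hz => abs_le.2 ⟨?_, ?_⟩, hup, hdown⟩
  · exact not_lt.1 fun h => disjoint_left.1 (disjoint_line _) hz (hdown z h)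
  · exact not_lt.1 fun h => disjoint_left.1 (disjoint_line _) hz (hup z h)

end EssLoop
end PlaneTop

namespace PlaneTop
open Filter Metric Topology Complex
open scoped Pointwise

variable {S : Type*} [TopologicalSpace S] {G : Type*} [Group G] [MulAction G ℂ]

/-- The group `G` acts on the plane by deck transformations of the covering `z ↦ p (exp z)`,
with `t` acting as the translation by `2πi`. -/
structure Sys (p : ℂ → S) (t : G) : Prop where
  cont : Continuous fun z => p (exp z)
  open_map : IsOpenMap fun z => p (exp z)
  loc_inj : ∀ z, ∃ V ∈ 𝓝 z, InjOn (fun z => p (exp z)) V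
  surj : ∀ x, ∃ z, p (exp z) = x
  map_smul : ∀ (g : G) z, p (exp (g • z)) = p (exp z)
  trans : ∀ z w, p (exp z) = p (exp w) → ∃ g : G, g • z = w
  free : ∀ (g : G) (z : ℂ), g • z = z → g = 1
  t_smul : ∀ z : ℂ, t • z = z + 2 * Real.pi * I

/-- An essential loop embedded by the covering `p`. -/
structure Curve (p : ℂ → S) (f : Circle1 → ℂ) : Prop extends EssLoop f where
  inj : InjOn p (range f)

theorem finite_of_isCompact_prod {X Y ι : Type*} [TopologicalSpace X] [TopologicalSpace Y]
    {C : Set X} {D : Set Y} (hC : IsCompact C) (hD : IsCompact D) (P : ι → X → Y → Prop)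
    (h : ∀ x ∈ C, ∀ y ∈ D, ∃ U ∈ 𝓝 x, ∃ V ∈ 𝓝 y, {i | ∃ a ∈ U, ∃ b ∈ V, P i a b}.Finite) :
    {i | ∃ a ∈ C, ∃ b ∈ D, P i a b}.Finite := by
  have := (hC.prod hD).induction_on (p := fun s => {i | ∃ a, ∃ b, (a, b) ∈ s ∧ P i a b}.Finite)
    (by simp) (fun s s' hss' hs' => hs'.subset fun i ⟨a, b, hab, hi⟩ => ⟨a, b, hss' hab, hi⟩)
    (fun s s' hs hs' => (hs.union hs').subset fun i ⟨a, b, hab, hi⟩ =>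
      hab.imp (fun h => ⟨a, b, h, hi⟩) fun h => ⟨a, b, h, hi⟩)
    (fun x hx => by
      obtain ⟨U, hU, V, hV, hUV⟩ := h x.1 hx.1 x.2 hx.2
      exact ⟨U ×ˢ V, mem_nhdsWithin_of_mem_nhds (prod_mem_nhds hU hV),
        hUV.subset fun i ⟨a, b, hab, hi⟩ => ⟨a, hab.1, b, hab.2, hi⟩⟩)
  exact this.subset fun i ⟨a, ha, b, hb, hi⟩ => ⟨a, b, ⟨ha, hb⟩, hi⟩

namespace Sys
variable {p : ℂ → S} {t : G} (hs : Sys p t)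
include hs

theorem zpow_smul (k : ℤ) (z : ℂ) : t ^ k • z = z + k * (2 * Real.pi * I) := by
  induction k using Int.induction_on generalizing z with
  | zero => simp
  | succ k ih =>
    rw [zpow_add_one, mul_smul, ih, hs.t_smul]
    push_cast; ring
  | pred k ih =>
    have h : t⁻¹ • z = z - 2 * Real.pi * I := by
      rw [inv_smul_eq_iff, hs.t_smul]; ring
    rw [zpow_sub_one, mul_smul, ih, h]
    push_cast; ring

theorem exp_zpow_smul (k : ℤ) (z : ℂ) : exp (t ^ k • z) = exp z := by
  rw [hs.zpow_smul, EssLoop.exp_add_int]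

theorem eq_of_smul_eq {g h : G} {z : ℂ} (hz : g • z = h • z) : g = h := by
  have := hs.free (h⁻¹ * g) z (by rw [mul_smul, hz, inv_smul_smul])
  exact (inv_mul_eq_one.1 this).symm

theorem zpow_ne_one {k : ℤ} (hk : k ≠ 0) : t ^ k ≠ 1 := by
  intro h
  have := hs.zpow_smul k 0
  rw [h, one_smul, zero_add] at this
  simp [hk, Real.pi_ne_zero] at this

theorem mem_zpowers_of_exp_eq {g : G} {z : ℂ} (h : exp (g • z) = exp z) :
    g ∈ Subgroup.zpowers t := by
  obtain ⟨k, hk⟩ := exp_eq_exp_iff_exists_int.1 h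
  exact ⟨k, (hs.eq_of_smul_eq (hk.trans (hs.zpow_smul k z).symm)).symm⟩

theorem smul_preimage_exp {g : G} (hg : g ∈ Subgroup.zpowers t) (A : Set ℂ) :
    g • (exp ⁻¹' A) = exp ⁻¹' A := by
  obtain ⟨k, rfl⟩ := hg
  ext z
  rw [mem_smul_set_iff_inv_smul_mem, mem_preimage, mem_preimage]
  change exp ((t ^ k)⁻¹ • z) ∈ A ↔ _
  rw [← zpow_neg, hs.exp_zpow_smul]

theorem smul_line {g : G} (hg : g ∈ Subgroup.zpowers t) (f : Circle1 → ℂ) :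
    g • line f = line f := hs.smul_preimage_exp hg _

theorem smul_side {g : G} (hg : g ∈ Subgroup.zpowers t) (f : Circle1 → ℂ) (b : Bool) :
    g • side f b = side f b := by
  cases b
  · exact hs.smul_preimage_exp hg {z | Linked (range f)ᶜ 0 z}
  · exact hs.smul_preimage_exp hg {z | Far (range f) z}

/-- Every point can be translated by a power of `t` into a horizontal strip. -/
theorem exists_zpow_smul_mem (z : ℂ) : ∃ k : ℤ, (t ^ k • z).re = z.re ∧
    (t ^ k • z).im ∈ Icc 0 (2 * Real.pi) := by
  have hπ : (0:ℝ) < 2 * Real.pi := by positivity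
  have h1 := Int.floor_le (z.im / (2 * Real.pi))
  have h2 := Int.lt_floor_add_one (z.im / (2 * Real.pi))
  rw [le_div_iff₀ hπ] at h1
  rw [div_lt_iff₀ hπ] at h2
  have h3 : ((-⌊z.im / (2 * Real.pi)⌋ : ℤ) * (2 * Real.pi * I) : ℂ).im =
      -⌊z.im / (2 * Real.pi)⌋ * (2 * Real.pi) := by simp
  refine ⟨-⌊z.im / (2 * Real.pi)⌋, ?_, ?_⟩
  · rw [hs.zpow_smul]; simp
  · rw [hs.zpow_smul, add_im, h3]
    constructor <;> linarith

variable [T2Space S] [ContinuousConstSMul G ℂ]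

/-- The action is properly discontinuous. -/
theorem finite_smul {C D : Set ℂ} (hC : IsCompact C) (hD : IsCompact D) :
    {g : G | ∃ z ∈ C, g • z ∈ D}.Finite := by
  have := finite_of_isCompact_prod hC hD (fun (g : G) z w => g • z = w) fun z _ w _ => ?_
  · exact this.subset fun g ⟨z, hz, hw⟩ => ⟨z, hz, _, hw, rfl⟩
  by_cases h : p (exp z) = p (exp w)
  · obtain ⟨k, rfl⟩ := hs.trans z w h
    obtain ⟨V, hV, hVi⟩ := hs.loc_inj (k • z)
    refine ⟨(k • ·) ⁻¹' V, (continuous_const_smul k).continuousAt.preimage_mem_nhds hV, V, hV,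
      (finite_singleton k).subset ?_⟩
    rintro g ⟨a, ha, b, hb, rfl⟩
    refine hs.eq_of_smul_eq (z := a) (hVi hb ha ?_)
    simp only [hs.map_smul]
  · obtain ⟨U, V, hU, hV, hzU, hwV, hUV⟩ := t2_separation h
    refine ⟨_, hs.cont.continuousAt.preimage_mem_nhds (hU.mem_nhds hzU), _,
      hs.cont.continuousAt.preimage_mem_nhds (hV.mem_nhds hwV), finite_empty.subset ?_⟩
    rintro g ⟨a, ha, b, hb, rfl⟩
    rw [mem_preimage, hs.map_smul] at hb
    exact disjoint_left.1 hUV ha hb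

omit [TopologicalSpace S] [Group G] [MulAction G ℂ] [T2Space S] hs [ContinuousConstSMul G ℂ] in
theorem isCompact_strip (R : ℝ) : IsCompact {z : ℂ | |z.re| ≤ R ∧ z.im ∈ Icc 0 (2 * Real.pi)} := by
  have : {z : ℂ | |z.re| ≤ R ∧ z.im ∈ Icc 0 (2 * Real.pi)} = Icc (-R) R ×ℂ Icc 0 (2 * Real.pi) := by
    ext z; simp [mem_reProdIm, abs_le]
  rw [this]
  exact isCompact_Icc.reProdIm isCompact_Icc

/-- Elements conjugating some nontrivial power of `t` to a nontrivial power of `t`. -/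
def _root_.PlaneTop.Comm (t g : G) : Prop := ∃ k i : ℤ, k ≠ 0 ∧ i ≠ 0 ∧ g * t ^ k = t ^ i * g

omit [ContinuousConstSMul G ℂ] [MulAction G ℂ] [T2Space S] hs in
theorem _root_.PlaneTop.Comm.inv {g : G} (h : Comm t g) : Comm t g⁻¹ := by
  obtain ⟨k, i, hk, hi, h⟩ := h
  exact ⟨i, k, hi, hk, by rw [inv_mul_eq_iff_eq_mul, ← mul_assoc, h, mul_inv_cancel_right]⟩

theorem comm_of_forall_exists {g : G} {D : Set ℂ} (hD : IsCompact D) {R : ℝ}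
    (h : ∀ N : ℤ, ∃ z ∈ D, |((g * t ^ N) • z).re| ≤ R) : Comm t g := by
  choose z hz hR using h
  choose j hj hj' using fun N => hs.exists_zpow_smul_mem ((g * t ^ N) • z N)
  have hfin := hs.finite_smul hD (isCompact_strip R)
  have hmem : ∀ N : ℤ, t ^ j N * (g * t ^ N) ∈ {h : G | ∃ z ∈ D, h • z ∈
      {z : ℂ | |z.re| ≤ R ∧ z.im ∈ Icc 0 (2 * Real.pi)}} := fun N =>
    ⟨z N, hz N, by rw [mul_smul]; exact ⟨by rw [hj]; exact hR N, hj' N⟩⟩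
  obtain ⟨M, -, N, -, hMN, he⟩ := infinite_univ.exists_ne_map_eq_of_mapsTo
    (f := fun N : ℤ => t ^ j N * (g * t ^ N)) (fun N _ => hmem N) hfin
  have h1 : g * t ^ (M - N) = t ^ (j N - j M) * g := by
    have h2 : t ^ j M * (g * t ^ M) * t ^ (-N) = t ^ j N * (g * t ^ N) * t ^ (-N) :=
      congrArg (· * t ^ (-N)) he
    have h3 : g * t ^ (M - N) = (t ^ j M)⁻¹ * (t ^ j M * (g * t ^ M) * t ^ (-N)) := by
      rw [sub_eq_add_neg, zpow_add]; group
    rw [h3, h2, sub_eq_neg_add, zpow_add]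
    group
  refine ⟨M - N, j N - j M, sub_ne_zero.2 hMN, fun h0 => ?_, h1⟩
  rw [h0, zpow_zero, one_mul, mul_eq_left] at h1
  exact hs.zpow_ne_one (sub_ne_zero.2 hMN) h1

omit [T2Space S] in
/-- A `Comm` element maps `t`-invariant sets of bounded real part to sets of bounded real part. -/
theorem _root_.PlaneTop.Comm.exists_bound {g : G} (hg : Comm t g) (A : Set ℂ) {R : ℝ}
    (hR : ∀ z ∈ A, |z.re| ≤ R) : ∃ R', ∀ z ∈ g • A, |z.re| ≤ R' := by
  obtain ⟨k, i, hk, hi, h⟩ := hg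
  have hkpos : (0 : ℝ) < |(k : ℝ)| * (2 * Real.pi) := by positivity
  have hcpt : IsCompact (Icc (-R) R ×ℂ Icc 0 (|(k : ℝ)| * (2 * Real.pi))) :=
    isCompact_Icc.reProdIm isCompact_Icc
  obtain ⟨R', hR'⟩ := (hcpt.image (continuous_const_smul g)).isBounded.exists_norm_le
  refine ⟨R', ?_⟩
  rintro _ ⟨z, hz, rfl⟩
  have key : ∀ n : ℤ, ((g * t ^ (k * n)) • z).re = (g • z).re := by
    intro n
    have h3 : (g * t ^ k * g⁻¹) ^ n = (t ^ i) ^ n := by rw [h, mul_inv_cancel_right]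
    rw [conj_zpow, ← zpow_mul, ← zpow_mul] at h3
    have h4 : g * t ^ (k * n) = t ^ (i * n) * g := by rw [← h3, inv_mul_cancel_right]
    rw [h4, mul_smul, hs.zpow_smul]
    simp
  have hex : ∃ n : ℤ, (t ^ (k * n) • z).im ∈ Icc 0 (|(k : ℝ)| * (2 * Real.pi)) := by
    have h1 := Int.floor_le (z.im / (|(k : ℝ)| * (2 * Real.pi)))
    have h2 := Int.lt_floor_add_one (z.im / (|(k : ℝ)| * (2 * Real.pi)))
    rw [le_div_iff₀ hkpos] at h1
    rw [div_lt_iff₀ hkpos] at h2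
    set m := ⌊z.im / (|(k : ℝ)| * (2 * Real.pi))⌋ with hm
    obtain ⟨s, hs'⟩ : ∃ s : ℤ, (k : ℝ) * s = |(k : ℝ)| := by
      rcases abs_choice (k : ℝ) with h | h <;> rw [h]
      · exact ⟨1, by simp⟩
      · exact ⟨-1, by simp⟩
    refine ⟨-(s * m), ?_⟩
    have h3 : (t ^ (k * -(s * m)) • z).im = z.im - m * (|(k : ℝ)| * (2 * Real.pi)) := by
      rw [hs.zpow_smul, ← hs']
      simp
      ring
    rw [h3]
    constructor <;> linarith
  obtain ⟨n, hn⟩ := hex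
  have hre : (t ^ (k * n) • z).re = z.re := by rw [hs.zpow_smul]; simp
  have := hR' (g • t ^ (k * n) • z) ⟨_, ⟨by rw [mem_preimage, hre]; exact abs_le.1 (hR z hz), hn⟩, rfl⟩
  rw [← key n]
  refine (abs_re_le_norm _).trans ?_
  rwa [mul_smul]

end Sys
end PlaneTop

namespace PlaneTop
open Filter Metric Topology Complex
open scoped Pointwise

variable {S : Type*} [TopologicalSpace S] {G : Type*} [Group G] [MulAction G ℂ]
  {p : ℂ → S} {t : G} {f : Circle1 → ℂ}

namespace Sys

theorem mem_zpowers_of_mem_line (hs : Sys p t) (hf : Curve p f) {g : G} {z : ℂ} (hz : z ∈ line f)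
    (hgz : g • z ∈ line f) : g ∈ Subgroup.zpowers t :=
  hs.mem_zpowers_of_exp_eq (hf.inj hgz hz (hs.map_smul g z))

theorem disjoint_smul_line (hs : Sys p t) (hf : Curve p f) {g : G} (hg : g ∉ Subgroup.zpowers t) :
    Disjoint (g • line f) (line f) := by
  rw [disjoint_left]
  rintro _ ⟨z, hz, rfl⟩ h
  exact hg (hs.mem_zpowers_of_mem_line hf hz h)

theorem inv_mul_mem_of_mem (hs : Sys p t) (hf : Curve p f) {g h : G} {z : ℂ}
    (hg : z ∈ g • line f) (hh : z ∈ h • line f) : g⁻¹ * h ∈ Subgroup.zpowers t := by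
  rw [mem_smul_set_iff_inv_smul_mem] at hg hh
  refine hs.mem_zpowers_of_mem_line hf hh ?_
  rwa [mul_smul, smul_inv_smul]

theorem smul_line_congr (hs : Sys p t) {g h : G} (hgh : g⁻¹ * h ∈ Subgroup.zpowers t) :
    h • line f = g • line f := by
  rw [show h = g * (g⁻¹ * h) by group, mul_smul, hs.smul_line hgh]

theorem smul_side_congr (hs : Sys p t) {g h : G} (hgh : g⁻¹ * h ∈ Subgroup.zpowers t) (b : Bool) :
    h • side f b = g • side f b := by
  rw [show h = g * (g⁻¹ * h) by group, mul_smul, hs.smul_side hgh]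

theorem mem_preimage_iff (hs : Sys p t) (hf : Curve p f) {z : ℂ} :
    p (exp z) ∈ p '' range f ↔ ∃ g : G, z ∈ g • line f := by
  constructor
  · rintro ⟨w, hw, hwz⟩
    have hw0 : w ≠ 0 := by
      rintro rfl
      exact hf.zero_notMem hw
    rw [← exp_log hw0] at hwz hw
    obtain ⟨g, rfl⟩ := hs.trans _ z hwz
    exact ⟨g, smul_mem_smul_set hw⟩
  · rintro ⟨g, y, hy, rfl⟩
    change p (exp (g • y)) ∈ _
    rw [hs.map_smul]
    exact mem_image_of_mem p hy

theorem line_ne (hs : Sys p t) (hf : Curve p f) {g h : G} (hgh : g⁻¹ * h ∉ Subgroup.zpowers t) :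
    Disjoint (g • line f) (h • line f) :=
  disjoint_left.2 fun _ hg hh => hgh (hs.inv_mul_mem_of_mem hf hg hh)

end Sys

namespace EssLoop
variable [ContinuousConstSMul G ℂ] (hf : EssLoop f)
include hf

theorem isPreconnected_smul_line (g : G) : IsPreconnected (g • line f) :=
  hf.isPreconnected_line.image _ (continuous_const_smul g).continuousOn

theorem isOpen_smul_side (g : G) (b : Bool) : IsOpen (g • side f b) :=
  (hf.isOpen_side b).smul g

omit [ContinuousConstSMul G ℂ] in
theorem compl_smul_side (g : G) (b : Bool) : (g • side f b)ᶜ = g • line f ∪ g • side f (!b) := by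
  rw [← smul_set_compl, hf.compl_side, smul_set_union]

omit [ContinuousConstSMul G ℂ] in
theorem disjoint_smul_side_not (g : G) (b : Bool) : Disjoint (g • side f b) (g • side f (!b)) :=
  disjoint_smul_set.2 (hf.disjoint_side_not b)

theorem subset_smul_side {X : Set ℂ} (hX : IsPreconnected X) {g : G} (hd : Disjoint X (g • line f))
    {x : ℂ} (hx : x ∈ X) {b : Bool} (hxb : x ∈ g • side f b) : X ⊆ g • side f b := by
  refine hX.subset_left_of_subset_union (hf.isOpen_smul_side g b) (hf.isOpen_smul_side g (!b))
    (hf.disjoint_smul_side_not g b) (fun z hz => ?_) ⟨x, hx, hxb⟩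
  by_contra h
  rw [mem_union, not_or, ← mem_compl_iff, hf.compl_smul_side] at h
  exact h.1.elim (disjoint_left.1 hd hz) h.2

theorem exists_subset_smul_side {X : Set ℂ} (hX : IsPreconnected X) (hne : X.Nonempty) {g : G}
    (hd : Disjoint X (g • line f)) : ∃ b, X ⊆ g • side f b := by
  obtain ⟨x, hx⟩ := hne
  by_cases h : x ∈ g • side f true
  · exact ⟨true, hf.subset_smul_side hX hd hx h⟩
  · rw [← mem_compl_iff, hf.compl_smul_side] at h
    exact ⟨false, hf.subset_smul_side hX hd hx (h.resolve_left (disjoint_left.1 hd hx))⟩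

theorem nested {g h : G} {b c : Bool} (h₁ : g • line f ⊆ h • side f b)
    (h₂ : h • line f ⊆ g • side f c) : h • (line f ∪ side f (!b)) ⊆ g • side f c := by
  obtain ⟨y, hy⟩ := hf.nonempty_line
  refine hf.subset_smul_side ((hf.isPreconnected_line_union_side (!b)).image _
    (continuous_const_smul h).continuousOn) ?_ (smul_mem_smul_set (Or.inl hy))
    (h₂ (smul_mem_smul_set hy))
  rw [← hf.compl_side]
  change Disjoint (h • (side f b)ᶜ) _
  rw [smul_set_compl]
  exact disjoint_left.2 fun z hz hz' => hz (h₁ hz')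

omit hf [ContinuousConstSMul G ℂ] in
theorem disjoint_of_subset_smul_side {X : Set ℂ} {g : G} {b : Bool} (h : X ⊆ g • side f b) :
    Disjoint X (g • line f) :=
  disjoint_left.2 fun _ hz hz' => disjoint_left.1
    (disjoint_smul_set.2 (disjoint_line b)) hz' (h hz)

end EssLoop

namespace Sys
variable [T2Space S] [ContinuousConstSMul G ℂ]

/-- Only finitely many translates of a loop meet a compact set. -/
theorem finite_smul_of_inter (hs : Sys p t) (hf : EssLoop f) {D : Set ℂ} (hD : IsCompact D)
    {X : Set ℂ} (hX : ∀ g ∈ Subgroup.zpowers t, g • X = X) :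
    {A : Set ℂ | ∃ g : G, A = g • X ∧ (g • line f ∩ D).Nonempty}.Finite := by
  obtain ⟨R, hR, -⟩ := hf.exists_bound
  refine ((hs.finite_smul (isCompact_strip R) hD).image fun g => g • X).subset ?_
  rintro _ ⟨g, rfl, _, ⟨z, hz, rfl⟩, hzD⟩
  obtain ⟨k, hk, hk'⟩ := hs.exists_zpow_smul_mem z
  refine ⟨g * (t ^ k)⁻¹, ⟨t ^ k • z, ⟨by rw [hk]; exact hR z hz, hk'⟩, ?_⟩, ?_⟩
  · rwa [mul_smul, inv_smul_smul]
  · change (g * (t ^ k)⁻¹) • X = g • X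
    rw [mul_smul, hX _ ⟨-k, by group⟩]

omit [T2Space S] in
/-- The far side of a line at bounded distance from the horizontal contains a half plane. -/
theorem exists_halfPlane (hs : Sys p t) (hf : EssLoop f) {g : G} (hg : Comm t g)
    (h₁ : g • line f ⊆ side f true) {c : Bool} (h₂ : line f ⊆ g • side f c) :
    ∃ R', ∀ z : ℂ, R' < z.re → z ∈ g • side f (!c) := by
  obtain ⟨R, hR, hRt, hRf⟩ := hf.exists_bound
  obtain ⟨R', hR'⟩ := hg.exists_bound hs _ hR
  have hH : {z : ℂ | max R R' < z.re} ⊆ side f true := fun z hz => hRt z ((le_max_left _ _).trans_lt hz)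
  have hpre : IsPreconnected {z : ℂ | max R R' < z.re} := (convex_halfSpace_re_gt _).isPreconnected
  obtain ⟨d, hd⟩ := hf.exists_subset_smul_side hpre ⟨(max R R' + 1 : ℝ), by simp [-ofReal_add, -sup_lt_iff]⟩ (g := g)
    (disjoint_left.2 fun z hz hz' => by
      have := (le_abs_self _).trans (hR' z hz')
      exact absurd (lt_of_le_of_lt (le_max_right R R') hz) this.not_gt)
  refine ⟨max R R', fun z hz => ?_⟩
  by_cases hcd : d = !c
  · rw [← hcd]; exact hd hz
  obtain rfl : d = c := by revert hcd; cases c <;> cases d <;> simp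
  exfalso
  have hn : (1:G) • (line f ∪ side f (!true)) ⊆ g • side f d :=
    hf.nested (by rwa [one_smul]) (by rwa [one_smul])
  rw [one_smul] at hn
  have hb : ∀ z ∈ line f ∪ side f (!d), |(g • z).re| ≤ max R R' := by
    intro z hz
    rcases hz with hz | hz
    · exact (hR' _ (smul_mem_smul_set hz)).trans (le_max_right _ _)
    have hz2 : g • z ∉ g • side f d := fun h =>
      disjoint_left.1 (hf.disjoint_smul_side_not g d) h (smul_mem_smul_set hz)
    refine abs_le.2 ⟨?_, ?_⟩
    · by_contra h
      push Not at h
      refine hz2 (hn (Or.inr (hRf _ ?_)))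
      have := le_max_left R R'
      linarith
    · by_contra h
      push Not at h
      exact hz2 (hd h)
  obtain ⟨R'', hR''⟩ := hg.inv.exists_bound hs (g • (line f ∪ side f (!d))) (R := max R R') (by
    rintro _ ⟨z, hz, rfl⟩; exact hb z hz)
  rw [inv_smul_smul] at hR''
  cases d
  · have h1 := hR'' (max R R'' + 1 : ℝ) (Or.inr (hRt _ (by
      rw [ofReal_re]; linarith [le_max_left R R''])))
    rw [ofReal_re] at h1
    linarith [le_abs_self (max R R'' + 1), le_max_right R R'']
  · have h1 := hR'' (-(max R R'' + 1) : ℝ) (Or.inr (hRf _ (by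
      rw [ofReal_re]; linarith [le_max_left R R''])))
    rw [ofReal_re] at h1
    linarith [neg_le_abs (-(max R R'' + 1)), le_max_right R R'']

end Sys
end PlaneTop

namespace PlaneTop
open Filter Metric Topology Complex
open scoped Pointwise

variable {S : Type*} [TopologicalSpace S] {G : Type*} [Group G] [MulAction G ℂ]
  {p : ℂ → S} {t : G} {f : Circle1 → ℂ}

theorem map_exp_nhds (z : ℂ) : map exp (𝓝 z) = 𝓝 (exp z) :=
  isOpenMap_exp.map_nhds_eq continuous_exp.continuousAt

namespace Sys

theorem map_nhds (hs : Sys p t) {w : ℂ} (hw : w ≠ 0) : map p (𝓝 w) = 𝓝 (p w) := by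
  rw [← exp_log hw, ← map_exp_nhds, map_map]
  exact hs.open_map.map_nhds_eq hs.cont.continuousAt

theorem continuousOn (hs : Sys p t) : ContinuousOn p {0}ᶜ := fun _ hw =>
  ContinuousAt.continuousWithinAt (hs.map_nhds hw).le

theorem continuousOn_range (hs : Sys p t) (hf : EssLoop f) : ContinuousOn p (range f) :=
  hs.continuousOn.mono fun _ hw h => hf.zero_notMem (h ▸ hw)

theorem isCompact_curve (hs : Sys p t) (hf : EssLoop f) : IsCompact (p '' range f) :=
  (isCompact_range_loop hf.emb).image_of_continuousOn (hs.continuousOn_range hf)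

variable [T2Space S] [ContinuousConstSMul G ℂ]

theorem eventually_notMem (hs : Sys p t) (hf : Curve p f) {z : ℂ} (hz : z ∈ line f) :
    ∀ᶠ w in 𝓝 z, w ∉ line f → p (exp w) ∉ p '' range f := by
  have hfin := (hs.finite_smul_of_inter hf.toEssLoop (isCompact_closedBall z 1)
      fun g hg => hs.smul_line hg f).subset
    (show {A : Set ℂ | (∃ g : G, A = g • line f ∧ (g • line f ∩ closedBall z 1).Nonempty) ∧ A ≠ line f} ⊆ _
      from fun A hA => hA.1)
  have hcl : IsClosed (⋃₀ {A : Set ℂ | (∃ g : G, A = g • line f ∧ (g • line f ∩ closedBall z 1).Nonempty) ∧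
      A ≠ line f}) := by
    rw [sUnion_eq_biUnion]
    refine hfin.isClosed_biUnion ?_
    rintro _ ⟨⟨g, rfl, -⟩, -⟩
    exact hf.isClosed_line.smul g
  have hz' : z ∉ ⋃₀ {A : Set ℂ | (∃ g : G, A = g • line f ∧ (g • line f ∩ closedBall z 1).Nonempty) ∧
      A ≠ line f} := by
    rintro ⟨_, ⟨⟨g, rfl, -⟩, hg⟩, hzg⟩
    refine hg (hs.smul_line ?_ f)
    by_contra h
    exact disjoint_left.1 (hs.disjoint_smul_line hf h) hzg hz
  filter_upwards [hcl.isOpen_compl.mem_nhds hz', closedBall_mem_nhds z one_pos] with w hw hwb hwl hwp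
  obtain ⟨g, hg⟩ := (hs.mem_preimage_iff hf).1 hwp
  exact hw ⟨g • line f, ⟨⟨g, rfl, w, hg, hwb⟩, fun h => hwl (h ▸ hg)⟩, hg⟩

theorem exists_pos_notMem (hs : Sys p t) (hf : Curve p f) : ∃ ε > 0, ∀ y, infDist y (range f) < ε →
    y ≠ 0 ∧ (y ∉ range f → p y ∉ p '' range f) := by
  obtain ⟨ε, hε, h⟩ := (isCompact_range_loop hf.emb).exists_thickening_subset_open
    (t := interior {y | y ≠ 0 ∧ (y ∉ range f → p y ∉ p '' range f)}) isOpen_interior fun y hy => by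
      have hy0 : y ≠ 0 := fun h => hf.zero_notMem (h ▸ hy)
      rw [mem_interior_iff_mem_nhds]
      refine inter_mem (isOpen_ne.mem_nhds hy0) ?_
      have hl : log y ∈ line f := by rwa [line, mem_preimage, exp_log hy0]
      rw [← exp_log hy0, ← map_exp_nhds]
      exact hs.eventually_notMem hf hl
  refine ⟨ε, hε, fun y hy => ?_⟩
  have hy' := interior_subset (h (a := y) ?_)
  · exact hy'
  rwa [mem_thickening_iff_infDist_lt (range_nonempty f)]

/-- A coloring of the complement of a curve which differs on both sides of the curve. -/
structure _root_.PlaneTop.Coloring (p : ℂ → S) (f : Circle1 → ℂ) (c : Bool → Set S) : Prop where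
  isOpen : ∀ b, IsOpen (c b)
  disj : ∀ b, Disjoint (c b) (c (!b))
  union : ∀ b, c b ∪ c (!b) = (p '' range f)ᶜ
  near : ∀ z ∈ line f, ∀ᶠ w in 𝓝 z, ∀ b, w ∈ side f b → p (exp w) ∈ c b

/-- If the curve separates the surface, then the two sides of it have different colours. -/
theorem exists_coloring [ConnectedSpace S] (hs : Sys p t) (hf : Curve p f)
    (hsep : ¬ IsPreconnected (p '' range f)ᶜ) : ∃ c : Bool → Set S, Coloring p f c := by
  have hJ := isCompact_range_loop hf.emb
  have hγ := (hs.isCompact_curve hf.toEssLoop).isClosed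
  obtain ⟨X, hXo, hXd, hXu, hXn⟩ : ∃ X : Bool → Set S, (∀ b, IsOpen (X b)) ∧
      (∀ b, Disjoint (X b) (X (!b))) ∧
      (∀ b, X b ∪ X (!b) = (p '' range f)ᶜ) ∧ ∀ b, (X b).Nonempty := by
    rw [IsPreconnected] at hsep
    push Not at hsep
    obtain ⟨U, V, hU, hV, hUV, hnU, hnV, hd⟩ := hsep
    have hd' : Disjoint ((p '' range f)ᶜ ∩ U) ((p '' range f)ᶜ ∩ V) := by
      rw [disjoint_iff_inter_eq_empty, ← hd]
      ext; simp only [mem_inter_iff]; tauto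
    have hu : (p '' range f)ᶜ ∩ U ∪ (p '' range f)ᶜ ∩ V = (p '' range f)ᶜ := by
      rw [← inter_union_distrib_left, inter_eq_left.2 hUV]
    refine ⟨fun b => if b then (p '' range f)ᶜ ∩ U else (p '' range f)ᶜ ∩ V, ?_, ?_, ?_, ?_⟩
    · rintro (_ | _)
      · exact hγ.isOpen_compl.inter hV
      · exact hγ.isOpen_compl.inter hU
    · rintro (_ | _)
      · exact hd'.symm
      · exact hd'
    · rintro (_ | _)
      · exact (union_comm _ _).trans hu
      · exact hu
    · rintro (_ | _)
      · exact hnV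
      · exact hnU
  obtain ⟨ε, hε, hεp⟩ := hs.exists_pos_notMem hf
  set N := {y | y ∉ range f ∧ infDist y (range f) < ε} with hN
  have hNp : p '' N ⊆ (p '' range f)ᶜ := by
    rintro _ ⟨y, hy, rfl⟩
    exact (hεp y hy.2).2 hy.1
  have hcol : ∀ {a b}, a ∈ N → b ∈ N → Linked (range f)ᶜ a b → ∀ k, p a ∈ X k → p b ∈ X k := by
    intro a b ha hb hab k hk
    have h1 := (hab.near hJ (isPreconnected_range_loop hf.emb) (range_nonempty f) ha.2 hb.2).image
      (f := p) (hs.continuousOn.mono fun y hy => (hεp y hy.2).1)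
    refine (h1.mono (hNp.trans (hXu k).symm.subset)).mem_of_isOpen (hXo _) (hXo _) (hXd _) hk
  have hside : ∀ b, ∃ k, ∀ w, w ∈ side f b → exp w ∈ N → p (exp w) ∈ X k := by
    intro b
    by_cases hne : ∃ w, w ∈ side f b ∧ exp w ∈ N
    · obtain ⟨w, hw, hwN⟩ := hne
      have : p (exp w) ∈ X true ∪ X (!true) := by rw [hXu]; exact hNp ⟨_, hwN, rfl⟩
      have hl : ∀ w', w' ∈ side f b → Linked (range f)ᶜ (exp w) (exp w') := by
        intro w' hw'
        cases b
        · exact Linked.trans (Linked.symm hw) hw'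
        · exact Far.linked hJ hw hw'
      rcases this with h | h
      · exact ⟨_, fun w' hw' hwN' => hcol hwN hwN' (hl w' hw') _ h⟩
      · exact ⟨_, fun w' hw' hwN' => hcol hwN hwN' (hl w' hw') _ h⟩
    · exact ⟨true, fun w hw hwN => absurd ⟨w, hw, hwN⟩ hne⟩
  choose k hk using hside
  have hev : ∀ z ∈ line f, ∀ᶠ w in 𝓝 z, ∀ b, w ∈ side f b → p (exp w) ∈ X (k b) := by
    intro z hz
    have h1 : ∀ᶠ w in 𝓝 z, infDist (exp w) (range f) < ε := by
      have hc : Continuous fun w => infDist (exp w) (range f) :=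
        (continuous_infDist_pt _).comp continuous_exp
      refine (isOpen_lt hc continuous_const).mem_nhds ?_
      change infDist (exp z) (range f) < ε
      rwa [infDist_zero_of_mem (mem_preimage.1 hz)]
    filter_upwards [h1] with w hw b hwb
    exact hk b w hwb ⟨fun h => disjoint_left.1 (EssLoop.disjoint_line b) h hwb, hw⟩
  by_cases hkk : k true = k false
  · exfalso
    have hopen : IsOpen (p '' range f ∪ X (k true)) := by
      rw [isOpen_iff_mem_nhds]
      rintro x (⟨y, hy, rfl⟩ | hx)
      · have hy0 : y ≠ 0 := fun h => hf.zero_notMem (h ▸ hy)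
        have hl : log y ∈ line f := by rwa [line, mem_preimage, exp_log hy0]
        rw [← exp_log hy0, ← hs.open_map.map_nhds_eq hs.cont.continuousAt]
        rw [mem_map]
        filter_upwards [hev _ hl] with w hw
        rcases hf.cover w with h | h | h
        · exact Or.inr (hw _ h)
        · exact Or.inl ⟨_, h, rfl⟩
        · exact Or.inr (hkk ▸ hw _ h)
      · exact mem_of_superset ((hXo _).mem_nhds hx) subset_union_right
    obtain ⟨x, -, hx, hx'⟩ := isPreconnected_univ (α := S) _ _ hopen (hXo (!k true))
      (fun x _ => by
        by_cases h : x ∈ p '' range f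
        · exact Or.inl (Or.inl h)
        · rw [← mem_compl_iff, ← hXu (k true)] at h
          exact h.imp Or.inr id)
      ((hXn (k true)).mono fun x hx => ⟨trivial, Or.inr hx⟩)
      ((hXn (!k true)).mono fun x hx => ⟨trivial, hx⟩)
    rcases hx with hx | hx
    · have : x ∈ (p '' range f)ᶜ := by rw [← hXu (k true)]; exact Or.inr hx'
      exact this hx
    · exact disjoint_left.1 (hXd _) hx hx'
  · have hkn : k false = !k true := by revert hkk; cases k true <;> cases k false <;> simp
    have hkn' : ∀ b, k (!b) = !k b := by
      rintro (_ | _)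
      · simp [hkn]
      · exact hkn
    exact ⟨fun b => X (k b), fun b => hXo _, fun b => by simp only [hkn']; exact hXd _,
      fun b => by simp only [hkn']; exact hXu _, hev⟩

end Sys
end PlaneTop

namespace PlaneTop
open Filter Metric Topology Complex
open scoped Pointwise

variable {S : Type*} [TopologicalSpace S] {G : Type*} [Group G] [MulAction G ℂ]
  {p : ℂ → S} {t : G} {f : Circle1 → ℂ}

namespace Sys
variable [T2Space S] [ContinuousConstSMul G ℂ]

omit [T2Space S] in
theorem eventually_mem_smul_iff (hf : EssLoop f) {g : G} {z : ℂ} (hz : z ∉ g • line f) (b : Bool) :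
    ∀ᶠ w in 𝓝 z, (w ∈ g • (line f ∪ side f b) ↔ z ∈ g • (line f ∪ side f b)) := by
  have hc : (g • (line f ∪ side f b))ᶜ = g • side f (!b) := by
    rw [← compl_compl (g • side f (!b)), hf.compl_smul_side, Bool.not_not, smul_set_union]
  by_cases h : z ∈ g • (line f ∪ side f b)
  · have h' := h
    rw [smul_set_union] at h'
    filter_upwards [(hf.isOpen_smul_side g b).mem_nhds (h'.resolve_left hz)] with w hw
    rw [smul_set_union]
    exact ⟨fun _ => Or.inr (h'.resolve_left hz), fun _ => Or.inr hw⟩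
  · rw [← mem_compl_iff, hc] at h
    filter_upwards [(hf.isOpen_smul_side g (!b)).mem_nhds h] with w hw
    rw [← hc] at hw h
    exact ⟨fun h' => absurd h' hw, fun hw' => absurd hw' h⟩

/-- If the translate `g • L` of the line `L` lies on the side `b` of `L`, and `L` lies on the
opposite side of `g • L`, then there is an intermediate translate with the other orientation. -/
theorem exists_between (hs : Sys p t) (hf : Curve p f) {c : Bool → Set S} (hc : Coloring p f c)
    {b : Bool} {g : G} (h₁ : g • line f ⊆ side f b) (h₂ : line f ⊆ g • side f (!b)) :
    ∃ h : G, line f ⊆ h • side f b ∧ h • line f ⊆ side f b ∧ g • line f ⊆ h • side f (!b) := by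
  obtain ⟨y₀, hy₀⟩ := hf.nonempty_line
  obtain ⟨y₁, hy₁⟩ : (g • line f).Nonempty := hf.nonempty_line.smul_set
  have hD : IsCompact (segment ℝ y₀ y₁) := by
    rw [segment_eq_image_lineMap]
    exact isCompact_Icc.image AffineMap.lineMap_continuous
  have hfin := hs.finite_smul_of_inter hf.toEssLoop hD (X := line f ∪ side f b) fun g hg => by
    rw [smul_set_union, hs.smul_line hg, hs.smul_side hg]
  set As := hfin.toFinset with hAs
  have hmem : ∀ A, A ∈ As ↔ ∃ g : G, A = g • (line f ∪ side f b) ∧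
    (g • line f ∩ segment ℝ y₀ y₁).Nonempty := fun A => hfin.mem_toFinset
  set ind : ℂ → ℤ := fun y => if p (exp y) ∈ c (!b) then 0 else 1 with hind
  set F : ℂ → ℤ := fun y => ind y - ∑ A ∈ As, if y ∈ A then 1 else 0 with hF
  have hcompl : ∀ (h : G) z, z ∈ h • side f (!b) → z ∉ h • (line f ∪ side f b) := by
    intro h z hz
    rw [smul_set_union]
    rintro (hz' | hz')
    · exact disjoint_left.1 (disjoint_smul_set.2 (EssLoop.disjoint_line (!b))) hz' hz
    · exact disjoint_left.1 (hf.disjoint_smul_side_not h b) hz' hz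
  have hloc : ∀ y ∈ segment ℝ y₀ y₁, ∀ᶠ w in 𝓝 y, F w = F y := by
    intro y hy
    by_cases hyl : ∃ h : G, y ∈ h • line f
    · obtain ⟨h, hyh⟩ := hyl
      have hA₀ : h • (line f ∪ side f b) ∈ As := (hmem _).2 ⟨h, rfl, y, hyh, hy⟩
      have hev1 : ∀ᶠ w in 𝓝 y, ∀ A ∈ As, A ≠ h • (line f ∪ side f b) → (w ∈ A ↔ y ∈ A) := by
        rw [Finset.eventually_all]
        intro A hA
        by_cases hAe : A = h • (line f ∪ side f b)
        · exact Eventually.of_forall fun w hw => absurd hAe hw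
        obtain ⟨k, rfl, -⟩ := (hmem A).1 hA
        have : y ∉ k • line f := fun hyk => hAe (by
          have := hs.inv_mul_mem_of_mem hf hyh hyk
          rw [smul_set_union, smul_set_union, hs.smul_line_congr this, hs.smul_side_congr this])
        filter_upwards [eventually_mem_smul_iff hf.toEssLoop this b] with w hw _ using hw
      have hev2 : ∀ᶠ w in 𝓝 y, ind w = if w ∈ h • (line f ∪ side f b) then 1 else 0 := by
        have h3 := hc.near (h⁻¹ • y) (mem_smul_set_iff_inv_smul_mem.1 hyh)
        filter_upwards [(continuous_const_smul h⁻¹).continuousAt.eventually h3] with w hw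
        rw [hs.map_smul] at hw
        rw [hind]
        by_cases hwb : w ∈ h • side f (!b)
        · rw [if_neg (hcompl h w hwb)]
          exact if_pos (hw _ (mem_smul_set_iff_inv_smul_mem.1 hwb))
        · have hw2 := hwb
          rw [← mem_compl_iff, hf.compl_smul_side, Bool.not_not, ← smul_set_union] at hw2
          rw [if_pos hw2]
          refine if_neg fun hwc => ?_
          rw [smul_set_union] at hw2
          rcases hw2 with hw2 | hw2
          · have h4 : p (exp w) ∈ p '' range f := (hs.mem_preimage_iff hf).2 ⟨h, hw2⟩
            have h5 : p (exp w) ∈ (p '' range f)ᶜ := by rw [← hc.union b]; exact Or.inr hwc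
            exact h5 h4
          · exact disjoint_left.1 (hc.disj b) (hw _ (mem_smul_set_iff_inv_smul_mem.1 hw2)) hwc
      filter_upwards [hev1, hev2] with w hw1 hw2
      have hy2 := hev2.self_of_nhds
      have : F w - F y = 0 := by
        have hsum : ∑ A ∈ As, ((if w ∈ A then 1 else 0 : ℤ) - if y ∈ A then 1 else 0) =
            ind w - ind y := by
          rw [Finset.sum_eq_single_of_mem _ hA₀, hw2, hy2]
          intro A hA hAe
          simp only [hw1 A hA hAe, sub_self]
        rw [Finset.sum_sub_distrib] at hsum
        simp only [hF]
        linarith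
      linarith
    · have hev1 : ∀ᶠ w in 𝓝 y, ∀ A ∈ As, (w ∈ A ↔ y ∈ A) := by
        rw [Finset.eventually_all]
        intro A hA
        obtain ⟨k, rfl, -⟩ := (hmem A).1 hA
        exact eventually_mem_smul_iff hf.toEssLoop (fun h => hyl ⟨k, h⟩) b
      have hev2 : ∀ᶠ w in 𝓝 y, ind w = ind y := by
        have h1 : p (exp y) ∈ (p '' range f)ᶜ := fun h => hyl ((hs.mem_preimage_iff hf).1 h)
        rw [← hc.union b] at h1
        rcases h1 with h1 | h1
        · filter_upwards [hs.cont.continuousAt.preimage_mem_nhds ((hc.isOpen _).mem_nhds h1)] with w hw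
          simp only [hind]
          rw [if_neg (disjoint_left.1 (hc.disj b) hw), if_neg (disjoint_left.1 (hc.disj b) h1)]
        · filter_upwards [hs.cont.continuousAt.preimage_mem_nhds ((hc.isOpen _).mem_nhds h1)] with w hw
          simp only [hind]
          rw [if_pos (mem_preimage.1 hw), if_pos h1]
      filter_upwards [hev1, hev2] with w hw1 hw2
      simp only [hF, hw2]
      congr 1
      refine Finset.sum_congr rfl fun A hA => ?_
      simp only [hw1 A hA]
  have hcont : ContinuousOn F (segment ℝ y₀ y₁) := fun y hy =>
    (tendsto_pure.2 (hloc y hy)).mono_right (pure_le_nhds _) |>.mono_left nhdsWithin_le_nhds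
  have hFe := (convex_segment y₀ y₁).isPreconnected.constant hcont (left_mem_segment ℝ y₀ y₁)
    (right_mem_segment ℝ y₀ y₁)
  have hind1 : ∀ (h : G) y, y ∈ h • line f → ind y = 1 := by
    intro h y hy
    have h4 : p (exp y) ∈ p '' range f := (hs.mem_preimage_iff hf).2 ⟨h, hy⟩
    refine if_neg fun hyc => ?_
    have h5 : p (exp y) ∈ (p '' range f)ᶜ := by rw [← hc.union b]; exact Or.inr hyc
    exact h5 h4
  simp only [hF, hind1 1 y₀ (by rwa [one_smul]), hind1 g y₁ hy₁, sub_right_inj] at hFe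
  have hex : ∃ A ∈ As, y₀ ∈ A ∧ y₁ ∉ A := by
    by_contra hcon
    push Not at hcon
    refine absurd hFe (Finset.sum_lt_sum (fun A hA => ?_)
      ⟨g • (line f ∪ side f b), (hmem _).2 ⟨g, rfl, y₁, hy₁, right_mem_segment ℝ y₀ y₁⟩, ?_⟩).ne
    · by_cases h : y₀ ∈ A
      · simp [h, hcon A hA h]
      · rw [if_neg h]; split_ifs <;> simp
    · rw [if_neg (hcompl g _ (h₂ hy₀)), if_pos]
      · exact zero_lt_one
      · rw [smul_set_union]; exact Or.inl hy₁
  obtain ⟨A, hA, hA₀, hA₁⟩ := hex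
  obtain ⟨h, rfl, -⟩ := (hmem A).1 hA
  have hy₁' : y₁ ∈ h • side f (!b) := by
    by_contra hn
    rw [← mem_compl_iff, hf.compl_smul_side, Bool.not_not, ← smul_set_union] at hn
    exact hA₁ hn
  have hT : h ∉ Subgroup.zpowers t := fun hT => hA₁ (by
    rw [smul_set_union, hs.smul_line hT, hs.smul_side hT]
    exact Or.inr (h₁ hy₁))
  have hdis := hs.disjoint_smul_line hf hT
  have hL : line f ⊆ h • side f b := by
    refine hf.subset_smul_side hf.isPreconnected_line hdis.symm hy₀ ?_
    rw [smul_set_union] at hA₀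
    exact hA₀.resolve_left fun h => disjoint_left.1 hdis h hy₀
  refine ⟨h, hL, ?_, ?_⟩
  · obtain ⟨d, hd⟩ := hf.exists_subset_smul_side (hf.isPreconnected_smul_line h)
      hf.nonempty_line.smul_set (g := (1 : G)) (by rwa [one_smul])
    by_cases hdb : d = b
    · rwa [hdb, one_smul] at hd
    obtain rfl : d = !b := by revert hdb; cases b <;> cases d <;> simp
    have := hf.nested hd (by rwa [one_smul])
    rw [one_smul, Bool.not_not] at this
    exact absurd hy₁' (disjoint_left.1 (hf.disjoint_smul_side_not h b) (this (Or.inr (h₁ hy₁))))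
  · refine hf.subset_smul_side (hf.isPreconnected_smul_line g) ?_ hy₁ hy₁'
    refine hs.line_ne hf fun hgh => ?_
    rw [hs.smul_side_congr hgh] at hL
    exact disjoint_left.1 (hf.disjoint_smul_side_not g b) (hL hy₀) (h₂ hy₀)

end Sys
end PlaneTop

namespace PlaneTop
open Filter Metric Topology Complex
open scoped Pointwise

variable {S : Type*} [TopologicalSpace S] {G : Type*} [Group G] [MulAction G ℂ]
  {p : ℂ → S} {t : G} {f : Circle1 → ℂ}

namespace EssLoop

theorem bool_unique (hf : EssLoop f) {g : G} {b d : Bool} {z : ℂ} (h₁ : z ∈ g • side f b)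
    (h₂ : z ∈ g • side f d) : b = d := by
  by_contra h
  obtain rfl : d = !b := by revert h; cases b <;> cases d <;> simp
  exact disjoint_left.1 (hf.disjoint_smul_side_not g b) h₁ h₂

end EssLoop

namespace Sys
variable [T2Space S] [ContinuousConstSMul G ℂ]

/-- Among the translates of the line `L` which stay at bounded distance from `L` and are above `L`,
there is a lowest one. -/
theorem exists_lowest (hs : Sys p t) (hf : Curve p f) {g : G} (hg : Comm t g)
    (h₁ : g • line f ⊆ side f true) : ∃ (m : G) (c : Bool), Comm t m ∧ m • line f ⊆ side f true ∧
      line f ⊆ m • side f c ∧ ∀ h : G, h • line f ⊆ side f true → ¬ h • line f ⊆ m • side f c := by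
  obtain ⟨y₀, hy₀⟩ := hf.nonempty_line
  obtain ⟨y₁, hy₁⟩ : (g • line f).Nonempty := hf.nonempty_line.smul_set
  set σ : ℝ → ℂ := fun s => y₀ + s * (y₁ - y₀) with hσd
  have hσ : Continuous σ := by fun_prop
  set E := {s | s ∈ Icc (0:ℝ) 1 ∧ ∃ h : G, Comm t h ∧ h • line f ⊆ side f true ∧ σ s ∈ h • line f}
    with hE
  have hfin := (hs.finite_smul_of_inter hf.toEssLoop (isCompact_Icc.image hσ (s := Icc 0 1))
    fun g hg => hs.smul_line hg f).subset (show {A : Set ℂ | (∃ h : G, A = h • line f ∧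
      (h • line f ∩ σ '' Icc 0 1).Nonempty) ∧ ∃ h : G, Comm t h ∧ h • line f ⊆ side f true ∧
        A = h • line f} ⊆ _ from fun A hA => hA.1)
  have hEc : IsCompact E := by
    have : E = Icc 0 1 ∩ σ ⁻¹' ⋃₀ {A : Set ℂ | (∃ h : G, A = h • line f ∧
      (h • line f ∩ σ '' Icc 0 1).Nonempty) ∧ ∃ h : G, Comm t h ∧ h • line f ⊆ side f true ∧
        A = h • line f} := by
      ext s
      constructor
      · rintro ⟨hs1, h, hh, hh', hsh⟩
        exact ⟨hs1, _, ⟨⟨h, rfl, _, hsh, s, hs1, rfl⟩, h, hh, hh', rfl⟩, hsh⟩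
      · rintro ⟨hs1, _, ⟨-, h, hh, hh', rfl⟩, hsh⟩
        exact ⟨hs1, h, hh, hh', hsh⟩
    rw [this]
    refine isCompact_Icc.inter_right (IsClosed.preimage hσ ?_)
    rw [sUnion_eq_biUnion]
    refine hfin.isClosed_biUnion ?_
    rintro _ ⟨⟨h, rfl, -⟩, -⟩
    exact hf.isClosed_line.smul h
  obtain ⟨s₀, ⟨hs₀, m, hm, hmL, hsm⟩, hmin⟩ := hEc.exists_isLeast
    ⟨1, ⟨zero_le_one, le_rfl⟩, g, hg, h₁, by simpa [hσd] using hy₁⟩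
  have hdis : ∀ h : G, h • line f ⊆ side f true → Disjoint (line f) (h • line f) := fun h hh =>
    disjoint_left.2 fun z hz hz' => disjoint_left.1 (EssLoop.disjoint_line true) hz (hh hz')
  have hside : ∀ h : G, h • line f ⊆ side f true → ∃ d, line f ⊆ h • side f d := fun h hh =>
    hf.exists_subset_smul_side hf.isPreconnected_line hf.nonempty_line (hdis h hh)
  obtain ⟨c, hc⟩ := hside m hmL
  refine ⟨m, c, hm, hmL, hc, fun h hh hhm => ?_⟩
  obtain ⟨R, hR, -, hRf⟩ := hf.exists_bound
  obtain ⟨R', hR'⟩ := hs.exists_halfPlane hf.toEssLoop hm hmL hc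
  have hhb : ∀ z ∈ h • line f, |z.re| ≤ max R R' := by
    intro z hz
    refine abs_le.2 ⟨?_, ?_⟩
    · by_contra hn
      push Not at hn
      exact disjoint_left.1 hf.disjoint_side (hh hz) (hRf z (by linarith [le_max_left R R']))
    · by_contra hn
      push Not at hn
      have h1 := hR' z ((le_max_right _ _).trans_lt hn)
      have := hf.bool_unique (hhm hz) h1
      revert this; cases c <;> simp
  have hhc : Comm t h := by
    refine hs.comm_of_forall_exists (isCompact_singleton (x := y₀)) (R := max R R') fun N =>
      ⟨y₀, rfl, hhb _ ?_⟩
    rw [mul_smul]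
    refine smul_mem_smul_set ?_
    rw [← hs.smul_line (g := t ^ N) ⟨N, rfl⟩ f]
    exact smul_mem_smul_set hy₀
  obtain ⟨d, hd⟩ := hside h hh
  obtain ⟨R'', hR''⟩ := hs.exists_halfPlane hf.toEssLoop hhc hh hd
  obtain ⟨e, he⟩ := hf.exists_subset_smul_side (hf.isPreconnected_smul_line m)
      hf.nonempty_line.smul_set (g := h) (EssLoop.disjoint_of_subset_smul_side hhm).symm
  have hed : e = !d := by
    have hn := hf.nested hhm he
    have h1 : ((max R' R'' + 1 : ℝ) : ℂ) ∈ h • side f e := hn (by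
      rw [smul_set_union]
      exact Or.inr (hR' _ (by rw [ofReal_re]; linarith [le_max_left R' R''])))
    exact hf.bool_unique h1 (hR'' _ (by rw [ofReal_re]; linarith [le_max_right R' R'']))
  have hmeet : (σ '' Icc 0 s₀ ∩ h • line f).Nonempty := by
    by_contra hn
    have h0 : y₀ ∈ σ '' Icc 0 s₀ := ⟨0, ⟨le_rfl, hs₀.1⟩, by simp [hσd]⟩
    have h2 := hf.subset_smul_side (isPreconnected_Icc.image σ hσ.continuousOn)
      (disjoint_iff_inter_eq_empty.2 (not_nonempty_iff_eq_empty.1 hn)) h0 (hd hy₀)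
    have h3 := hf.bool_unique (h2 ⟨s₀, ⟨hs₀.1, le_rfl⟩, rfl⟩) (he hsm)
    rw [hed] at h3
    revert h3; cases d <;> simp
  obtain ⟨_, ⟨s, hs1, rfl⟩, hs2⟩ := hmeet
  have h4 : s₀ ≤ s := hmin ⟨⟨hs1.1, hs1.2.trans hs₀.2⟩, h, hhc, hh, hs2⟩
  obtain rfl : s = s₀ := le_antisymm hs1.2 h4
  exact disjoint_left.1 (EssLoop.disjoint_of_subset_smul_side hhm) hs2 hsm

/-- The translation by `m` acts as an involution modulo `t`, and moves the line `L` up. -/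
structure _root_.PlaneTop.IsInvolution (t m : G) (f : Circle1 → ℂ) : Prop where
  notMem : m ∉ Subgroup.zpowers t
  sq : m * m ∈ Subgroup.zpowers t
  conj : ∀ k ∈ Subgroup.zpowers t, m * k * m⁻¹ ∈ Subgroup.zpowers t
  line_subset : line f ⊆ m • side f true
  smul_line_subset : m • line f ⊆ side f true
  halfPlane : ∃ R', ∀ z : ℂ, R' < z.re → z ∈ m • side f false
  mem_or : ∀ (h : G) (x : ℂ), x ∈ side f true ∩ m • side f true →
    h • x ∈ side f true ∩ m • side f true → h ∈ Subgroup.zpowers t ∨ m⁻¹ * h ∈ Subgroup.zpowers t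

/-- If some translate of the line `L` other than `L` stays at bounded distance from `L`, above `L`,
then some deck transformation acts as an involution exchanging `L` and a translate of `L`. -/
theorem exists_involution (hs : Sys p t) (hf : Curve p f) {c : Bool → Set S} (hc : Coloring p f c)
    {g : G} (hg : Comm t g) (h₁ : g • line f ⊆ side f true) :
    ∃ m : G, IsInvolution t m f := by
  obtain ⟨m, d, hm, hmL, hLm, hno⟩ := hs.exists_lowest hf hg h₁
  obtain ⟨y₀, hy₀⟩ := hf.nonempty_line
  have hside : ∀ g h : G, g⁻¹ * h ∉ Subgroup.zpowers t → ∃ d, h • line f ⊆ g • side f d :=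
    fun g h hgh => hf.exists_subset_smul_side (hf.isPreconnected_smul_line h)
      hf.nonempty_line.smul_set (hs.line_ne hf hgh).symm
  have hnT : ∀ h : G, h • line f ⊆ side f true → h ∉ Subgroup.zpowers t := fun h hh hT => by
    rw [hs.smul_line hT] at hh
    exact disjoint_left.1 (EssLoop.disjoint_line true) hy₀ (hh hy₀)
  have hbt : ∀ {d : Bool}, d ≠ true → d = false := fun {d} => by cases d <;> simp
  obtain rfl : d = true := by
    by_contra hd
    rw [hbt hd] at hLm hno
    obtain ⟨h, hh1, hh2, hh3⟩ := hs.exists_between hf hc hmL hLm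
    obtain ⟨e, he⟩ := hf.exists_subset_smul_side (hf.isPreconnected_smul_line h)
      hf.nonempty_line.smul_set (EssLoop.disjoint_of_subset_smul_side hh3).symm
    have := hf.nested hh3 he
    rw [Bool.not_not, smul_set_union] at this
    have h5 := hf.bool_unique (this (Or.inr (hh1 hy₀))) (hLm hy₀)
    exact hno h hh2 (h5 ▸ he)
  obtain ⟨R', hR'⟩ := hs.exists_halfPlane hf.toEssLoop hm hmL hLm
  have hconj : ∀ k ∈ Subgroup.zpowers t, m⁻¹ * (k * m) ∈ Subgroup.zpowers t := by
    intro k hk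
    by_contra hn
    have hup : ∀ k ∈ Subgroup.zpowers t, (k * m) • line f ⊆ side f true := by
      intro k hk
      rw [mul_smul, ← hs.smul_side hk f true]
      exact smul_set_mono hmL
    have hup' : ∀ k ∈ Subgroup.zpowers t, line f ⊆ (k * m) • side f true := by
      intro k hk
      rw [mul_smul]
      refine (hs.smul_line hk f).symm.subset.trans (smul_set_mono hLm)
    obtain ⟨d, hd⟩ := hside _ _ hn
    by_cases hdt : d = true
    · exact hno _ (hup k hk) (hdt ▸ hd)
    rw [hbt hdt] at hd
    obtain ⟨e, he⟩ := hf.exists_subset_smul_side (hf.isPreconnected_smul_line m)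
      hf.nonempty_line.smul_set (EssLoop.disjoint_of_subset_smul_side hd).symm
    have := hf.nested hd he
    rw [Bool.not_false, smul_set_union] at this
    have h5 := hf.bool_unique (this (Or.inr (hLm hy₀))) (hup' k hk hy₀)
    rw [h5] at he
    refine hno (k⁻¹ * m) (hup _ (inv_mem hk)) ?_
    rw [mul_smul] at he ⊢
    rw [← inv_smul_smul k (m • side f true)]
    exact smul_set_mono he
  have hinv : m⁻¹ • line f ⊆ side f true := by
    rw [← inv_smul_smul m (side f true)]
    exact smul_set_mono hLm
  have hinv' : line f ⊆ m⁻¹ • side f true := by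
    rw [← inv_smul_smul m (line f)]
    exact smul_set_mono hmL
  have hsq : m * m ∈ Subgroup.zpowers t := by
    by_contra hn
    obtain ⟨d, hd⟩ := hside m m⁻¹ (fun h => hn (by
      have := inv_mem h
      rwa [mul_inv_rev, inv_inv] at this))
    obtain ⟨e, he⟩ := hside m⁻¹ m (by rwa [inv_inv])
    by_cases hdt : d = true
    · exact hno _ hinv (hdt ▸ hd)
    by_cases het : e = true
    · refine hno (m * m) ?_ ?_
      · rw [mul_smul, ← smul_inv_smul m (side f true)]
        exact smul_set_mono (het ▸ he)
      · rw [mul_smul]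
        exact smul_set_mono hmL
    rw [hbt hdt] at hd
    have := hf.nested hd he
    rw [Bool.not_false, smul_set_union] at this
    exact het (hf.bool_unique (this (Or.inr (hLm hy₀))) (hinv' hy₀))
  have hmm : m⁻¹ * m⁻¹ ∈ Subgroup.zpowers t := by
    have := inv_mem hsq
    rwa [mul_inv_rev] at this
  have hconj' : ∀ k ∈ Subgroup.zpowers t, m * k * m⁻¹ ∈ Subgroup.zpowers t := fun k hk => by
    have := mul_mem (mul_mem hsq (hconj k hk)) hmm
    convert this using 1
    group
  refine ⟨m, hnT m hmL, hsq, hconj', hLm, hmL, ⟨R', hR'⟩, fun h x hx hhx => ?_⟩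
  by_contra hn
  push Not at hn
  obtain ⟨hn1, hn2⟩ := hn
  have hn3 : h * m ∉ Subgroup.zpowers t := fun hT => hn2 (by
    have := mul_mem (hconj _ hT) hmm
    convert this using 1
    group)
  have hn4 : m⁻¹ * (h * m) ∉ Subgroup.zpowers t := fun hT => hn1 (by
    have := hconj' _ hT
    convert this using 1
    group)
  set Rb := (line f ∪ side f true) \ (m • side f false) with hRb
  have hRbp : IsPreconnected Rb := by
    refine IsPreconnected.sdiff_of_isOpen (hf.isPreconnected_line_union_side true) (hf.isOpen_smul_side m false)
      (D := m • line f) ?_ (hf.isPreconnected_smul_line m) hf.nonempty_line.smul_set ?_ ?_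
    · rw [union_comm, ← Bool.not_true, ← hf.compl_smul_side]
      exact (hf.isOpen_smul_side m true).isClosed_compl
    · exact hmL.trans subset_union_right
    · exact disjoint_smul_set.2 (EssLoop.disjoint_line false)
  have hRbs : ∀ z, z ∈ side f true ∩ m • side f true → z ∈ Rb := fun z hz =>
    ⟨Or.inr hz.1, fun h => Bool.noConfusion (hf.bool_unique hz.2 h)⟩
  have hLRb : line f ⊆ Rb := fun z hz =>
    ⟨Or.inl hz, fun h => Bool.noConfusion (hf.bool_unique (hLm hz) h)⟩
  have key : ∀ k : G, k ∉ Subgroup.zpowers t → m⁻¹ * k ∉ Subgroup.zpowers t →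
      Disjoint Rb (k • line f) := by
    intro k hk hk'
    rw [disjoint_left]
    intro z hz hzk
    obtain ⟨d, hd⟩ := hside 1 k (by simpa using hk)
    obtain ⟨e, he⟩ := hside m k hk'
    rw [one_smul] at hd
    refine hno k ?_ ?_
    · by_cases hdt : d = true
      · rwa [hdt] at hd
      rw [hbt hdt] at hd
      rcases hz.1 with h | h
      · exact absurd (hd hzk) (disjoint_left.1 (EssLoop.disjoint_line false) h)
      · exact absurd (hd hzk) (disjoint_left.1 hf.disjoint_side h)
    · by_cases het : e = true
      · rwa [het] at he
      rw [hbt het] at he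
      exact absurd (he hzk) hz.2
  have hx1 : h • x ∈ h • side f true := smul_mem_smul_set hx.1
  have hx2 : h • x ∈ (h * m) • side f true := by
    rw [mul_smul]; exact smul_mem_smul_set hx.2
  have hs1 := hf.subset_smul_side hRbp (key h hn1 hn2) (hRbs _ hhx) hx1
  have hs2 := hf.subset_smul_side hRbp (key (h * m) hn3 hn4) (hRbs _ hhx) hx2
  refine hno h⁻¹ ?_ ?_
  · rw [← inv_smul_smul h (side f true)]
    exact smul_set_mono (hLRb.trans hs1)
  · rw [← inv_smul_smul h (m • side f true), ← mul_smul h m]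
    exact smul_set_mono (hLRb.trans hs2)

end Sys
end PlaneTop

namespace PlaneTop
open Filter Metric Topology Complex
open scoped Pointwise

/-- `a` and `b` are joined by an injective path in `W`. -/
def JoinedByArc (W : Set ℂ) (a b : ℂ) : Prop :=
  ∃ T > 0, ∃ c : ℝ → ℂ, ContinuousOn c (Icc 0 T) ∧ InjOn c (Icc 0 T) ∧ c 0 = a ∧ c T = b ∧
    ∀ s ∈ Icc 0 T, c s ∈ W

theorem JoinedByArc.of_segment {W : Set ℂ} {a b : ℂ} (hab : a ≠ b) (h : segment ℝ a b ⊆ W) :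
    JoinedByArc W a b := by
  refine ⟨1, one_pos, fun s => a + s • (b - a), by fun_prop, fun s _ s' _ h => ?_, by simp, by simp,
    fun s hs => h ?_⟩
  · have : s • (b - a) = s' • (b - a) := add_left_cancel h
    exact smul_left_injective ℝ (sub_ne_zero.2 hab.symm) this
  · rw [segment_eq_image']
    exact ⟨s, hs, rfl⟩

theorem joinedByArc_of_closedBall {W : Set ℂ} {a x y b : ℂ} {r : ℝ} (hW : closedBall x r ⊆ W)
    (hy : y ∈ closedBall x r) (hay : a = y ∨ JoinedByArc W a y) (hb : b ∈ closedBall x r)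
    (hab : a ≠ b) : JoinedByArc W a b := by
  have hseg : ∀ a' ∈ closedBall x r, segment ℝ a' b ⊆ closedBall x r := fun a' ha' =>
    (convex_closedBall x r).segment_subset ha' hb
  by_cases ha : a ∈ closedBall x r
  · exact .of_segment hab ((hseg a ha).trans hW)
  obtain rfl | ⟨T, hT, c, hc, hci, rfl, rfl, hcW⟩ := hay
  · exact absurd hy ha
  have hcpt : IsCompact (Icc 0 T ∩ c ⁻¹' closedBall x r) :=
    isCompact_Icc.of_isClosed_subset (hc.preimage_isClosed_of_isClosed isClosed_Icc isClosed_closedBall)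
      inter_subset_left
  obtain ⟨s₀, ⟨hs₀, hs₀x⟩, hmin⟩ := hcpt.exists_isLeast ⟨T, ⟨hT.le, le_rfl⟩, hy⟩
  have hs₀pos : 0 < s₀ := hs₀.1.lt_of_ne fun h => ha (by rw [h]; exact hs₀x)
  have hlt : ∀ s ∈ Ico 0 s₀, c s ∉ closedBall x r := fun s hs h =>
    absurd (hmin ⟨⟨hs.1, hs.2.le.trans hs₀.2⟩, h⟩) (not_le.2 hs.2)
  have hsub : Icc 0 s₀ ⊆ Icc 0 T := Icc_subset_Icc le_rfl hs₀.2
  by_cases hbs : c s₀ = b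
  · exact ⟨s₀, hs₀pos, c, hc.mono hsub, hci.mono hsub, rfl, hbs, fun s hs => hcW s (hsub hs)⟩
  set d : ℝ → ℂ := fun s => c s₀ + (s - s₀) • (b - c s₀) with hd
  have hdb : ∀ s ∈ Icc s₀ (s₀ + 1), d s ∈ closedBall x r := fun s hs => hseg _ hs₀x (by
    rw [segment_eq_image']
    exact ⟨s - s₀, ⟨by linarith [hs.1], by linarith [hs.2]⟩, rfl⟩)
  have hdi : Function.Injective d := fun s s' h => by
    have := smul_left_injective ℝ (sub_ne_zero.2 (Ne.symm hbs)) (add_left_cancel h)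
    linarith [show s - s₀ = s' - s₀ from this]
  have hds : d s₀ = c s₀ := by simp [hd]
  set e : ℝ → ℂ := fun s => if s ≤ s₀ then c s else d s with he
  have he1 : ∀ s, s ≤ s₀ → e s = c s := fun s h => if_pos h
  have he2 : ∀ s, s₀ ≤ s → e s = d s := fun s h => by
    obtain rfl | h := h.eq_or_lt
    · rw [he1 _ le_rfl, hds]
    · exact if_neg (not_le.2 h)
  have hcross : ∀ s ∈ Icc 0 (s₀ + 1), ∀ s' ∈ Icc 0 (s₀ + 1), s ≤ s' → e s = e s' → s = s' := by
    intro s hs s' hs' hss' h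
    rcases le_total s' s₀ with h1 | h1
    · rw [he1 _ h1, he1 _ (hss'.trans h1)] at h
      exact hci (hsub ⟨hs.1, hss'.trans h1⟩) (hsub ⟨hs'.1, h1⟩) h
    rw [he2 _ h1] at h
    rcases lt_or_ge s s₀ with h2 | h2
    · rw [he1 _ h2.le] at h
      exact absurd (h ▸ hdb s' ⟨h1, hs'.2⟩) (hlt s ⟨hs.1, h2⟩)
    · rw [he2 _ h2] at h
      exact hdi h
  refine ⟨s₀ + 1, by linarith, e, ?_, fun s hs s' hs' h => ?_, he1 _ hs₀pos.le, ?_, fun s hs => ?_⟩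
  · have h1 : ContinuousOn e (Icc 0 s₀) := (hc.mono hsub).congr fun s hs => he1 s hs.2
    have h2 : ContinuousOn e (Icc s₀ (s₀ + 1)) :=
      (show ContinuousOn d _ by fun_prop).congr fun s hs => he2 s hs.1
    rw [← Icc_union_Icc_eq_Icc hs₀pos.le (by linarith : s₀ ≤ s₀ + 1)]
    exact h1.union_of_isClosed h2 isClosed_Icc isClosed_Icc
  · rcases le_total s s' with h1 | h1
    · exact hcross s hs s' hs' h1 h
    · exact (hcross s' hs' s hs h1 h.symm).symm
  · rw [he2 _ (by linarith)]
    simp [hd]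
  · rcases le_total s s₀ with h1 | h1
    · rw [he1 _ h1]
      exact hcW _ (hsub ⟨hs.1, h1⟩)
    · rw [he2 _ h1]
      exact hW (hdb s ⟨h1, hs.2⟩)

/-- Connected open subsets of the plane are arcwise connected. -/
theorem joinedByArc_of_isPreconnected {W : Set ℂ} (hW : IsOpen W) (hc : IsPreconnected W) {a b : ℂ}
    (ha : a ∈ W) (hb : b ∈ W) (hab : a ≠ b) : JoinedByArc W a b := by
  set A := {b | b ∈ W ∧ (a = b ∨ JoinedByArc W a b)} with hA
  have key : ∀ x ∈ W, ∃ r > 0, closedBall x r ⊆ W ∧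
      ((∃ y ∈ closedBall x r, y ∈ A) → closedBall x r ⊆ A) := by
    intro x hx
    obtain ⟨r, hr, hrW⟩ := nhds_basis_closedBall.mem_iff.1 (hW.mem_nhds hx)
    refine ⟨r, hr, hrW, fun ⟨y, hy, hyA⟩ z hz => ⟨hrW hz, or_iff_not_imp_left.2 fun haz => ?_⟩⟩
    exact joinedByArc_of_closedBall hrW hy hyA.2 hz haz
  have hAo : IsOpen A := isOpen_iff_mem_nhds.2 fun x hx => by
    obtain ⟨r, hr, -, h⟩ := key x hx.1
    exact mem_of_superset (closedBall_mem_nhds x hr) (h ⟨x, mem_closedBall_self hr.le, hx⟩)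
  have hBo : IsOpen (W \ A) := isOpen_iff_mem_nhds.2 fun x hx => by
    obtain ⟨r, hr, hrW, h⟩ := key x hx.1
    refine mem_of_superset (closedBall_mem_nhds x hr) fun y hy => ⟨hrW hy, fun hyA => hx.2 ?_⟩
    exact h ⟨y, hy, hyA⟩ (mem_closedBall_self hr.le)
  have := hc.subset_left_of_subset_union hAo hBo disjoint_sdiff_right
    (fun x hx => (em (x ∈ A)).imp id fun h => ⟨hx, h⟩) ⟨a, ha, ha, Or.inl rfl⟩ hb
  exact this.2.resolve_left hab

/-- A fixed point free involution of a connected open subset of the plane preserves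
some simple closed curve, acting on it as the antipodal map. -/
theorem exists_antipodal_loop {W : Set ℂ} (hW : IsOpen W) (hc : IsPreconnected W)
    (hne : W.Nonempty) {τ : ℂ → ℂ} (hτ : ContinuousOn τ W) (hτW : MapsTo τ W W)
    (hττ : ∀ w ∈ W, τ (τ w) = w) (hτw : ∀ w ∈ W, τ w ≠ w) :
    ∃ f : Circle1 → ℂ, IsEmbedding f ∧ range f ⊆ W ∧ ∀ θ, τ (f θ) = f (θ + ((1 / 2 : ℝ) : Circle1)) := by
  obtain ⟨z, hz⟩ := hne
  obtain ⟨T, hT, c, hcc, hci, h0, h1, hcW⟩ :=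
    joinedByArc_of_isPreconnected hW hc hz (hτW hz) (hτw z hz).symm
  have hτc : ContinuousOn (fun s => τ (c s)) (Icc 0 T) := hτ.comp hcc hcW
  set K := {x : ℝ × ℝ | x ∈ Icc (0:ℝ) T ×ˢ Icc (0:ℝ) T ∧ x.1 ≤ x.2 ∧ c x.2 - τ (c x.1) = 0} with hK
  have hKc : IsCompact K := by
    have hcl : IsClosed (Icc (0:ℝ) T ×ˢ Icc (0:ℝ) T) := isClosed_Icc.prod isClosed_Icc
    have hcont : ContinuousOn (fun x : ℝ × ℝ => c x.2 - τ (c x.1)) (Icc (0:ℝ) T ×ˢ Icc (0:ℝ) T) :=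
      (hcc.comp continuousOn_snd fun x hx => hx.2).sub (hτc.comp continuousOn_fst fun x hx => hx.1)
    have h2 := hcont.preimage_isClosed_of_isClosed hcl (isClosed_singleton (x := (0:ℂ)))
    refine IsCompact.of_isClosed_subset (isCompact_Icc.prod isCompact_Icc) (t := K) ?_ fun x hx => hx.1
    convert h2.inter (isClosed_le continuous_fst continuous_snd) using 1
    ext x
    exact ⟨fun h => ⟨⟨h.1, h.2.2⟩, h.2.1⟩, fun h => ⟨h.1.1, h.2, h.1.2⟩⟩
  obtain ⟨⟨r, s⟩, ⟨hrs, hle, hcs⟩, hmin⟩ := hKc.exists_isMinOn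
    ⟨(0, T), ⟨⟨le_rfl, hT.le⟩, ⟨hT.le, le_rfl⟩⟩, hT.le, by simp [h0, h1]⟩
    (f := fun x => x.2 - x.1) (by fun_prop)
  replace hcs : c s = τ (c r) := sub_eq_zero.1 hcs
  have hr : r ∈ Icc 0 T := hrs.1
  have hs : s ∈ Icc 0 T := hrs.2
  have hlt : r < s := hle.lt_of_ne fun h => hτw _ (hcW r hr) (by rw [← hcs]; exact congrArg c h.symm)
  have hτs : τ (c s) = c r := by rw [hcs, hττ _ (hcW r hr)]
  set l := s - r with hl
  have hlpos : 0 < l := sub_pos.2 hlt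
  have hmem : ∀ u ∈ Icc (0:ℝ) 1, r + u * l ∈ Icc 0 T := fun u hu =>
    ⟨by nlinarith [hr.1, hu.1], by nlinarith [hs.2, hu.2]⟩
  set k : ℝ → ℂ := fun u => c (r + u * l) with hk
  have hkc : ContinuousOn k (Icc 0 1) := hcc.comp (by fun_prop) hmem
  have hkW : ∀ u ∈ Icc (0:ℝ) 1, k u ∈ W := fun u hu => hcW _ (hmem u hu)
  have hki : InjOn k (Icc 0 1) := fun u hu v hv h => by
    have := hci (hmem u hu) (hmem v hv) h
    exact mul_right_cancel₀ hlpos.ne' (add_left_cancel this)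
  have hk0 : k 0 = c r := by simp [hk]
  have hk1 : k 1 = c s := by simp [hk, hl]
  have hcross : ∀ u ∈ Icc (0:ℝ) 1, ∀ v ∈ Icc (0:ℝ) 1, u ≤ v → k v = τ (k u) → u = 0 ∧ v = 1 := by
    intro u hu v hv huv h
    have := hmin (show (r + u * l, r + v * l) ∈ K from
      ⟨⟨hmem u hu, hmem v hv⟩, by simpa using mul_le_mul_of_nonneg_right huv hlpos.le,
        sub_eq_zero.2 h⟩)
    have h3 : l ≤ r + v * l - (r + u * l) := this
    have h4 : 1 ≤ v - u := by
      by_contra! h5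
      nlinarith
    exact ⟨by linarith [hu.1, hv.2], by linarith [hu.1, hv.2]⟩
  have hcross' : ∀ u ∈ Ico (0:ℝ) 1, ∀ v ∈ Ico (0:ℝ) 1, k v ≠ τ (k u) := by
    intro u hu v hv h
    rcases le_total u v with h1 | h1
    · exact hv.2.ne (hcross u ⟨hu.1, hu.2.le⟩ v ⟨hv.1, hv.2.le⟩ h1 h).2
    · refine hu.2.ne (hcross v ⟨hv.1, hv.2.le⟩ u ⟨hu.1, hu.2.le⟩ h1 ?_).2
      rw [h, hττ _ (hkW u ⟨hu.1, hu.2.le⟩)]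
  set F : ℝ → ℂ := fun x => if x < 1 / 2 then k (2 * x) else τ (k (2 * x - 1)) with hF
  have hF1 : ∀ x, x < 1 / 2 → F x = k (2 * x) := fun x h => if_pos h
  have hF2 : ∀ x, 1 / 2 ≤ x → F x = τ (k (2 * x - 1)) := fun x h => if_neg (not_lt.2 h)
  have hF1' : ∀ x, x ≤ 1 / 2 → F x = k (2 * x) := fun x h => by
    obtain rfl | h := h.eq_or_lt
    · rw [hF2 _ le_rfl, show (2 * (1 / 2 : ℝ) - 1) = 0 by norm_num, hk0, ← hcs, ← hk1]
      norm_num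
    · exact hF1 x h
  have hFc : ContinuousOn F (Icc 0 1) := by
    rw [← Icc_union_Icc_eq_Icc (by norm_num : (0:ℝ) ≤ 1 / 2) (by norm_num : (1/2 : ℝ) ≤ 1)]
    refine ContinuousOn.union_of_isClosed ?_ ?_ isClosed_Icc isClosed_Icc
    · refine ContinuousOn.congr (hkc.comp (f := fun x : ℝ => 2 * x) (by fun_prop) fun x hx => ?_)
        fun x hx => hF1' x hx.2
      exact ⟨by linarith [hx.1], by linarith [hx.2]⟩
    · refine ContinuousOn.congr ((hτ.comp hkc hkW).comp (f := fun x : ℝ => 2 * x - 1) (by fun_prop)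
        fun x hx => ?_) fun x hx => hF2 x hx.1
      exact ⟨by linarith [hx.1], by linarith [hx.2]⟩
  have hF01 : F 0 = F 1 := by
    rw [hF1 _ (by norm_num), hF2 _ (by norm_num)]
    norm_num
    rw [hk0, hk1, hτs]
  have hFW : ∀ x ∈ Ico (0:ℝ) 1, F x ∈ W := fun x hx => by
    rcases lt_or_ge x (1/2) with h | h
    · rw [hF1 x h]
      exact hkW _ ⟨by linarith [hx.1], by linarith⟩
    · rw [hF2 x h]
      exact hτW (hkW _ ⟨by linarith, by linarith [hx.2]⟩)
  have hFi' : ∀ x ∈ Ico (0:ℝ) 1, ∀ y ∈ Ico (0:ℝ) 1, x ≤ y → F x = F y → x = y := by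
    intro x hx y hy hxy h
    rcases lt_or_ge y (1/2) with h1 | h1
    · rw [hF1 _ h1, hF1 _ (hxy.trans_lt h1)] at h
      linarith [hki ⟨by linarith [hx.1], by linarith⟩ ⟨by linarith [hy.1], by linarith⟩ h]
    rw [hF2 _ h1] at h
    rcases lt_or_ge x (1/2) with h2 | h2
    · rw [hF1 _ h2] at h
      exact absurd h (hcross' _ ⟨by linarith, by linarith [hy.2]⟩ _ ⟨by linarith [hx.1], by linarith⟩)
    · rw [hF2 _ h2] at h
      have hu : 2 * x - 1 ∈ Icc (0:ℝ) 1 := ⟨by linarith, by linarith [hx.2]⟩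
      have hv : 2 * y - 1 ∈ Icc (0:ℝ) 1 := ⟨by linarith, by linarith [hy.2]⟩
      have := congrArg τ h
      rw [hττ _ (hkW _ hu), hττ _ (hkW _ hv)] at this
      linarith [hki hu hv this]
  have hFi : InjOn F (Ico 0 1) := fun x hx y hy h => (le_total x y).elim
    (fun h1 => hFi' x hx y hy h1 h) fun h1 => (hFi' y hy x hx h1 h.symm).symm
  have hf : ∀ x ∈ Ico (0:ℝ) 1, AddCircle.liftIco 1 0 F (x : Circle1) = F x := fun x hx =>
    AddCircle.liftIco_zero_coe_apply hx
  have hex : ∀ θ : Circle1, ∃ x ∈ Ico (0:ℝ) 1, (x : Circle1) = θ := fun θ => by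
    have := AddCircle.coe_image_Ico_eq (1:ℝ) 0
    rw [zero_add] at this
    exact (this ▸ mem_univ θ : θ ∈ _ '' Ico (0:ℝ) 1)
  refine ⟨AddCircle.liftIco 1 0 F, ?_, ?_, fun θ => ?_⟩
  · refine (Continuous.isClosedEmbedding (AddCircle.liftIco_zero_continuous hF01 hFc) ?_).isEmbedding
    intro θ θ' h
    obtain ⟨x, hx, rfl⟩ := hex θ
    obtain ⟨y, hy, rfl⟩ := hex θ'
    rw [hf x hx, hf y hy] at h
    rw [hFi hx hy h]
  · rintro _ ⟨θ, rfl⟩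
    obtain ⟨x, hx, rfl⟩ := hex θ
    rw [hf x hx]
    exact hFW x hx
  · obtain ⟨x, hx, rfl⟩ := hex θ
    rw [hf x hx, ← AddCircle.coe_add]
    rcases lt_or_ge x (1/2) with h | h
    · rw [hf _ ⟨by linarith [hx.1], by linarith⟩, hF1 _ h, hF2 _ (by linarith [hx.1])]
      ring_nf
    · have : ((x + 1 / 2 : ℝ) : Circle1) = ((x - 1 / 2 : ℝ) : Circle1) := by
        have h1 : (x + 1/2 : ℝ) = (x - 1/2) + 1 := by ring
        rw [h1]
        exact AddCircle.coe_add_period 1 _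
      rw [this, hf _ ⟨by linarith, by linarith [hx.2]⟩, hF2 _ h, hF1' _ (by linarith [hx.2]),
        hττ _ (hkW _ ⟨by linarith, by linarith [hx.2]⟩)]
      ring_nf

end PlaneTop

namespace PlaneTop
open Filter Metric Topology Complex
open scoped Pointwise

variable {S : Type*} [TopologicalSpace S] {G : Type*} [Group G] [MulAction G ℂ]
  {p : ℂ → S} {t m : G} {f : Circle1 → ℂ}

/-- The map of the punctured plane induced by `m`. -/
def tau (m : G) (w : ℂ) : ℂ := exp (m • log w)

/-- The region between the loop `f` and its image under `tau m`. -/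
def core (m : G) (f : Circle1 → ℂ) : Set ℂ :=
  {w | w ≠ 0 ∧ Far (range f) w ∧ Far (range f) (tau m w)}

theorem exists_exp_eq {w : ℂ} (hw : w ≠ 0) : ∃ z, exp z = w := ⟨log w, exp_log hw⟩

theorem tau_ne_zero (w : ℂ) : tau m w ≠ 0 := exp_ne_zero _

namespace IsInvolution

theorem tau_exp (hs : Sys p t) (hm : IsInvolution t m f) (z : ℂ) : tau m (exp z) = exp (m • z) := by
  obtain ⟨k, hk⟩ := exp_eq_exp_iff_exists_int.1 (exp_log (exp_ne_zero z))
  obtain ⟨j, hj⟩ := hm.conj (t ^ k) ⟨k, rfl⟩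
  rw [tau, hk, ← hs.zpow_smul, ← mul_smul, show m * t ^ k = t ^ j * m by
    rw [show t ^ j = m * t ^ k * m⁻¹ from hj, inv_mul_cancel_right], mul_smul, hs.exp_zpow_smul]

theorem tau_tau (hs : Sys p t) (hm : IsInvolution t m f) {w : ℂ} (hw : w ≠ 0) :
    tau m (tau m w) = w := by
  obtain ⟨z, rfl⟩ := exists_exp_eq hw
  obtain ⟨j, hj⟩ := hm.sq
  rw [hm.tau_exp hs, hm.tau_exp hs, ← mul_smul, ← hj]
  exact hs.exp_zpow_smul j z

theorem map_tau (hs : Sys p t) (hm : IsInvolution t m f) {w : ℂ} (hw : w ≠ 0) :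
    p (tau m w) = p w := by
  obtain ⟨z, rfl⟩ := exists_exp_eq hw
  rw [hm.tau_exp hs, hs.map_smul]

theorem tau_ne_self (hs : Sys p t) (hm : IsInvolution t m f) {w : ℂ} (hw : w ≠ 0) :
    tau m w ≠ w := by
  obtain ⟨z, rfl⟩ := exists_exp_eq hw
  rw [hm.tau_exp hs]
  exact fun h => hm.notMem (hs.mem_zpowers_of_exp_eq h)

theorem exp_mem_core_iff (hs : Sys p t) (hm : IsInvolution t m f) {z : ℂ} :
    exp z ∈ core m f ↔ z ∈ side f true ∩ m • side f true := by
  have h1 : z ∈ m • side f true ↔ m • z ∈ side f true := by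
    rw [mem_smul_set_iff_inv_smul_mem]
    conv_rhs => rw [← hs.smul_side hm.sq f true]
    rw [mem_smul_set_iff_inv_smul_mem, mul_inv_rev, mul_smul, inv_smul_smul]
  rw [mem_inter_iff, h1, core, mem_ofPred_eq, hm.tau_exp hs]
  exact ⟨fun h => h.2, fun h => ⟨exp_ne_zero z, h⟩⟩

theorem eq_or_eq_tau (hs : Sys p t) (hm : IsInvolution t m f) {w w' : ℂ} (hw : w ∈ core m f)
    (hw' : w' ∈ core m f) (h : p w = p w') : w' = w ∨ w' = tau m w := by
  obtain ⟨z, rfl⟩ := exists_exp_eq hw.1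
  obtain ⟨z', rfl⟩ := exists_exp_eq hw'.1
  obtain ⟨g, rfl⟩ := hs.trans z z' h
  rcases hm.mem_or g z ((hm.exp_mem_core_iff hs).1 hw) ((hm.exp_mem_core_iff hs).1 hw') with
    ⟨k, rfl⟩ | ⟨k, hk⟩
  · exact Or.inl (hs.exp_zpow_smul k z)
  · right
    rw [show g = m * t ^ k by rw [show t ^ k = m⁻¹ * g from hk, mul_inv_cancel_left], mul_smul,
      ← hm.tau_exp hs, hs.exp_zpow_smul]

theorem mapsTo_core (hs : Sys p t) (hm : IsInvolution t m f) : MapsTo (tau m) (core m f) (core m f) :=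
  fun w hw => ⟨tau_ne_zero w, hw.2.2, by rw [hm.tau_tau hs hw.1]; exact hw.2.1⟩

theorem far_tau_of_mem_range (hs : Sys p t) (hf : EssLoop f) (hm : IsInvolution t m f) {w : ℂ}
    (hw : w ∈ range f) : Far (range f) (tau m w) := by
  obtain ⟨z, rfl⟩ := exists_exp_eq (w := w) fun h => hf.zero_notMem (h ▸ hw)
  rw [hm.tau_exp hs]
  exact hm.smul_line_subset (smul_mem_smul_set hw)

variable [ContinuousConstSMul G ℂ]

theorem continuousOn_tau (hs : Sys p t) (hm : IsInvolution t m f) : ContinuousOn (tau m) {0}ᶜ := by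
  intro w hw
  obtain ⟨z, rfl⟩ := exists_exp_eq hw
  refine ContinuousAt.continuousWithinAt ?_
  rw [ContinuousAt, ← map_exp_nhds, tendsto_map'_iff]
  have : tau m ∘ exp = fun z => exp (m • z) := funext fun z => hm.tau_exp hs z
  rw [this, hm.tau_exp hs]
  exact (continuous_exp.comp (continuous_const_smul m)).continuousAt

theorem isOpen_core (hs : Sys p t) (hf : EssLoop f) (hm : IsInvolution t m f) :
    IsOpen (core m f) := by
  have hF := isOpen_far (isCompact_range_loop hf.emb).isClosed
  have h0 : IsOpen ({0}ᶜ : Set ℂ) := isOpen_compl_singleton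
  have := (h0.inter hF).inter ((hm.continuousOn_tau hs).isOpen_inter_preimage h0 hF)
  convert this using 1
  ext w
  exact ⟨fun h => ⟨⟨h.1, h.2.1⟩, h.1, h.2.2⟩, fun h => ⟨h.1.1, h.1.2, h.2.2⟩⟩

theorem nonempty_core (hs : Sys p t) (hf : EssLoop f) (hm : IsInvolution t m f) :
    (core m f).Nonempty := by
  have h1 := hf.nested (g := m) (h := 1) (b := true) (c := true) (by simpa using hm.smul_line_subset)
    (by simpa using hm.line_subset)
  rw [one_smul] at h1
  have h2 : (univ : Set ℂ) ⊆ side f true ∪ m • side f true := fun z _ => by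
    rcases hf.cover z with h | h | h
    · exact Or.inl h
    · exact Or.inr (h1 (Or.inl h))
    · exact Or.inr (h1 (Or.inr h))
  obtain ⟨y, hy⟩ := hf.nonempty_line
  obtain ⟨z, -, hz⟩ := isPreconnected_univ (side f true) (m • side f true) (hf.isOpen_side _)
    (hf.isOpen_smul_side m true) h2 ⟨m • y, mem_univ _, hm.smul_line_subset (smul_mem_smul_set hy)⟩
    ⟨y, mem_univ _, hm.line_subset hy⟩
  exact ⟨exp z, (hm.exp_mem_core_iff hs).2 hz⟩

theorem far_of_linked_far {K : Set ℂ} {a b : ℂ} (ha : Far K a) (h : Linked Kᶜ a b) :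
    Linked {w | Far K w} a b := by
  obtain ⟨C, hC, hCK, haC, hbC⟩ := h
  exact ⟨C, hC, fun x hx => ha.of_linked ⟨C, hC, hCK, haC, hx⟩, haC, hbC⟩

theorem isPreconnected_core (hs : Sys p t) (hf : EssLoop f) (hm : IsInvolution t m f) :
    IsPreconnected (core m f) := by
  have hJ := isCompact_range_loop hf.emb
  have hJ0 : range f ⊆ {0}ᶜ := fun w hw h => hf.zero_notMem (h ▸ hw)
  have hF0 : {w | Far (range f) w} ⊆ {0}ᶜ := fun w hw h => hf.not_far (h ▸ hw)
  have hτJ : IsCompact (tau m '' range f) := hJ.image_of_continuousOn ((hm.continuousOn_tau hs).mono hJ0)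
  have hdis : range f ∩ tau m '' range f = ∅ := by
    rw [← disjoint_iff_inter_eq_empty, disjoint_right]
    rintro _ ⟨w, hw, rfl⟩
    exact (hm.far_tau_of_mem_range hs hf hw).notMem
  refine isPreconnected_of_forall_pair fun a ha b hb => ?_
  have h1 := ha.2.1.linked hJ hb.2.1
  have h2 : Linked (tau m '' range f)ᶜ a b := by
    have := (far_of_linked_far ha.2.2 (ha.2.2.linked hJ hb.2.2)).image
      ((hm.continuousOn_tau hs).mono hF0)
    rw [hm.tau_tau hs ha.1, hm.tau_tau hs hb.1] at this
    refine this.mono ?_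
    rintro _ ⟨w, hw, rfl⟩ ⟨j, hj, hjw⟩
    have := congrArg (tau m) hjw
    rw [hm.tau_tau hs (hJ0 hj), hm.tau_tau hs (hF0 hw)] at this
    exact hw.notMem (this ▸ hj)
  obtain ⟨C, hC, hCK, haC, hbC⟩ := h1.janiszewski hJ hτJ (by rw [hdis]; exact isPreconnected_empty) h2
  have hCF : ∀ x ∈ C, Far (range f) x := fun x hx =>
    ha.2.1.of_linked ⟨C, hC, fun y hy h => hCK hy (Or.inl h), haC, hx⟩
  refine ⟨C, fun x hx => ⟨hF0 (hCF x hx), hCF x hx, ha.2.2.of_linked ⟨tau m '' C, ?_, ?_,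
    mem_image_of_mem _ haC, mem_image_of_mem _ hx⟩⟩, haC, hbC, hC⟩
  · exact hC.image _ ((hm.continuousOn_tau hs).mono fun x hx => hF0 (hCF x hx))
  · rintro _ ⟨y, hy, rfl⟩ h
    exact hCK hy (Or.inr ⟨_, h, hm.tau_tau hs (hF0 (hCF y hy))⟩)

variable {k : Circle1 → ℂ}

/-- A loop on which `tau` acts as the antipodal map winds around the origin. -/
theorem not_far_of_antipodal (hs : Sys p t) (hm : IsInvolution t m f) (hk : IsEmbedding k)
    (hkτ : ∀ θ, tau m (k θ) = k (θ + ((1 / 2 : ℝ) : Circle1))) : ¬ Far (range k) 0 := by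
  intro hfar
  obtain ⟨l, hl, hle⟩ := hfar.hasLog (isCompact_range_loop hk)
  simp only [sub_zero] at hle
  set L : Circle1 → ℂ := fun θ => l (k θ) with hL
  have hLc : Continuous L := hl.comp_continuous hk.continuous fun θ => mem_range_self θ
  have hLe : ∀ θ, exp (L θ) = k θ := fun θ => hle _ (mem_range_self θ)
  set h2 : Circle1 := ((1 / 2 : ℝ) : Circle1) with hh
  have h22 : h2 + h2 = 0 := by
    rw [hh, ← AddCircle.coe_add]
    norm_num
  have hexp : ∀ θ, exp (L (θ + h2)) = exp (m • L θ) := fun θ => by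
    rw [hLe, ← hkτ, ← hLe, hm.tau_exp hs]
  obtain ⟨j, hj⟩ := exp_eq_exp_iff_exists_int.1 (hexp 0)
  have hconst : ∀ θ, L (θ + h2) = (t ^ j * m) • L θ := fun θ => by
    have := eq_of_log_eq_on (l := fun θ => L (θ + h2)) (m := fun θ => m • L θ)
      (isPreconnected_univ (α := Circle1)) (by fun_prop) (by fun_prop) (fun θ _ => hexp θ)
      (mem_univ θ) (mem_univ 0)
    rw [mul_smul, hs.zpow_smul]
    linear_combination this + hj
  set a := t ^ j * m with ha
  have haa : a * a = 1 := hs.free _ (L 0) (by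
    rw [mul_smul, ← hconst, ← hconst, add_assoc, h22, add_zero])
  have ha1 : a ≠ 1 := fun h => hm.notMem ⟨-j, by
    change t ^ (-j) = m
    rw [zpow_neg]
    exact (eq_inv_of_mul_eq_one_right h).symm⟩
  have hφ0 : ∀ x : ℂ, a • x - x ≠ 0 := fun x h => ha1 (hs.free a x (sub_eq_zero.1 h))
  obtain ⟨ψ, hψ, hψe⟩ := exists_log_of_continuous (g := fun x : ℂ => a • x - x) (by fun_prop) hφ0
  have haax : ∀ x : ℂ, a • a • x = x := fun x => by rw [← mul_smul, haa, one_smul]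
  have hneg : ∀ x : ℂ, exp (ψ (a • x)) = exp (ψ x + Real.pi * I) := fun x => by
    rw [exp_add, exp_pi_mul_I, hψe, hψe, haax]
    ring
  have := eq_of_log_eq_on (l := fun x : ℂ => ψ (a • x)) (m := fun x => ψ x + Real.pi * I)
    (isPreconnected_univ (α := ℂ)) (by fun_prop) (by fun_prop) (fun x _ => hneg x)
    (mem_univ 0) (mem_univ (a • (0:ℂ)))
  simp only [haax] at this
  have h3 : ψ (a • 0) = ψ 0 := by linear_combination this / 2
  have h4 := hneg 0
  rw [h3, exp_add, exp_pi_mul_I] at h4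
  refine exp_ne_zero (ψ 0) ?_
  linear_combination h4 / 2

omit [ContinuousConstSMul G ℂ] in
theorem linked_of_range_subset_core (hf : EssLoop f) (hkc : range k ⊆ core m f) {w : ℂ}
    (hw : w ∈ range f) : Linked (range k)ᶜ 0 w := by
  have hsub : range f ⊆ closure {z | Linked (range f)ᶜ 0 z} := fun x hx =>
    (range_subset_closure hf.emb hf.zero_notMem hf.not_far hx).1
  have h0 : Linked (range f)ᶜ 0 0 := Linked.refl hf.zero_notMem
  refine ⟨{z | Linked (range f)ᶜ 0 z} ∪ range f, (isPreconnected_linked _ _).subset_closure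
    subset_union_left (union_subset subset_closure hsub), ?_, Or.inl h0, Or.inr hw⟩
  rintro z hz hzk
  have hfar := (hkc hzk).2.1
  rcases hz with h | h
  · exact hf.not_far (hfar.of_linked h.symm)
  · exact hfar.notMem h

theorem far_tau_of_range_subset_core (hs : Sys p t) (hf : EssLoop f) (hm : IsInvolution t m f)
    (hkc : range k ⊆ core m f) {w : ℂ} (hw : w ∈ range f) : Far (range k) (tau m w) := by
  intro R
  obtain ⟨R', hR'⟩ := hm.halfPlane
  obtain ⟨z, rfl⟩ := exists_exp_eq (w := w) fun h => hf.zero_notMem (h ▸ hw)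
  rw [hm.tau_exp hs]
  set x : ℝ := max R' (Real.log (|R| + 1)) + 1 with hx
  have hx1 : (x : ℂ) ∈ m • side f false := hR' _ (by
    rw [ofReal_re, hx]; linarith [le_max_left R' (Real.log (|R| + 1))])
  refine ⟨exp x, ?_, exp '' (m • (line f ∪ side f false)), ?_, ?_,
    mem_image_of_mem _ (smul_mem_smul_set (Or.inl hw)),
    mem_image_of_mem _ (smul_set_mono subset_union_right hx1)⟩
  · rw [norm_exp, ofReal_re]
    have hR0 : 0 < |R| + 1 := by positivity
    have := (Real.log_lt_iff_lt_exp hR0).1 (show Real.log (|R| + 1) < x by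
      rw [hx]; linarith [le_max_right R' (Real.log (|R| + 1))])
    linarith [le_abs_self R]
  · exact ((hf.isPreconnected_line_union_side false).image _
      (continuous_const_smul m).continuousOn).image _ continuous_exp.continuousOn
  · rintro _ ⟨y, hy, rfl⟩ hyk
    have h1 := ((hm.exp_mem_core_iff hs).1 (hkc hyk)).2
    rw [← Bool.not_true, smul_set_union, ← hf.compl_smul_side] at hy
    exact hy h1

/-- `tau` maps the inside of an antipodal loop to its outside. -/
theorem far_tau (hs : Sys p t) (hf : EssLoop f) (hm : IsInvolution t m f) (hk : IsEmbedding k)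
    (hkc : range k ⊆ core m f) (hkτ : ∀ θ, tau m (k θ) = k (θ + ((1 / 2 : ℝ) : Circle1))) {w : ℂ}
    (hw : Linked (range k)ᶜ 0 w) (hw0 : w ≠ 0) : Far (range k) (tau m w) := by
  obtain ⟨j, hj⟩ := range_nonempty f
  have hj0 : j ≠ 0 := fun h => hf.zero_notMem (h ▸ hj)
  have h0 : Linked ({0}ᶜ : Set ℂ) j w :=
    ⟨_, (isConnected_compl_singleton_of_one_lt_rank (by simp) 0).isPreconnected, subset_rfl, hj0, hw0⟩
  have hk0 : range k ∩ {0} = ∅ := by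
    rw [inter_singleton_eq_empty]
    exact fun h => (hkc h).1 rfl
  have h1 := (((linked_of_range_subset_core hf hkc hj).symm.trans hw).janiszewski
    (isCompact_range_loop hk) isCompact_singleton (by rw [hk0]; exact isPreconnected_empty) h0).image
    ((hm.continuousOn_tau hs).mono (compl_subset_compl.2 subset_union_right))
  refine (hm.far_tau_of_range_subset_core hs hf hkc hj).of_linked (h1.mono ?_)
  rintro _ ⟨x, hx, rfl⟩ ⟨θ, hθ⟩
  refine hx (Or.inl ⟨θ + ((1 / 2 : ℝ) : Circle1), ?_⟩)
  rw [← hkτ, hθ, hm.tau_tau hs fun h => hx (Or.inr h)]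

end IsInvolution
end PlaneTop

namespace PlaneTop
open Filter Metric Topology Complex
open scoped Pointwise

variable {S : Type} [TopologicalSpace S] {G : Type*} [Group G] [MulAction G ℂ]
  {p : ℂ → S} {t m : G} {f : Circle1 → ℂ}

theorem coe_half_eq {u u' : ℝ} (hu : u ∈ Icc (0:ℝ) 1) (hu' : u' ∈ Icc (0:ℝ) 1)
    (h : ((u / 2 : ℝ) : Circle1) = ((u' / 2 : ℝ) : Circle1)) : u = u' := by
  obtain ⟨n, hn⟩ := (QuotientAddGroup.eq_iff_sub_mem.1 h)
  have h1 : (n : ℝ) = u / 2 - u' / 2 := by simpa using hn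
  have h2 : n < 1 := by exact_mod_cast (show (n : ℝ) < 1 by linarith [hu.2, hu'.1])
  have h3 : -1 < n := by exact_mod_cast (show (-1 : ℝ) < n by linarith [hu.1, hu'.2])
  obtain rfl : n = 0 := by omega
  push_cast at h1
  linarith

theorem coe_half_add_half_eq {u u' : ℝ} (hu : u ∈ Icc (0:ℝ) 1) (hu' : u' ∈ Icc (0:ℝ) 1)
    (h : ((u / 2 : ℝ) : Circle1) = ((u' / 2 + 1 / 2 : ℝ) : Circle1)) :
    (u = 1 ∧ u' = 0) ∨ (u = 0 ∧ u' = 1) := by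
  obtain ⟨n, hn⟩ := (QuotientAddGroup.eq_iff_sub_mem.1 h)
  have h1 : (n : ℝ) = u / 2 - (u' / 2 + 1 / 2) := by simpa using hn
  have h2 : n < 1 := by exact_mod_cast (show (n : ℝ) < 1 by linarith [hu.2, hu'.1])
  have h3 : -2 < n := by exact_mod_cast (show (-2 : ℝ) < n by linarith [hu.1, hu'.2])
  obtain rfl | rfl : n = 0 ∨ n = -1 := by omega
  · left
    push_cast at h1
    constructor <;> linarith [hu.2, hu'.1]
  · right
    push_cast at h1
    constructor <;> linarith [hu'.2, hu.1]

/-- A collar `Φ : Circle1 × [0, ε] → S` of a two-to-one loop yields a Möbius band. -/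
theorem exists_mobius {Ψ : Circle1 → ℝ → S} {ε : ℝ} (hε : 0 < ε)
    (hΨ : ContinuousOn (fun x : Circle1 × ℝ => Ψ x.1 x.2) (univ ×ˢ Icc 0 ε))
    (h0 : ∀ θ, Ψ (θ + ((1 / 2 : ℝ) : Circle1)) 0 = Ψ θ 0)
    (hinj : ∀ θ θ', ∀ r ∈ Icc 0 ε, ∀ r' ∈ Icc 0 ε, Ψ θ r = Ψ θ' r' → (θ = θ' ∧ r = r') ∨
      (r = 0 ∧ r' = 0 ∧ θ = θ' + ((1 / 2 : ℝ) : Circle1))) :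
    ∃ e : C(MobiusBand, S), Function.Injective e := by
  have hI : ∀ x : unitInterval, (x : ℝ) ∈ Icc (0:ℝ) 1 := fun x => x.2
  set A : unitInterval × unitInterval → S := fun x =>
    Ψ (((x.1 / 2 : ℝ)) : Circle1) (ε * (2 * x.2 - 1)) with hA
  set B : unitInterval × unitInterval → S := fun x =>
    Ψ (((x.1 / 2 + 1 / 2 : ℝ)) : Circle1) (ε * (1 - 2 * x.2)) with hB
  have hAr : ∀ x : unitInterval × unitInterval, 1 / 2 ≤ (x.2 : ℝ) → ε * (2 * x.2 - 1) ∈ Icc 0 ε :=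
    fun x hx => ⟨by nlinarith, by nlinarith [(hI x.2).2]⟩
  have hBr : ∀ x : unitInterval × unitInterval, (x.2 : ℝ) ≤ 1 / 2 → ε * (1 - 2 * x.2) ∈ Icc 0 ε :=
    fun x hx => ⟨by nlinarith, by nlinarith [(hI x.2).1]⟩
  have hAB : ∀ x : unitInterval × unitInterval, (x.2 : ℝ) = 1 / 2 → A x = B x := fun x hx => by
    simp only [hA, hB, hx]
    norm_num
    have := h0 ((x.1 / 2 : ℝ) : Circle1)
    rw [← AddCircle.coe_add] at this
    rw [← this]
    norm_num
  set P : unitInterval × unitInterval → S := fun x => if 1 / 2 ≤ (x.2 : ℝ) then A x else B x with hP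
  have hP1 : ∀ x : unitInterval × unitInterval, 1 / 2 ≤ (x.2 : ℝ) → P x = A x := fun x h => if_pos h
  have hP2 : ∀ x : unitInterval × unitInterval, (x.2 : ℝ) ≤ 1 / 2 → P x = B x := fun x h => by
    obtain h | h := h.eq_or_lt
    · rw [hP1 _ h.ge, hAB _ h]
    · exact if_neg (not_le.2 h)
  have hPc : Continuous P := by
    have hsnd : Continuous fun x : unitInterval × unitInterval => (x.2 : ℝ) := by fun_prop
    have hcl1 : IsClosed {x : unitInterval × unitInterval | 1 / 2 ≤ (x.2 : ℝ)} :=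
      isClosed_le continuous_const hsnd
    have hcl2 : IsClosed {x : unitInterval × unitInterval | (x.2 : ℝ) ≤ 1 / 2} :=
      isClosed_le hsnd continuous_const
    rw [← continuousOn_univ, show (univ : Set (unitInterval × unitInterval)) =
      {x | 1 / 2 ≤ (x.2 : ℝ)} ∪ {x | (x.2 : ℝ) ≤ 1 / 2} from
      by
        ext x; simpa using le_total _ _]
    refine ContinuousOn.union_of_isClosed ?_ ?_ hcl1 hcl2
    · refine ContinuousOn.congr ?_ hP1
      refine hΨ.comp (f := fun x : unitInterval × unitInterval =>
        ((((x.1 / 2 : ℝ)) : Circle1), (ε * (2 * x.2 - 1) : ℝ))) (Continuous.continuousOn ?_)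
        fun x hx => ⟨mem_univ _, hAr x hx⟩
      exact ((AddCircle.continuous_mk' 1).comp (by fun_prop)).prodMk (by fun_prop)
    · refine ContinuousOn.congr ?_ hP2
      refine hΨ.comp (f := fun x : unitInterval × unitInterval =>
        ((((x.1 / 2 + 1 / 2 : ℝ)) : Circle1), (ε * (1 - 2 * x.2) : ℝ))) (Continuous.continuousOn ?_)
        fun x hx => ⟨mem_univ _, hBr x hx⟩
      exact ((AddCircle.continuous_mk' 1).comp (by fun_prop)).prodMk (by fun_prop)
  have hrel : ∀ x y, MobiusRel x y → P x = P y := by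
    rintro x y (rfl | ⟨h1, h2, h3⟩)
    · rfl
    have h10 : ((1 / 2 + 1 / 2 : ℝ) : Circle1) = ((0 / 2 : ℝ) : Circle1) := by
      norm_num
    rcases le_total (1 / 2) (x.2 : ℝ) with h | h
    · rw [hP1 x h, hP2 y (by linarith)]
      simp only [hA, hB, h1, h2]
      rw [h10, show (1 - 2 * (y.2 : ℝ)) = 2 * x.2 - 1 by linarith]
    · rw [hP2 x h, hP1 y (by linarith)]
      simp only [hA, hB, h1, h2]
      rw [zero_div, zero_add, show (1 - 2 * (x.2 : ℝ)) = 2 * y.2 - 1 by linarith]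
  have hmix : ∀ x y : unitInterval × unitInterval, 1 / 2 ≤ (x.2 : ℝ) → (y.2 : ℝ) ≤ 1 / 2 →
      P x = P y → (Quot.mk MobiusRel x) = Quot.mk MobiusRel y := by
    intro x y hx hy h
    rw [hP1 x hx, hP2 y hy] at h
    rcases hinj _ _ _ (hAr x hx) _ (hBr y hy) h with ⟨h1, h2⟩ | ⟨h1, h2, h3⟩
    · have h4 : (x.2 : ℝ) + y.2 = 1 := by
        have := mul_left_cancel₀ hε.ne' h2
        linarith
      rcases coe_half_add_half_eq (hI x.1) (hI y.1) h1 with ⟨h5, h6⟩ | ⟨h5, h6⟩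
      · exact (Quot.sound (show MobiusRel y x from Or.inr ⟨h6, h5, by linarith⟩)).symm
      · exact Quot.sound (Or.inr ⟨h5, h6, h4⟩)
    · have h4 : (x.2 : ℝ) = 1 / 2 := by
        have := (mul_eq_zero.1 h1).resolve_left hε.ne'
        linarith
      have h5 : (y.2 : ℝ) = 1 / 2 := by
        have := (mul_eq_zero.1 h2).resolve_left hε.ne'
        linarith
      rw [← AddCircle.coe_add, show (y.1 / 2 + 1 / 2 + 1 / 2 : ℝ) = y.1 / 2 + 1 by ring] at h3
      rw [show ((y.1 / 2 + 1 : ℝ) : Circle1) = ((y.1 / 2 : ℝ) : Circle1) from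
        AddCircle.coe_add_period 1 _] at h3
      exact congrArg _ (Prod.ext (Subtype.ext (coe_half_eq (hI _) (hI _) h3))
        (Subtype.ext (h4.trans h5.symm)))
  refine ⟨⟨Quot.lift P hrel, continuous_quot_lift hrel hPc⟩, ?_⟩
  rintro ⟨x⟩ ⟨y⟩ h
  replace h : P x = P y := h
  rcases le_total (1 / 2) (x.2 : ℝ) with hx | hx <;> rcases le_total (1 / 2) (y.2 : ℝ) with hy | hy
  · rw [hP1 x hx, hP1 y hy] at h
    rcases hinj _ _ _ (hAr x hx) _ (hAr y hy) h with ⟨h1, h2⟩ | ⟨h1, h2, h3⟩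
    · have h4 : (x.2 : ℝ) = y.2 := by
        have := mul_left_cancel₀ hε.ne' h2
        linarith
      exact congrArg _ (Prod.ext (Subtype.ext (coe_half_eq (hI _) (hI _) h1)) (Subtype.ext h4))
    · have h4 : (y.2 : ℝ) = 1 / 2 := by
        have := (mul_eq_zero.1 h2).resolve_left hε.ne'
        linarith
      refine hmix x y hx h4.le ?_
      rw [hP1 x hx, hP2 y h4.le, ← hAB y h4, h]
  · exact hmix x y hx hy h
  · exact (hmix y x hy hx h.symm).symm
  · rw [hP2 x hx, hP2 y hy] at h
    rcases hinj _ _ _ (hBr x hx) _ (hBr y hy) h with ⟨h1, h2⟩ | ⟨h1, h2, h3⟩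
    · have h4 : (x.2 : ℝ) = y.2 := by
        have := mul_left_cancel₀ hε.ne' h2
        linarith
      rw [AddCircle.coe_add, AddCircle.coe_add] at h1
      exact congrArg _ (Prod.ext (Subtype.ext (coe_half_eq (hI _) (hI _) (add_right_cancel h1)))
        (Subtype.ext h4))
    · have h4 : (x.2 : ℝ) = 1 / 2 := by
        have := (mul_eq_zero.1 h1).resolve_left hε.ne'
        linarith
      refine hmix x y h4.ge hy ?_
      rw [hP1 x h4.ge, hP2 y hy, hAB x h4, h]

variable [ContinuousConstSMul G ℂ]

theorem IsInvolution.exists_mobius (hs : Sys p t) (hf : EssLoop f) (hm : IsInvolution t m f) :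
    ∃ e : C(MobiusBand, S), Function.Injective e := by
  have hcore0 : core m f ⊆ {0}ᶜ := fun w hw => hw.1
  obtain ⟨k, hk, hkc, hkτ⟩ := exists_antipodal_loop (hm.isOpen_core hs hf)
    (hm.isPreconnected_core hs hf) (hm.nonempty_core hs hf)
    ((hm.continuousOn_tau hs).mono hcore0) (hm.mapsTo_core hs)
    (fun w hw => hm.tau_tau hs hw.1) fun w hw => hm.tau_ne_self hs hw.1
  have hnf := hm.not_far_of_antipodal hs hk hkτ
  obtain ⟨Φ, hΦ, hΦi, hΦ0, hΦr⟩ := exists_collar hk (fun h => (hkc h).1 rfl) hnf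
  have hcl : IsClosed ((univ : Set Circle1) ×ˢ Icc (0:ℝ) (1 / 2)) := isClosed_univ.prod isClosed_Icc
  have hcpt : IsCompact ((univ : Set Circle1) ×ˢ Icc (0:ℝ) (1 / 2)) := isCompact_univ.prod isCompact_Icc
  obtain ⟨ε, hε, hε2, hεc⟩ : ∃ ε > 0, ε ≤ 1 / 2 ∧ ∀ θ, ∀ r ∈ Icc 0 ε, Φ (θ, r) ∈ core m f := by
    set K := (univ : Set Circle1) ×ˢ Icc (0:ℝ) (1 / 2) ∩ Φ ⁻¹' (core m f)ᶜ with hK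
    have hKc : IsCompact K := hcpt.of_isClosed_subset
      (hΦ.preimage_isClosed_of_isClosed hcl (hm.isOpen_core hs hf).isClosed_compl) inter_subset_left
    rcases K.eq_empty_or_nonempty with h | h
    · refine ⟨1 / 2, by norm_num, le_rfl, fun θ r hr => ?_⟩
      by_contra hn
      exact notMem_empty (θ, r) (by rw [← h]; exact ⟨⟨mem_univ _, hr⟩, hn⟩)
    · obtain ⟨⟨θ₀, r₀⟩, ⟨⟨-, hr₀⟩, hn⟩, hmin⟩ := hKc.exists_isMinOn h (f := Prod.snd) (by fun_prop)
      have hpos : 0 < r₀ := hr₀.1.lt_of_ne (by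
        rintro rfl
        exact hn ((hΦ0 θ₀).symm ▸ hkc (mem_range_self θ₀)))
      refine ⟨r₀ / 2, by positivity, by linarith [hr₀.2], fun θ r hr => ?_⟩
      by_contra hn'
      have := hmin (show (θ, r) ∈ K from ⟨⟨mem_univ _, hr.1, by linarith [hr.2, hr₀.2]⟩, hn'⟩)
      have h3 : r₀ ≤ r := this
      linarith [hr.2]
  have hsub : ∀ r ∈ Icc 0 ε, r ∈ Icc (0:ℝ) (1 / 2) := fun r hr => ⟨hr.1, hr.2.trans hε2⟩
  refine PlaneTop.exists_mobius (Ψ := fun θ r => p (Φ (θ, r))) hε ?_ (fun θ => ?_) ?_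
  · exact hs.continuousOn.comp (hΦ.mono fun x hx => ⟨hx.1, hsub _ hx.2⟩)
      fun x hx => hcore0 (hεc x.1 x.2 hx.2)
  · simp only [hΦ0]
    rw [← hkτ, hm.map_tau hs (hkc (mem_range_self θ)).1]
  · intro θ θ' r hr r' hr' h
    have hinj : ∀ θ θ' r r', r ∈ Icc 0 ε → r' ∈ Icc 0 ε → Φ (θ, r) = Φ (θ', r') → θ = θ' ∧ r = r' :=
      fun θ θ' r r' hr hr' h => Prod.ext_iff.1 (hΦi ⟨mem_univ _, hsub r hr⟩ ⟨mem_univ _, hsub r' hr'⟩ h)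
    rcases hm.eq_or_eq_tau hs (hεc θ' r' hr') (hεc θ r hr) h.symm with h1 | h1
    · exact Or.inl (hinj _ _ _ _ hr hr' h1)
    · have hr'0 : r' = 0 := by
        by_contra hne
        have h2 := hΦr θ' r' ⟨hr'.1.lt_of_ne (Ne.symm hne), (hsub _ hr').2⟩
        have h3 := hm.far_tau hs hf hk hkc hkτ h2.1 h2.2
        rw [← h1] at h3
        rcases hr.1.eq_or_lt with rfl | hpos
        · exact h3.notMem (hΦ0 θ ▸ mem_range_self θ)
        · exact hnf (h3.of_linked (hΦr θ r ⟨hpos, (hsub _ hr).2⟩).1.symm)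
      subst hr'0
      rw [hΦ0, hkτ, ← hΦ0] at h1
      obtain ⟨h2, h3⟩ := hinj _ _ _ _ hr hr' h1
      exact Or.inr ⟨h3, rfl, h2⟩

end PlaneTop

namespace PlaneTop
open Filter Metric Topology Complex
open scoped Pointwise

variable {S : Type} [TopologicalSpace S] {G : Type*} [Group G] [MulAction G ℂ]
  {p : ℂ → S} {t : G} {f : Circle1 → ℂ}

/-- The group `G`, acting on the plane by the given action conjugated by `z ↦ -z`. -/
def Flip (G : Type*) : Type _ := G

instance : Group (Flip G) := inferInstanceAs (Group G)

instance : MulAction (Flip G) ℂ where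
  smul g z := -((show G from g) • (-z))
  one_smul z := by
    change -((1 : G) • (-z)) = z
    rw [one_smul, neg_neg]
  mul_smul g h z := by
    change -(((show G from g) * (show G from h)) • (-z)) =
      -((show G from g) • (- -((show G from h) • (-z))))
    rw [neg_neg, mul_smul]

/-- The element `g`, seen in the flipped group. -/
def toFlip (g : G) : Flip G := g

theorem toFlip_smul (g : G) (z : ℂ) : toFlip g • z = -(g • (-z)) := rfl

instance [ContinuousConstSMul G ℂ] : ContinuousConstSMul (Flip G) ℂ where
  continuous_const_smul g := ((continuous_const_smul (show G from g)).comp continuous_neg).neg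

omit [MulAction G ℂ] in
theorem Comm.toFlip {g : G} (h : Comm t g) : Comm (toFlip t⁻¹) (toFlip g) := by
  obtain ⟨k, i, hk, hi, h⟩ := h
  refine ⟨-k, -i, neg_ne_zero.2 hk, neg_ne_zero.2 hi, ?_⟩
  change g * (t⁻¹) ^ (-k) = (t⁻¹) ^ (-i) * g
  simpa using h

theorem Sys.flip (hs : Sys p t) : Sys (fun w => p w⁻¹) (toFlip t⁻¹) := by
  have hfun : (fun z => p (exp z)⁻¹) = (fun z => p (exp z)) ∘ Homeomorph.neg ℂ := by
    ext z; simp [exp_neg]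
  have hp : ∀ z, p (exp z)⁻¹ = p (exp (-z)) := fun z => by rw [exp_neg]
  refine ⟨?_, ?_, fun z => ?_, fun x => ?_, fun g z => ?_, fun z w h => ?_, fun g z h => ?_, fun z => ?_⟩
  · rw [hfun]
    exact hs.cont.comp (Homeomorph.neg ℂ).continuous
  · rw [hfun]
    exact hs.open_map.comp (Homeomorph.neg ℂ).isOpenMap
  · obtain ⟨V, hV, hVi⟩ := hs.loc_inj (-z)
    refine ⟨-V, continuous_neg.continuousAt.preimage_mem_nhds hV, fun x hx y hy h => ?_⟩
    simp only [hp] at h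
    exact neg_injective (hVi hx hy h)
  · obtain ⟨z, hz⟩ := hs.surj x
    exact ⟨-z, by rw [hp, neg_neg, hz]⟩
  · change p (exp (-((show G from g) • (-z))))⁻¹ = _
    rw [hp, neg_neg, hs.map_smul, hp]
  · rw [hp, hp] at h
    obtain ⟨g, hg⟩ := hs.trans _ _ h
    exact ⟨toFlip g, by rw [toFlip_smul, hg, neg_neg]⟩
  · exact hs.free _ _ (neg_eq_iff_eq_neg.1 h)
  · rw [toFlip_smul, inv_smul_eq_iff.2 (show -z = t • (-z - 2 * Real.pi * I) by rw [hs.t_smul]; ring)]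
    ring

theorem inv_linked {A : Set ℂ} {a b : ℂ} (h : Linked (A ∪ {0})ᶜ a b) :
    Linked (Inv.inv '' A)ᶜ a⁻¹ b⁻¹ := by
  have := h.image (f := Inv.inv) (continuousOn_inv₀.mono fun x hx h0 => hx (Or.inr h0))
  refine this.mono ?_
  rintro _ ⟨x, hx, rfl⟩ ⟨y, hy, hyx⟩
  exact hx (Or.inl (inv_injective hyx ▸ hy))

namespace EssLoop

theorem linked_compl_union_zero (hJ : IsCompact (range f)) (h0 : 0 ∉ range f) {a b : ℂ}
    (h : Linked (range f)ᶜ a b) (ha : a ≠ 0) (hb : b ≠ 0) : Linked (range f ∪ {0})ᶜ a b := by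
  refine h.janiszewski hJ isCompact_singleton ?_
    ⟨_, (isConnected_compl_singleton_of_one_lt_rank (by simp) 0).isPreconnected, subset_rfl, ha, hb⟩
  rw [inter_singleton_eq_empty.2 h0]
  exact isPreconnected_empty

variable (hf : EssLoop f)
include hf

theorem exists_ball : ∃ r > 0, ball 0 r ⊆ (range f)ᶜ :=
  Metric.isOpen_iff.1 (isCompact_range_loop hf.emb).isClosed.isOpen_compl 0 hf.zero_notMem

theorem far_inv {w : ℂ} (hw : w ≠ 0) (h : Linked (range f)ᶜ 0 w) :
    Far (Inv.inv '' range f) w⁻¹ := by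
  intro R
  obtain ⟨r, hr, hb⟩ := hf.exists_ball
  set x : ℝ := min (r / 2) (|R| + 1)⁻¹ with hx
  have hR : 0 < |R| + 1 := by positivity
  have hx0 : 0 < x := by positivity
  have hxr : ‖(x : ℂ)‖ < r := by
    rw [norm_real, Real.norm_of_nonneg hx0.le]
    linarith [min_le_left (r / 2) (|R| + 1)⁻¹]
  have h2 : Linked (range f)ᶜ 0 (x : ℂ) :=
    ⟨_, (convex_ball _ _).isPreconnected, hb, mem_ball_self hr, mem_ball_zero_iff.2 hxr⟩
  refine ⟨(x : ℂ)⁻¹, ?_, inv_linked (linked_compl_union_zero (isCompact_range_loop hf.emb)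
    hf.zero_notMem (h.symm.trans h2) hw (by exact_mod_cast hx0.ne'))⟩
  rw [norm_inv, norm_real, Real.norm_of_nonneg hx0.le]
  have : |R| + 1 ≤ x⁻¹ := (le_inv_comm₀ hR hx0).2 (min_le_right _ _)
  linarith [le_abs_self R]

theorem linked_inv {w : ℂ} (h : Far (range f) w) : Linked (Inv.inv '' range f)ᶜ 0 w⁻¹ := by
  have hw : w ≠ 0 := fun h0 => hf.not_far (h0 ▸ h)
  obtain ⟨R, hR⟩ := (isCompact_range_loop hf.emb).isBounded.exists_norm_le
  obtain ⟨b, hb, hwb⟩ := h (|R| + 1)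
  have hRp : 0 < |R| + 1 := by positivity
  have hb0 : b ≠ 0 := norm_pos_iff.1 (hRp.trans hb)
  refine Linked.trans ⟨ball 0 (|R| + 1)⁻¹, (convex_ball _ _).isPreconnected, ?_,
    mem_ball_self (by positivity), ?_⟩ (inv_linked (linked_compl_union_zero
      (isCompact_range_loop hf.emb) hf.zero_notMem hwb.symm hb0 hw))
  · rintro _ hx ⟨y, hy, rfl⟩
    rw [mem_ball_zero_iff, norm_inv] at hx
    have hy0 : y ≠ 0 := fun h => hf.zero_notMem (h ▸ hy)
    have := (inv_lt_inv₀ (norm_pos_iff.2 hy0) hRp).1 hx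
    linarith [hR y hy, le_abs_self R]
  · rw [mem_ball_zero_iff, norm_inv]
    exact (inv_lt_inv₀ (norm_pos_iff.2 hb0) hRp).2 hb

theorem flip : EssLoop fun θ => (f θ)⁻¹ := by
  have hne : ∀ θ, f θ ≠ 0 := fun θ h => hf.zero_notMem ⟨θ, h⟩
  have hr : range (fun θ => (f θ)⁻¹) = Inv.inv '' range f := range_comp Inv.inv f
  have hemb : IsEmbedding fun θ => (f θ)⁻¹ :=
    ((hf.emb.continuous.inv₀ hne).isClosedEmbedding
      (inv_injective.comp hf.emb.injective)).isEmbedding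
  have h0 : 0 ∉ range fun θ => (f θ)⁻¹ := by
    rintro ⟨θ, h⟩
    exact hne θ (inv_eq_zero.1 h)
  refine ⟨hemb, h0, fun hfar => ?_⟩
  obtain ⟨R, hR, hRt, hRf⟩ := hf.exists_bound
  have h1 : Far (range f) (exp ((R + 1 : ℝ) : ℂ)) := hRt _ (by rw [ofReal_re]; linarith)
  have h2 : Linked (range f)ᶜ 0 (exp ((-R - 1 : ℝ) : ℂ)) := hRf _ (by rw [ofReal_re]; linarith)
  have h3 := hf.linked_inv h1
  have h4 := hf.far_inv (exp_ne_zero _) h2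
  rw [← hr] at h3 h4
  have h5 := (hfar.linked (isCompact_range_loop hemb) h4)
  have h6 := inv_linked (linked_compl_union_zero (isCompact_range_loop hemb) h0 (h3.symm.trans h5)
    (inv_ne_zero (exp_ne_zero _)) (inv_ne_zero (exp_ne_zero _)))
  rw [inv_inv, inv_inv, hr, ← image_comp, show (Inv.inv ∘ Inv.inv : ℂ → ℂ) = id by ext; simp,
    image_id] at h6
  exact hf.not_far (h1.of_linked (h6.trans h2.symm))

theorem neg_mem_side_flip {z : ℂ} (h : z ∈ side f false) : -z ∈ side (fun θ => (f θ)⁻¹) true := by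
  change Far (range (Inv.inv ∘ f)) (exp (-z))
  rw [range_comp, exp_neg]
  exact hf.far_inv (exp_ne_zero _) h

end EssLoop

omit [TopologicalSpace S] in
theorem Curve.flip (hf : Curve p f) : Curve (fun w => p w⁻¹) fun θ => (f θ)⁻¹ := by
  refine ⟨hf.toEssLoop.flip, ?_⟩
  rintro _ ⟨θ, rfl⟩ _ ⟨θ', rfl⟩ h
  simp only [inv_inv] at h
  simp only [hf.inj (mem_range_self _) (mem_range_self _) h]

namespace Sys
variable [T2Space S] [ConnectedSpace S] [ContinuousConstSMul G ℂ]

theorem not_subset_side_true (hs : Sys p t) (hf : Curve p f) (hsep : ¬ IsPreconnected (p '' range f)ᶜ)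
    (hM : ¬ ∃ e : C(MobiusBand, S), Function.Injective e) {g : G} (hg : Comm t g) :
    ¬ g • line f ⊆ side f true := fun h => by
  obtain ⟨c, hc⟩ := hs.exists_coloring hf hsep
  obtain ⟨m, hm⟩ := hs.exists_involution hf hc hg h
  exact hM (hm.exists_mobius hs hf.toEssLoop)

/-- On an orientable surface, only the powers of `t` keep the line `L` at bounded distance. -/
theorem mem_zpowers_of_comm (hs : Sys p t) (hf : Curve p f)
    (hsep : ¬ IsPreconnected (p '' range f)ᶜ)
    (hM : ¬ ∃ e : C(MobiusBand, S), Function.Injective e) {g : G} (hg : Comm t g) :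
    g ∈ Subgroup.zpowers t := by
  by_contra hgT
  have h1 := hs.disjoint_smul_line hf hgT
  obtain ⟨b, hb⟩ := hf.exists_subset_smul_side (g := (1 : G)) (hf.isPreconnected_smul_line g)
    hf.nonempty_line.smul_set (by rwa [one_smul])
  rw [one_smul] at hb
  cases b
  · have hr : (fun w => p w⁻¹) '' range (fun θ => (f θ)⁻¹) = p '' range f := by
      rw [← range_comp, ← range_comp]
      congr 1
      ext θ
      simp
    refine hs.flip.not_subset_side_true hf.flip (by rwa [hr]) hM hg.toFlip ?_
    rintro _ ⟨z, ⟨θ, hθ⟩, rfl⟩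
    change -(g • (-z)) ∈ _
    exact hf.toEssLoop.neg_mem_side_flip (hb (smul_mem_smul_set ⟨θ, by
      rw [exp_neg, ← hθ, inv_inv]⟩))
  · exact hs.not_subset_side_true hf hsep hM hg hb

end Sys
end PlaneTop

namespace PlaneTop
open Filter Metric Topology Complex
open scoped Pointwise

variable {S : Type} [TopologicalSpace S] {G : Type*} [Group G] [MulAction G ℂ]
  {p : ℂ → S} {t : G} {f f' : Circle1 → ℂ}

namespace EssLoop

theorem exists_far_point (hf : EssLoop f) (hf' : EssLoop f') (b : Bool) :
    ∃ z, z ∈ side f b ∧ z ∈ side f' b := by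
  obtain ⟨R, -, hRt, hRf⟩ := hf.exists_bound
  obtain ⟨R', -, hRt', hRf'⟩ := hf'.exists_bound
  have h1 := le_max_left R R'
  have h2 := le_max_right R R'
  cases b
  · exact ⟨(-(max R R' + 1) : ℝ), hRf _ (by rw [ofReal_re]; linarith),
      hRf' _ (by rw [ofReal_re]; linarith)⟩
  · exact ⟨(max R R' + 1 : ℝ), hRt _ (by rw [ofReal_re]; linarith),
      hRt' _ (by rw [ofReal_re]; linarith)⟩

theorem subset_side {X : Set ℂ} (hf : EssLoop f) (hX : IsPreconnected X) (hd : Disjoint X (line f))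
    {x : ℂ} (hx : x ∈ X) {b : Bool} (hxb : x ∈ side f b) : X ⊆ side f b := by
  refine hX.subset_left_of_subset_union (hf.isOpen_side b) (hf.isOpen_side (!b))
    (hf.disjoint_side_not b) (fun z hz => ?_) ⟨x, hx, hxb⟩
  by_contra h
  rw [mem_union, not_or] at h
  exact h.2 (hf.mem_side_not (disjoint_left.1 hd hz) h.1)

theorem exists_subset_side {X : Set ℂ} (hf : EssLoop f) (hX : IsPreconnected X) (hne : X.Nonempty)
    (hd : Disjoint X (line f)) : ∃ b, X ⊆ side f b := by
  obtain ⟨x, hx⟩ := hne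
  rcases hf.cover x with h | h | h
  · exact ⟨true, hf.subset_side hX hd hx h⟩
  · exact absurd h (disjoint_left.1 hd hx)
  · exact ⟨false, hf.subset_side hX hd hx h⟩

theorem side_subset_side (hf : EssLoop f) (hf' : EssLoop f') {b : Bool}
    (h : line f' ⊆ side f b) : side f' b ⊆ side f b := by
  have hd : Disjoint (line f) (line f') := (disjoint_line b).mono_right h
  obtain ⟨d, hL⟩ := hf'.exists_subset_side hf.isPreconnected_line hf.nonempty_line hd
  obtain ⟨x, hx⟩ := hf.nonempty_line
  obtain ⟨y, hy⟩ := hf'.nonempty_line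
  by_cases hdb : d = b
  · subst hdb
    have h1 : line f ∪ side f (!d) ⊆ side f' d := by
      refine hf'.subset_side (hf.isPreconnected_line_union_side _) ?_ (Or.inl hx) (hL hx)
      rw [← hf.compl_side]
      exact disjoint_left.2 fun z hz hz' => hz (h hz')
    obtain ⟨z, hz, hz'⟩ := hf.exists_far_point hf' (!d)
    exact absurd hz' (disjoint_left.1 (hf'.disjoint_side_not d) (h1 (Or.inr hz)))
  · obtain rfl : d = !b := by revert hdb; cases b <;> cases d <;> simp
    refine subset_union_right.trans (hf.subset_side (hf'.isPreconnected_line_union_side b) ?_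
      (Or.inl hy) (h hy))
    have := hf'.compl_side (!b)
    rw [Bool.not_not] at this
    rw [← this]
    exact disjoint_left.2 fun z hz hz' => hz (hL hz')

end EssLoop

namespace Sys
variable [T2Space S] [ContinuousConstSMul G ℂ]

/-- A deck transformation which does not nearly commute with `t` moves homotopic lines to the
same side. -/
theorem smul_line_subset_side (hs : Sys p t) (hf : EssLoop f) (hf' : Curve p f') {g : G}
    (hgT : g ∉ Subgroup.zpowers t) (hg : ¬ Comm t g) {b : Bool} (h : g • line f ⊆ side f b) :
    g • line f' ⊆ side f' b := by
  obtain ⟨d, hd⟩ := hf'.exists_subset_side (hf'.isPreconnected_smul_line g)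
    hf'.nonempty_line.smul_set (hs.disjoint_smul_line hf' hgT)
  by_cases hdb : d = b
  · rwa [← hdb]
  exfalso
  obtain ⟨x, hx⟩ := hf.nonempty_line
  obtain ⟨y, hy⟩ := hf'.nonempty_line
  obtain ⟨R, hR, hRt, hRf⟩ := hf.exists_bound
  obtain ⟨R', -, hRt', hRf'⟩ := hf'.exists_bound
  have hD : IsCompact (segment ℝ x y) := by
    rw [segment_eq_image_lineMap]
    exact isCompact_Icc.image AffineMap.lineMap_continuous
  refine hg (hs.comm_of_forall_exists hD (R := max R R') fun N => ?_)
  by_contra! hcon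
  set X : Set ℂ := (g * t ^ N) • segment ℝ x y with hXd
  have hX : IsPreconnected X := (convex_segment x y).isPreconnected.image _
    (continuous_const_smul (g * t ^ N)).continuousOn
  have hxX : (g * t ^ N) • x ∈ X := smul_mem_smul_set (left_mem_segment ℝ x y)
  have hyX : (g * t ^ N) • y ∈ X := smul_mem_smul_set (right_mem_segment ℝ x y)
  have hxs : (g * t ^ N) • x ∈ side f b := by
    refine h ?_
    rw [mul_smul, ← hs.smul_line (g := t ^ N) ⟨N, rfl⟩ f]
    exact smul_mem_smul_set (smul_mem_smul_set hx)
  have hys : (g * t ^ N) • y ∈ side f' d := by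
    refine hd ?_
    rw [mul_smul, ← hs.smul_line (g := t ^ N) ⟨N, rfl⟩ f']
    exact smul_mem_smul_set (smul_mem_smul_set hy)
  have hR0 := le_max_left R R'
  have hR1 := le_max_right R R'
  have hXR : ∀ z ∈ X, max R R' < |z.re| := by
    rintro _ ⟨z, hz, rfl⟩
    exact hcon z hz
  have hsub := hX.subset_or_subset (u := {z : ℂ | max R R' < z.re}) (v := {z : ℂ | z.re < -max R R'})
    (isOpen_lt continuous_const continuous_re) (isOpen_lt continuous_re continuous_const)
    (disjoint_left.2 fun z hz hz' => by
      have h1 := (abs_nonneg _).trans (hR x hx)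
      simp only [mem_ofPred_eq] at hz hz'
      linarith)
    (fun z hz => (lt_abs.1 (hXR z hz)).imp id fun h => by
      simp only [mem_ofPred_eq]; linarith)
  rcases hsub with hsub | hsub
  · have h1 := hf.bool_unique (g := (1 : G)) (by simpa using hxs)
      (by simpa using hRt _ (hR0.trans_lt (hsub hxX)))
    have h2 := hf'.bool_unique (g := (1 : G)) (by simpa using hys)
      (by simpa using hRt' _ (hR1.trans_lt (hsub hyX)))
    exact hdb (h2.trans h1.symm)
  · have h1 := hf.bool_unique (g := (1 : G)) (by simpa using hxs)
      (by simpa using hRf _ ((hsub hxX).trans_le (neg_le_neg hR0)))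
    have h2 := hf'.bool_unique (g := (1 : G)) (by simpa using hys)
      (by simpa using hRf' _ ((hsub hyX).trans_le (neg_le_neg hR1)))
    exact hdb (h2.trans h1.symm)

/-- Separating curves with disjoint compact elevations are disjoint. -/
theorem disjoint_image_range (hs : Sys p t) (hf : Curve p f) (hf' : Curve p f')
    [ConnectedSpace S] (hsep : ¬ IsPreconnected (p '' range f)ᶜ)
    (hM : ¬ ∃ e : C(MobiusBand, S), Function.Injective e) (hd : Disjoint (range f) (range f')) :
    Disjoint (p '' range f) (p '' range f') := by
  have hLM : Disjoint (line f') (line f) := hd.symm.preimage _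
  obtain ⟨c, hc⟩ := hs.exists_coloring hf hsep
  obtain ⟨b, hb⟩ := hf.exists_subset_side hf'.isPreconnected_line hf'.nonempty_line hLM
  have hK := hf.side_subset_side hf'.toEssLoop hb
  have key : ∀ g : G, g ∉ Subgroup.zpowers t → line f ⊆ g • side f b →
      line f' ⊆ g • side f b := fun g hg h => by
    have hg' : g⁻¹ ∉ Subgroup.zpowers t := fun h => hg (inv_mem_iff.1 h)
    have h1 := hs.smul_line_subset_side hf.toEssLoop hf' hg'
      (fun h => hg' (hs.mem_zpowers_of_comm hf hsep hM h)) (b := b)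
      (by rwa [smul_set_subset_iff_subset_inv_smul_set, inv_inv])
    rw [smul_set_subset_iff_subset_inv_smul_set, inv_inv] at h1
    exact h1.trans (smul_set_mono hK)
  rw [disjoint_right]
  rintro _ ⟨w, hw, rfl⟩ hmem
  have hw0 : w ≠ 0 := fun h => hf'.zero_notMem (h ▸ hw)
  rw [← exp_log hw0] at hmem
  obtain ⟨g, hg⟩ := (hs.mem_preimage_iff hf).1 hmem
  have hz : log w ∈ line f' := by rwa [line, mem_preimage, exp_log hw0]
  by_cases hgT : g ∈ Subgroup.zpowers t
  · rw [hs.smul_line hgT] at hg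
    exact disjoint_left.1 hLM hz hg
  have hdis := hs.disjoint_smul_line hf hgT
  obtain ⟨d, hd'⟩ := hf.exists_subset_side (hf.isPreconnected_smul_line g)
    hf.nonempty_line.smul_set hdis
  obtain rfl : b = d := hf.bool_unique (g := (1 : G)) (by simpa using hb hz) (by simpa using hd' hg)
  obtain ⟨e, he⟩ := hf.exists_subset_smul_side hf.isPreconnected_line hf.nonempty_line hdis.symm
  by_cases heb : e = b
  · subst heb
    exact disjoint_left.1 (EssLoop.disjoint_of_subset_smul_side (key g hgT he)) hz hg
  · obtain rfl : e = !b := by revert heb; cases b <;> cases e <;> simp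
    obtain ⟨h, h1, h2, h3⟩ := hs.exists_between hf hc hd' he
    have hhT : h ∉ Subgroup.zpowers t := fun hh => by
      rw [hs.smul_line hh] at h2
      obtain ⟨y, hy⟩ := hf.nonempty_line
      exact disjoint_left.1 (EssLoop.disjoint_line b) hy (h2 hy)
    exact disjoint_left.1 (hf.disjoint_smul_side_not h b) (key h hhT h1 hz) (h3 hg)

end Sys
end PlaneTop

namespace PlaneTop
open Filter Metric Topology Complex
open scoped Pointwise

/-- Polar coordinates: the punctured plane is an open annulus. -/
theorem exists_polar : ∃ (A : ℂ → Circle1 × ℝ) (χ : Circle1 × ℝ → ℂ), Continuous (A ∘ exp) ∧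
    Continuous χ ∧ (∀ x, χ x ≠ 0) ∧ (∀ x, A (χ x) = x) ∧ ∀ w ≠ 0, χ (A w) = w := by
  have hπ : (2 * Real.pi : ℝ) ≠ 0 := by positivity
  set P : ℂ → Circle1 × ℝ := fun z => (((z.im / (2 * Real.pi) : ℝ) : Circle1), z.re) with hP
  set χ : Circle1 × ℝ → ℂ := fun x => exp x.2 * AddCircle.toCircle x.1 with hχ
  have hχP : ∀ z, χ (P z) = exp z := fun z => by
    simp only [hχ, hP, AddCircle.toCircle_apply_mk, Circle.coe_exp, ← exp_add]
    congr 1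
    rw [div_one, mul_div_cancel₀ _ hπ, re_add_im]
  have hPsurj : ∀ x, ∃ z, P z = x := by
    rintro ⟨θ, r⟩
    obtain ⟨s, rfl⟩ := QuotientAddGroup.mk_surjective θ
    refine ⟨⟨r, s * (2 * Real.pi)⟩, ?_⟩
    simp only [hP, mul_div_cancel_right₀ _ hπ]
  have hper : ∀ z w, exp z = exp w → P z = P w := fun z w h => by
    obtain ⟨n, hn⟩ := exp_eq_exp_iff_exists_int.1 h
    rw [hn]
    refine Prod.ext ?_ (by simp [hP])
    simp only [hP]
    rw [show (w + n * (2 * Real.pi * I)).im / (2 * Real.pi) = w.im / (2 * Real.pi) + n by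
      simp; field_simp, AddCircle.coe_add]
    have h1 : ((n : ℝ) : Circle1) = 0 := (AddCircle.coe_eq_zero_iff 1).2 ⟨n, by simp⟩
    rw [h1, add_zero]
  have hPexp : ∀ z, P (log (exp z)) = P z := fun z => hper _ _ (exp_log (exp_ne_zero z))
  refine ⟨fun w => P (log w), χ, ?_, ?_, fun x => ?_, fun x => ?_, fun w hw => ?_⟩
  · have : Continuous P := by
      refine Continuous.prodMk ?_ continuous_re
      exact (AddCircle.continuous_mk' 1).comp (continuous_im.div_const _)
    exact this.congr fun z => (hPexp z).symm
  · refine (continuous_exp.comp (continuous_ofReal.comp continuous_snd)).mul ?_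
    exact continuous_subtype_val.comp (AddCircle.continuous_toCircle.comp continuous_fst)
  · exact mul_ne_zero (exp_ne_zero _) (Circle.coe_ne_zero _)
  · obtain ⟨z, rfl⟩ := hPsurj x
    simp only [hχP, hPexp]
  · simp only [hχP, exp_log hw]

theorem exp_injOn_ball (z : ℂ) : InjOn exp (ball z 1) := by
  intro x hx y hy h
  obtain ⟨n, hn⟩ := exp_eq_exp_iff_exists_int.1 h
  have h1 : dist x y < 2 := by
    linarith [dist_triangle_right x y z, mem_ball.1 hx, mem_ball.1 hy]
  rw [dist_eq, hn, add_sub_cancel_left, norm_mul, norm_mul, norm_mul, norm_I, norm_intCast,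
    norm_real, Real.norm_of_nonneg Real.pi_pos.le] at h1
  by_cases h0 : n = 0
  · simpa [h0] using hn
  have h2 : (1:ℝ) ≤ |(n : ℝ)| := by exact_mod_cast Int.one_le_abs h0
  norm_num at h1
  nlinarith [Real.pi_gt_three]

theorem surjective_of_isCoveringMap {X Y : Type*} [TopologicalSpace X] [TopologicalSpace Y]
    [Nonempty X] [PreconnectedSpace Y] {p : X → Y} (hp : IsCoveringMap p) :
    Function.Surjective p := by
  rw [← range_eq_univ]
  refine IsClopen.eq_univ ⟨⟨isOpen_iff_mem_nhds.2 fun x hx => ?_⟩, hp.isOpenMap.isOpen_range⟩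
    (range_nonempty p)
  obtain ⟨-, U, hxU, hU, -, H, -⟩ := hp x
  refine mem_of_superset (hU.mem_nhds hxU) ?_
  rintro _ hy ⟨e, rfl⟩
  obtain ⟨e', he'⟩ := (H ⟨e, hy⟩).2
  exact hx (Exists.intro e' he')

/-- The group of homeomorphisms of the plane over `q`. -/
def Deck {S : Type*} (q : ℂ → S) : Subgroup (ℂ ≃ₜ ℂ) where
  carrier := {g | ∀ z, q (g z) = q z}
  one_mem' _ := rfl
  mul_mem' {g h} hg hh z := (hg (h z)).trans (hh z)
  inv_mem' {g} hg z := by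
    have := hg (g.symm z)
    rw [g.apply_symm_apply] at this
    exact this.symm

variable {S : Type*} [TopologicalSpace S] {q : ℂ → S}

instance : MulAction (Deck q) ℂ where
  smul g z := g.1 z
  one_smul _ := rfl
  mul_smul _ _ _ := rfl

instance : ContinuousConstSMul (Deck q) ℂ where
  continuous_const_smul g := g.1.continuous

/-- The translation by `2πi`, as a deck transformation over `z ↦ p (exp z)`. -/
def deckTranslation (p : ℂ → S) : Deck fun z => p (exp z) :=
  ⟨Homeomorph.addRight (2 * Real.pi * I), fun z => by
    change p (exp (z + 2 * Real.pi * I)) = p (exp z)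
    rw [exp_periodic z]⟩

omit [TopologicalSpace S] in
theorem exists_deck (hq : IsLocallyInjective q)
    (hlift : ∀ z w, q z = q w → ∃ g : C(ℂ, ℂ), (∀ x, q (g x) = q x) ∧ g z = w) {z w : ℂ}
    (h : q z = q w) : ∃ g : Deck q, g • z = w := by
  obtain ⟨g, hg, hgz⟩ := hlift z w h
  obtain ⟨g', hg', hgw⟩ := hlift w z h.symm
  have huniq : ∀ f f' : C(ℂ, ℂ), (∀ x, q (f x) = q x) → (∀ x, q (f' x) = q x) → f z = z → f' w = w →
      f = ContinuousMap.id ℂ ∧ f' = ContinuousMap.id ℂ := fun f f' h1 h2 h3 h4 =>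
    ⟨ContinuousMap.coe_injective ((T2Space.isSeparatedMap q).eq_of_comp_eq hq f.continuous
      continuous_id (funext h1) z h3), ContinuousMap.coe_injective
        ((T2Space.isSeparatedMap q).eq_of_comp_eq hq f'.continuous continuous_id (funext h2) w h4)⟩
  obtain ⟨h1, h2⟩ := huniq (g'.comp g) (g.comp g') (fun x => (hg' _).trans (hg x))
    (fun x => (hg _).trans (hg' x)) (by simp [hgz, hgw]) (by simp [hgz, hgw])
  exact ⟨⟨⟨⟨g, g', DFunLike.congr_fun h1, DFunLike.congr_fun h2⟩, g.continuous, g'.continuous⟩,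
    hg⟩, hgz⟩

theorem sys_of_isCoveringMap [PreconnectedSpace S] {T : Type*} [TopologicalSpace T] {P : T → S}
    (hP : IsCoveringMap P) {A : ℂ → T} {χ : T → ℂ} (hA : Continuous (A ∘ exp)) (hχ : Continuous χ)
    (hχ0 : ∀ x, χ x ≠ 0) (hAχ : ∀ x, A (χ x) = x) (hχA : ∀ w ≠ 0, χ (A w) = w) :
    Sys (fun w => P (A w)) (deckTranslation fun w => P (A w)) := by
  have : Nonempty T := ⟨A 0⟩
  have hcont : Continuous fun z => P (A (exp z)) := hP.continuous.comp hA
  have hloc : ∀ z, ∃ V ∈ 𝓝 z, InjOn (fun z => P (A (exp z))) V := fun z => by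
    obtain ⟨U, hU, hzU, hinj⟩ := hP.isLocalHomeomorph.isLocallyInjective (A (exp z))
    refine ⟨ball z 1 ∩ (A ∘ exp) ⁻¹' U, inter_mem (ball_mem_nhds z one_pos)
      (hA.continuousAt.preimage_mem_nhds (hU.mem_nhds hzU)), fun x hx y hy h => ?_⟩
    refine exp_injOn_ball z hx.1 hy.1 ?_
    rw [← hχA _ (exp_ne_zero x), ← hχA _ (exp_ne_zero y)]
    exact congrArg χ (hinj hx.2 hy.2 h)
  have hlift : ∀ z w, P (A (exp z)) = P (A (exp w)) →
      ∃ g : C(ℂ, ℂ), (∀ x, P (A (exp (g x))) = P (A (exp x))) ∧ g z = w := fun z w h => by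
    obtain ⟨F, ⟨hF, hFp⟩, -⟩ := hP.existsUnique_continuousMap_lifts ⟨_, hcont⟩ z (A (exp w)) h.symm
    obtain ⟨l, hl, hl'⟩ := exists_log_of_continuous (hχ.comp F.continuous) fun x => hχ0 _
    have h1 : exp (l z) = exp w := by
      rw [hl', Function.comp_apply, hF, hχA _ (exp_ne_zero w)]
    refine ⟨⟨fun x => l x + (w - l z), by fun_prop⟩, fun x => ?_, by simp⟩
    have h2 : exp (l x + (w - l z)) = χ (F x) := by
      rw [exp_add, exp_sub, h1, div_self (exp_ne_zero w), mul_one, hl', Function.comp_apply]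
    rw [ContinuousMap.coe_mk, h2, hAχ]
    exact congrFun hFp x
  have hinj : IsLocallyInjective fun z => P (A (exp z)) := by
    rw [isLocallyInjective_iff_nhds]
    exact hloc
  refine ⟨hcont, fun U hU => ?_, hloc, fun x => ?_, fun g z => g.2 z,
    fun z w h => exists_deck hinj hlift h, fun g z h => ?_, fun z => rfl⟩
  · have h1 : (fun z => P (A (exp z))) '' U = P '' (χ ⁻¹' (exp '' U)) := by
      ext y
      constructor
      · rintro ⟨z, hz, rfl⟩
        exact ⟨A (exp z), ⟨z, hz, (hχA _ (exp_ne_zero z)).symm⟩, rfl⟩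
      · rintro ⟨x, ⟨z, hz, hzx⟩, rfl⟩
        refine ⟨z, hz, ?_⟩
        simp only [hzx, hAχ]
    rw [h1]
    exact hP.isOpenMap _ ((isOpenMap_exp U hU).preimage hχ)
  · obtain ⟨x, rfl⟩ := surjective_of_isCoveringMap hP x
    exact ⟨log (χ x), by simp only [exp_log (hχ0 x), hAχ]⟩
  · refine Subtype.ext (Homeomorph.ext fun x => congrFun ((T2Space.isSeparatedMap _).eq_of_comp_eq
      hinj g.1.continuous continuous_id (funext g.2) z h) x)

/-- The compact elevation of an essential curve, in polar coordinates. -/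
theorem exists_curve [T2Space S] {T : Type*} [TopologicalSpace T] {P : T → S} (hP : Continuous P)
    {A : ℂ → T} {χ : T → ℂ} (hA : Continuous (A ∘ exp)) (hχ : Continuous χ)
    (hχ0 : ∀ x, χ x ≠ 0) (hAχ : ∀ x, A (χ x) = x) {K : Set T} (hK : IsCompact K) {c : C(Circle1, S)}
    (hc : Function.Injective c) (hess : ¬ ∃ x, c.Homotopic (ContinuousMap.const Circle1 x))
    (hbij : BijOn P K (range c)) :
    ∃ f, Curve (fun w => P (A w)) f ∧ (fun w => P (A w)) '' range f = range c ∧ range f = χ '' K := by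
  have hne : Nonempty T := ⟨A 0⟩
  set g := Function.invFunOn P K
  have hgP : ∀ x ∈ K, g (P x) = x := hbij.injOn.leftInvOn_invFunOn
  have hPg : ∀ y ∈ range c, P (g y) = y := fun y hy =>
    Function.invFunOn_eq (hbij.surjOn hy)
  have hgc : ContinuousOn g (range c) := by
    rw [← hbij.image_eq]
    exact continuousOn_leftInverse_of_isCompact hK hP.continuousOn hgP
  have hF : Continuous fun θ => g (c θ) :=
    continuousOn_univ.1 (hgc.comp c.continuous.continuousOn fun θ _ => mem_range_self θ)
  have hPF : ∀ θ, P (g (c θ)) = c θ := fun θ => hPg _ (mem_range_self θ)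
  set f : Circle1 → ℂ := fun θ => χ (g (c θ)) with hf
  have hAf : ∀ θ, A (f θ) = g (c θ) := fun θ => hAχ _
  have hpf : ∀ θ, P (A (f θ)) = c θ := fun θ => by rw [hAf, hPF]
  have hfc : Continuous f := hχ.comp hF
  have hfi : Function.Injective f := fun θ θ' h => hc (by rw [← hpf, ← hpf, h])
  have hemb : IsEmbedding f := (hfc.isClosedEmbedding hfi).isEmbedding
  have hrange : range f = χ '' K := by
    ext w
    constructor
    · rintro ⟨θ, rfl⟩
      exact ⟨_, Function.invFunOn_mem (hbij.surjOn (mem_range_self θ)), rfl⟩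
    · rintro ⟨x, hx, rfl⟩
      obtain ⟨θ, hθ⟩ := hbij.mapsTo hx
      exact ⟨θ, by simp only [hf, hθ, hgP x hx]⟩
  refine ⟨f, ⟨⟨hemb, ?_, fun hfar => hess ?_⟩, ?_⟩, ?_, hrange⟩
  · rintro ⟨θ, h⟩
    exact hχ0 _ h
  · obtain ⟨l, hl, hl'⟩ := hfar.hasLog (isCompact_range_loop hemb)
    have hlf : Continuous fun θ => l (f θ) :=
      continuousOn_univ.1 (hl.comp hfc.continuousOn fun θ _ => mem_range_self θ)
    obtain ⟨y, ⟨H⟩⟩ := (id_nullhomotopic ℂ).comp_left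
      (⟨fun θ => l (f θ), hlf⟩ : C(Circle1, ℂ))
    set Q : C(ℂ, S) := ⟨fun z => P (A (exp z)), hP.comp hA⟩
    have hQ : Q.comp ⟨fun θ => l (f θ), hlf⟩ = c := by
      ext θ
      change P (A (exp (l (f θ)))) = c θ
      refine (congrArg (fun z => P (A z)) ((hl' _ (mem_range_self θ)).trans (sub_zero _))).trans (hpf θ)
    refine ⟨Q y, ?_⟩
    have h2 := (ContinuousMap.Homotopic.refl Q).comp ⟨H⟩
    rw [ContinuousMap.id_comp, hQ] at h2
    exact h2
  · rintro _ ⟨θ, rfl⟩ _ ⟨θ', rfl⟩ h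
    simp only [hpf] at h
    rw [hc h]
  · rw [← range_comp]
    exact congrArg range (funext hpf)

/-- Separating essential curves meet only if their compact elevations to an annular cover do. -/
theorem nonempty_inter_hatSet {S : Type} [TopologicalSpace S] [T2Space S] [ConnectedSpace S]
    (hM : ¬ ∃ e : C(MobiusBand, S), Function.Injective e) {β γ : Set S}
    (hβ : IsEssentialSCC β) (hγ : IsEssentialSCC γ) (hsep : IsSeparating β) {C : AnnCover S}
    (D : CurveLift C β) (E : CurveLift C γ) (h : (β ∩ γ).Nonempty) :
    (hatSet D ∩ hatSet E).Nonempty := by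
  obtain ⟨A, χ, hA, hχ, hχ0, hAχ, hχA⟩ := exists_polar
  obtain ⟨e⟩ := C.annulus
  have hA' : Continuous ((fun w => e.symm (A w)) ∘ exp) := e.symm.continuous.comp hA
  have hχ' : Continuous fun x => χ (e x) := hχ.comp e.continuous
  have hχ0' : ∀ x, χ (e x) ≠ 0 := fun x => hχ0 _
  have hAχ' : ∀ x, e.symm (A (χ (e x))) = x := fun x => by rw [hAχ, e.symm_apply_apply]
  have hs := sys_of_isCoveringMap C.cov hA' hχ' hχ0' hAχ' fun w hw => by
    rw [e.apply_symm_apply, hχA w hw]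
  obtain ⟨⟨c, hc, rfl⟩, hcess⟩ := hβ
  obtain ⟨⟨c', hc', rfl⟩, hcess'⟩ := hγ
  obtain ⟨f, hf, hfr, hfK⟩ := exists_curve C.cov.continuous hA' hχ' hχ0' hAχ' D.compact hc
    (hcess c rfl) D.bij
  obtain ⟨f', hf', hfr', hfK'⟩ := exists_curve C.cov.continuous hA' hχ' hχ0' hAχ' E.compact hc'
    (hcess' c' rfl) E.bij
  by_contra hne
  refine not_disjoint_iff_nonempty_inter.2 h ?_
  rw [← hfr, ← hfr']
  refine hs.disjoint_image_range hf hf' (by rwa [hfr]) hM ?_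
  rw [hfK, hfK', disjoint_image_iff
    (Function.LeftInverse.injective (g := fun w => e.symm (A w)) hAχ')]
  exact disjoint_iff_inter_eq_empty.2 (not_nonempty_iff_eq_empty.1 hne)

end PlaneTop

/-- Let `S` be a closed orientable surface of genus `g ≥ 2`.  If two
isotopic separating essential simple closed curves `β` and `γ` intersect, then their
compact elevations in the annular cover corresponding to their common isotopy class also
intersect. -/
theorem stmt11 (g : ℕ) (hg : 2 ≤ g)
    (S : Type) [TopologicalSpace S] (hS : IsOrientedSurface g 0 S ∅)
    (βc γc : Set S) (hβ : IsEssentialCurve ∅ βc) (hγ : IsEssentialCurve ∅ γc)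
    (hβsep : IsSeparating βc) (hγsep : IsSeparating γc)
    (hiso : CurvesIsotopic βc γc)
    (C : AnnCover S) (Dβ : CurveLift C βc) (Dγ : CurveLift C γc)
    (hint : (βc ∩ γc).Nonempty) :
    (hatSet Dβ ∩ hatSet Dγ).Nonempty := by
  obtain ⟨-, _, _, -, -, -, -, -, hM, -⟩ := hS
  exact PlaneTop.nonempty_inter_hatSet hM hβ.2.1 hγ.2.1 hβsep Dβ Dγ hint
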